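/- The even hyperbolic lattice U ⊕ D₈ ⊕ D₈ (the 2-elementary lattice with invariants (r,a,δ) = (18,4,0)) is reflective: the subgroup W_r of O(S) generated by reflections in all roots has finite index in O(S). -/

import Mathlib

open Matrix

/-- The bilinear form on `ℤⁿ` associated to a Gram matrix `G`. -/
def bform {n : ℕ} (G : Matrix (Fin n) (Fin n) ℤ) (x y : Fin n → ℤ) : ℤ :=
  x ⬝ᵥ G.mulVec y

/-- The orthogonal group `O(S)` of the lattice with Gram matrix `G`:
all `ℤ`-module automorphisms preserving the bilinear form. -/
def OrthGroup (n : ℕ) (G : Matrix (Fin n) (Fin n) ℤ) :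
    Subgroup ((Fin n → ℤ) ≃ₗ[ℤ] (Fin n → ℤ)) where
  carrier := {f | ∀ x y, bform G (f x) (f y) = bform G x y}
  one_mem' := fun _ _ => rfl
  mul_mem' := by
    intro f g hf hg x y
    exact (hf (g x) (g y)).trans (hg x y)
  inv_mem' := by
    intro f hf x y
    have h := (hf (f⁻¹ x) (f⁻¹ y)).symm
    rwa [show f (f⁻¹ x) = x from f.apply_symm_apply x,
      show f (f⁻¹ y) = y from f.apply_symm_apply y] at h

/-- A root: a vector of square `-2`, or of square `-4` whose pairing with
the whole lattice is even. -/
def IsRoot {n : ℕ} (G : Matrix (Fin n) (Fin n) ℤ) (α : Fin n → ℤ) : Prop :=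
  bform G α α = -2 ∨ (bform G α α = -4 ∧ ∀ x : Fin n → ℤ, (2 : ℤ) ∣ bform G α x)

/-- `f` is the reflection in a root `α`. -/
def IsReflection {n : ℕ} (G : Matrix (Fin n) (Fin n) ℤ)
    (f : (Fin n → ℤ) ≃ₗ[ℤ] (Fin n → ℤ)) : Prop :=
  ∃ α : Fin n → ℤ, IsRoot G α ∧
    ∀ x : Fin n → ℤ, f x = x - ((2 * bform G x α) / bform G α α) • α

/-- The subgroup `W_r` of `O(S)` generated by the reflections in all roots. -/
def Wr (n : ℕ) (G : Matrix (Fin n) (Fin n) ℤ) : Subgroup ↥(OrthGroup n G) :=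
  Subgroup.closure {f | IsReflection G f.val}

open Matrix

/-- Orthogonal direct sum of two Gram matrices. -/
def dsum {m k : ℕ} (A : Matrix (Fin m) (Fin m) ℤ) (B : Matrix (Fin k) (Fin k) ℤ) :
    Matrix (Fin (m + k)) (Fin (m + k)) ℤ :=
  Matrix.reindex finSumFinEquiv finSumFinEquiv (Matrix.fromBlocks A 0 0 B)

/-- Gram matrix of the hyperbolic plane `U`. -/
def gramU : Matrix (Fin 2) (Fin 2) ℤ := !![0, 1; 1, 0]

/-- Gram matrix of `A₁ = ⟨-2⟩`. -/
def gramA1 : Matrix (Fin 1) (Fin 1) ℤ := !![-2]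

/-- Gram matrix (= negative Cartan matrix) of a simply laced root lattice with
given Dynkin diagram edges. -/
def adjGram (n : ℕ) (E : List (ℕ × ℕ)) : Matrix (Fin n) (Fin n) ℤ :=
  Matrix.of fun i j =>
    if i = j then -2 else if (i.1, j.1) ∈ E ∨ (j.1, i.1) ∈ E then 1 else 0

/-- Gram matrix of the negative definite root lattice `Dₙ`
(in the root basis `e₁+e₂, e₂-e₁, e₃-e₂, …, eₙ-eₙ₋₁` of `{x ∈ ℤⁿ : Σxᵢ even}`
with the negative of the standard Euclidean form). -/
def gramD (n : ℕ) : Matrix (Fin n) (Fin n) ℤ :=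
  adjGram n ((0, 2) :: (List.range (n - 2)).map fun k => (k + 1, k + 2))

/-- Gram matrix (negative Cartan matrix) of `E₈`. -/
def gramE8 : Matrix (Fin 8) (Fin 8) ℤ :=
  adjGram 8 [(0, 2), (1, 3), (2, 3), (3, 4), (4, 5), (5, 6), (6, 7)]

/-- Gram matrix (negative Cartan matrix) of `E₇`. -/
def gramE7 : Matrix (Fin 7) (Fin 7) ℤ :=
  adjGram 7 [(0, 2), (1, 3), (2, 3), (3, 4), (4, 5), (5, 6)]

/-- The Gram matrix of the even 2-elementary hyperbolic lattice `U ⊕ D₈ ⊕ D₈`,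
with invariants `(r,a,δ) = (18,4,0)`. -/
def gramS :=
  dsum gramU (dsum (gramD 8) (gramD 8))

namespace ReflectiveLattice

/-- A functional, given by its positive and its negative coefficients. -/
abbrev Facet := List ℕ × List ℕ

set_option maxRecDepth 100000

/-- The facets of the cone. -/
def facetList : List Facet :=
  [([0, 0, 1, 0, 0, 0, 0, 0, 0, 0, 0, 0, 0, 0, 0, 0, 0, 0], [0, 0, 0, 0, 0, 0, 0, 0, 0, 0, 0, 0, 0, 0, 0, 0, 0, 0]),
   ([0, 0, 0, 1, 0, 0, 0, 0, 0, 0, 0, 0, 0, 0, 0, 0, 0, 0], [0, 0, 0, 0, 0, 0, 0, 0, 0, 0, 0, 0, 0, 0, 0, 0, 0, 0]),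
   ([0, 0, 0, 0, 1, 0, 0, 0, 0, 0, 0, 0, 0, 0, 0, 0, 0, 0], [0, 0, 0, 0, 0, 0, 0, 0, 0, 0, 0, 0, 0, 0, 0, 0, 0, 0]),
   ([0, 0, 0, 0, 0, 1, 0, 0, 0, 0, 0, 0, 0, 0, 0, 0, 0, 0], [0, 0, 0, 0, 0, 0, 0, 0, 0, 0, 0, 0, 0, 0, 0, 0, 0, 0]),
   ([0, 0, 0, 0, 0, 0, 1, 0, 0, 0, 0, 0, 0, 0, 0, 0, 0, 0], [0, 0, 0, 0, 0, 0, 0, 0, 0, 0, 0, 0, 0, 0, 0, 0, 0, 0]),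
   ([0, 0, 0, 0, 0, 0, 0, 1, 0, 0, 0, 0, 0, 0, 0, 0, 0, 0], [0, 0, 0, 0, 0, 0, 0, 0, 0, 0, 0, 0, 0, 0, 0, 0, 0, 0]),
   ([0, 0, 0, 0, 0, 0, 0, 0, 1, 0, 0, 0, 0, 0, 0, 0, 0, 0], [0, 0, 0, 0, 0, 0, 0, 0, 0, 0, 0, 0, 0, 0, 0, 0, 0, 0]),
   ([0, 0, 0, 0, 0, 0, 0, 0, 0, 1, 0, 0, 0, 0, 0, 0, 0, 0], [0, 0, 0, 0, 0, 0, 0, 0, 0, 0, 0, 0, 0, 0, 0, 0, 0, 0]),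
   ([0, 0, 0, 0, 0, 0, 0, 0, 0, 0, 1, 0, 0, 0, 0, 0, 0, 0], [0, 0, 0, 0, 0, 0, 0, 0, 0, 0, 0, 0, 0, 0, 0, 0, 0, 0]),
   ([0, 0, 0, 0, 0, 0, 0, 0, 0, 0, 0, 1, 0, 0, 0, 0, 0, 0], [0, 0, 0, 0, 0, 0, 0, 0, 0, 0, 0, 0, 0, 0, 0, 0, 0, 0]),
   ([0, 0, 0, 0, 0, 0, 0, 0, 0, 0, 0, 0, 1, 0, 0, 0, 0, 0], [0, 0, 0, 0, 0, 0, 0, 0, 0, 0, 0, 0, 0, 0, 0, 0, 0, 0]),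
   ([0, 0, 0, 0, 0, 0, 0, 0, 0, 0, 0, 0, 0, 1, 0, 0, 0, 0], [0, 0, 0, 0, 0, 0, 0, 0, 0, 0, 0, 0, 0, 0, 0, 0, 0, 0]),
   ([0, 0, 0, 0, 0, 0, 0, 0, 0, 0, 0, 0, 0, 0, 1, 0, 0, 0], [0, 0, 0, 0, 0, 0, 0, 0, 0, 0, 0, 0, 0, 0, 0, 0, 0, 0]),
   ([0, 0, 0, 0, 0, 0, 0, 0, 0, 0, 0, 0, 0, 0, 0, 1, 0, 0], [0, 0, 0, 0, 0, 0, 0, 0, 0, 0, 0, 0, 0, 0, 0, 0, 0, 0]),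
   ([0, 0, 0, 0, 0, 0, 0, 0, 0, 0, 0, 0, 0, 0, 0, 0, 1, 0], [0, 0, 0, 0, 0, 0, 0, 0, 0, 0, 0, 0, 0, 0, 0, 0, 0, 0]),
   ([0, 0, 0, 0, 0, 0, 0, 0, 0, 0, 0, 0, 0, 0, 0, 0, 0, 1], [0, 0, 0, 0, 0, 0, 0, 0, 0, 0, 0, 0, 0, 0, 0, 0, 0, 0]),
   ([1, 0, 0, 0, 0, 0, 0, 0, 0, 0, 0, 0, 0, 0, 0, 0, 0, 0], [0, 0, 1, 1, 1, 1, 0, 0, 0, 0, 0, 0, 0, 0, 0, 0, 0, 0]),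
   ([1, 0, 0, 0, 0, 0, 0, 0, 0, 0, 0, 0, 0, 0, 0, 0, 0, 0], [0, 0, 0, 0, 0, 0, 1, 1, 1, 1, 0, 0, 0, 0, 0, 0, 0, 0]),
   ([1, 0, 0, 0, 0, 0, 0, 0, 0, 0, 0, 0, 0, 0, 0, 0, 0, 0], [0, 0, 0, 0, 0, 0, 0, 0, 0, 0, 1, 1, 1, 1, 0, 0, 0, 0]),
   ([1, 0, 0, 0, 0, 0, 0, 0, 0, 0, 0, 0, 0, 0, 0, 0, 0, 0], [0, 0, 0, 0, 0, 0, 0, 0, 0, 0, 0, 0, 0, 0, 1, 1, 1, 1]),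
   ([0, 1, 0, 0, 0, 0, 0, 0, 0, 0, 0, 0, 0, 0, 0, 0, 0, 0], [0, 0, 1, 0, 0, 0, 1, 0, 0, 0, 1, 0, 0, 0, 1, 0, 0, 0]),
   ([0, 1, 0, 0, 0, 0, 0, 0, 0, 0, 0, 0, 0, 0, 0, 0, 0, 0], [0, 0, 0, 1, 0, 0, 0, 1, 0, 0, 0, 1, 0, 0, 0, 1, 0, 0]),
   ([0, 1, 0, 0, 0, 0, 0, 0, 0, 0, 0, 0, 0, 0, 0, 0, 0, 0], [0, 0, 0, 0, 1, 0, 0, 0, 1, 0, 0, 0, 1, 0, 0, 0, 1, 0]),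
   ([0, 1, 0, 0, 0, 0, 0, 0, 0, 0, 0, 0, 0, 0, 0, 0, 0, 0], [0, 0, 0, 0, 0, 1, 0, 0, 0, 1, 0, 0, 0, 1, 0, 0, 0, 1]),
   ([1, 1, 0, 0, 0, 0, 0, 0, 0, 0, 0, 0, 0, 0, 0, 0, 0, 0], [0, 0, 1, 0, 0, 0, 0, 1, 0, 0, 0, 0, 1, 0, 0, 0, 0, 1]),
   ([1, 1, 0, 0, 0, 0, 0, 0, 0, 0, 0, 0, 0, 0, 0, 0, 0, 0], [0, 0, 1, 0, 0, 0, 0, 1, 0, 0, 0, 0, 0, 1, 0, 0, 1, 0]),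
   ([1, 1, 0, 0, 0, 0, 0, 0, 0, 0, 0, 0, 0, 0, 0, 0, 0, 0], [0, 0, 1, 0, 0, 0, 0, 0, 1, 0, 0, 1, 0, 0, 0, 0, 0, 1]),
   ([1, 1, 0, 0, 0, 0, 0, 0, 0, 0, 0, 0, 0, 0, 0, 0, 0, 0], [0, 0, 1, 0, 0, 0, 0, 0, 1, 0, 0, 0, 0, 1, 0, 1, 0, 0]),
   ([1, 1, 0, 0, 0, 0, 0, 0, 0, 0, 0, 0, 0, 0, 0, 0, 0, 0], [0, 0, 1, 0, 0, 0, 0, 0, 0, 1, 0, 1, 0, 0, 0, 0, 1, 0]),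
   ([1, 1, 0, 0, 0, 0, 0, 0, 0, 0, 0, 0, 0, 0, 0, 0, 0, 0], [0, 0, 1, 0, 0, 0, 0, 0, 0, 1, 0, 0, 1, 0, 0, 1, 0, 0]),
   ([1, 1, 0, 0, 0, 0, 0, 0, 0, 0, 0, 0, 0, 0, 0, 0, 0, 0], [0, 0, 0, 1, 0, 0, 1, 0, 0, 0, 0, 0, 1, 0, 0, 0, 0, 1]),
   ([1, 1, 0, 0, 0, 0, 0, 0, 0, 0, 0, 0, 0, 0, 0, 0, 0, 0], [0, 0, 0, 1, 0, 0, 1, 0, 0, 0, 0, 0, 0, 1, 0, 0, 1, 0]),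
   ([1, 1, 0, 0, 0, 0, 0, 0, 0, 0, 0, 0, 0, 0, 0, 0, 0, 0], [0, 0, 0, 1, 0, 0, 0, 0, 1, 0, 1, 0, 0, 0, 0, 0, 0, 1]),
   ([1, 1, 0, 0, 0, 0, 0, 0, 0, 0, 0, 0, 0, 0, 0, 0, 0, 0], [0, 0, 0, 1, 0, 0, 0, 0, 1, 0, 0, 0, 0, 1, 1, 0, 0, 0]),
   ([1, 1, 0, 0, 0, 0, 0, 0, 0, 0, 0, 0, 0, 0, 0, 0, 0, 0], [0, 0, 0, 1, 0, 0, 0, 0, 0, 1, 1, 0, 0, 0, 0, 0, 1, 0]),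
   ([1, 1, 0, 0, 0, 0, 0, 0, 0, 0, 0, 0, 0, 0, 0, 0, 0, 0], [0, 0, 0, 1, 0, 0, 0, 0, 0, 1, 0, 0, 1, 0, 1, 0, 0, 0]),
   ([1, 1, 0, 0, 0, 0, 0, 0, 0, 0, 0, 0, 0, 0, 0, 0, 0, 0], [0, 0, 0, 0, 1, 0, 1, 0, 0, 0, 0, 1, 0, 0, 0, 0, 0, 1]),
   ([1, 1, 0, 0, 0, 0, 0, 0, 0, 0, 0, 0, 0, 0, 0, 0, 0, 0], [0, 0, 0, 0, 1, 0, 1, 0, 0, 0, 0, 0, 0, 1, 0, 1, 0, 0]),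
   ([1, 1, 0, 0, 0, 0, 0, 0, 0, 0, 0, 0, 0, 0, 0, 0, 0, 0], [0, 0, 0, 0, 1, 0, 0, 1, 0, 0, 1, 0, 0, 0, 0, 0, 0, 1]),
   ([1, 1, 0, 0, 0, 0, 0, 0, 0, 0, 0, 0, 0, 0, 0, 0, 0, 0], [0, 0, 0, 0, 1, 0, 0, 1, 0, 0, 0, 0, 0, 1, 1, 0, 0, 0]),
   ([1, 1, 0, 0, 0, 0, 0, 0, 0, 0, 0, 0, 0, 0, 0, 0, 0, 0], [0, 0, 0, 0, 1, 0, 0, 0, 0, 1, 1, 0, 0, 0, 0, 1, 0, 0]),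
   ([1, 1, 0, 0, 0, 0, 0, 0, 0, 0, 0, 0, 0, 0, 0, 0, 0, 0], [0, 0, 0, 0, 1, 0, 0, 0, 0, 1, 0, 1, 0, 0, 1, 0, 0, 0]),
   ([1, 1, 0, 0, 0, 0, 0, 0, 0, 0, 0, 0, 0, 0, 0, 0, 0, 0], [0, 0, 0, 0, 0, 1, 1, 0, 0, 0, 0, 1, 0, 0, 0, 0, 1, 0]),
   ([1, 1, 0, 0, 0, 0, 0, 0, 0, 0, 0, 0, 0, 0, 0, 0, 0, 0], [0, 0, 0, 0, 0, 1, 1, 0, 0, 0, 0, 0, 1, 0, 0, 1, 0, 0]),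
   ([1, 1, 0, 0, 0, 0, 0, 0, 0, 0, 0, 0, 0, 0, 0, 0, 0, 0], [0, 0, 0, 0, 0, 1, 0, 1, 0, 0, 1, 0, 0, 0, 0, 0, 1, 0]),
   ([1, 1, 0, 0, 0, 0, 0, 0, 0, 0, 0, 0, 0, 0, 0, 0, 0, 0], [0, 0, 0, 0, 0, 1, 0, 1, 0, 0, 0, 0, 1, 0, 1, 0, 0, 0]),
   ([1, 1, 0, 0, 0, 0, 0, 0, 0, 0, 0, 0, 0, 0, 0, 0, 0, 0], [0, 0, 0, 0, 0, 1, 0, 0, 1, 0, 1, 0, 0, 0, 0, 1, 0, 0]),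
   ([1, 1, 0, 0, 0, 0, 0, 0, 0, 0, 0, 0, 0, 0, 0, 0, 0, 0], [0, 0, 0, 0, 0, 1, 0, 0, 1, 0, 0, 1, 0, 0, 1, 0, 0, 0])]

/-- Representatives of the extreme rays of the cone. -/
def rayList : List (List ℕ) :=
  [[0, 1, 0, 0, 0, 0, 0, 0, 0, 0, 0, 0, 0, 0, 0, 0, 0, 0],
   [1, 1, 0, 0, 0, 0, 0, 0, 0, 0, 0, 0, 0, 1, 0, 0, 1, 0],
   [1, 2, 0, 0, 0, 1, 0, 0, 0, 1, 0, 0, 1, 0, 0, 0, 1, 0],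
   [1, 2, 0, 0, 0, 1, 0, 0, 0, 1, 0, 0, 1, 0, 0, 1, 0, 0],
   [2, 2, 0, 0, 0, 0, 0, 0, 0, 2, 0, 1, 1, 0, 0, 1, 1, 0],
   [2, 2, 0, 0, 0, 0, 0, 0, 0, 2, 0, 1, 1, 0, 1, 0, 1, 0],
   [2, 2, 0, 0, 0, 1, 0, 0, 0, 1, 0, 0, 2, 0, 1, 1, 0, 0],
   [2, 2, 0, 0, 1, 1, 0, 0, 1, 1, 1, 1, 0, 0, 1, 1, 0, 0],
   [2, 2, 0, 0, 1, 1, 0, 1, 0, 1, 1, 0, 1, 0, 1, 1, 0, 0],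
   [2, 3, 0, 0, 0, 2, 0, 0, 1, 1, 0, 0, 2, 0, 1, 1, 0, 0],
   [2, 3, 0, 0, 0, 2, 0, 0, 1, 1, 0, 1, 1, 0, 0, 2, 0, 0],
   [3, 3, 0, 0, 0, 3, 1, 1, 1, 0, 1, 1, 1, 0, 1, 1, 1, 0],
   [3, 3, 0, 0, 1, 2, 0, 2, 1, 0, 1, 1, 0, 1, 2, 0, 1, 0],
   [3, 4, 0, 0, 0, 3, 0, 0, 2, 1, 0, 1, 2, 0, 1, 2, 0, 0],
   [3, 4, 0, 0, 0, 3, 0, 0, 2, 1, 0, 2, 1, 0, 0, 2, 1, 0],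
   [3, 4, 0, 0, 0, 3, 0, 1, 2, 0, 0, 1, 2, 0, 1, 2, 0, 0],
   [5, 6, 0, 0, 1, 4, 0, 3, 0, 2, 2, 3, 0, 0, 4, 0, 1, 0],
   [1, 1, 0, 0, 0, 0, 0, 0, 0, 0, 0, 0, 0, 0, 0, 0, 0, 1],
   [1, 2, 0, 0, 0, 0, 0, 0, 0, 0, 0, 0, 0, 1, 0, 0, 0, 1],
   [1, 2, 0, 0, 0, 0, 0, 0, 0, 1, 0, 0, 0, 1, 0, 0, 1, 0],
   [1, 2, 0, 0, 0, 0, 0, 0, 0, 1, 0, 0, 1, 0, 0, 1, 0, 0],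
   [1, 3, 0, 0, 0, 0, 0, 0, 0, 1, 0, 0, 0, 1, 0, 0, 0, 1],
   [1, 3, 0, 0, 0, 1, 0, 0, 0, 1, 0, 0, 0, 1, 0, 0, 1, 0],
   [1, 3, 0, 0, 0, 1, 0, 0, 1, 0, 0, 1, 0, 0, 1, 0, 0, 0],
   [2, 2, 0, 0, 0, 0, 0, 0, 0, 1, 0, 0, 1, 1, 0, 2, 0, 0],
   [2, 2, 0, 0, 0, 0, 0, 0, 0, 1, 0, 0, 2, 0, 1, 1, 0, 0],
   [2, 2, 0, 0, 0, 1, 0, 0, 1, 1, 1, 1, 0, 0, 1, 1, 0, 0],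
   [2, 2, 0, 0, 0, 1, 0, 1, 1, 0, 1, 0, 1, 0, 1, 1, 0, 0],
   [1, 4, 0, 0, 0, 1, 0, 0, 0, 1, 0, 0, 0, 1, 0, 0, 0, 1],
   [2, 3, 0, 0, 0, 0, 0, 0, 0, 2, 0, 0, 1, 1, 0, 0, 2, 0],
   [2, 3, 0, 0, 0, 0, 0, 0, 0, 2, 0, 0, 1, 1, 0, 2, 0, 0],
   [2, 3, 0, 0, 0, 0, 0, 0, 0, 2, 0, 0, 2, 0, 1, 1, 0, 0],
   [2, 3, 0, 0, 0, 1, 0, 0, 0, 2, 0, 0, 2, 0, 0, 1, 1, 0],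
   [2, 3, 0, 0, 0, 1, 0, 0, 0, 2, 0, 0, 2, 0, 1, 1, 0, 0],
   [2, 3, 0, 0, 0, 1, 0, 0, 1, 1, 0, 0, 2, 0, 0, 2, 0, 0],
   [2, 3, 0, 0, 0, 1, 0, 0, 2, 0, 0, 1, 1, 0, 0, 2, 0, 0],
   [3, 3, 0, 0, 0, 0, 0, 0, 0, 2, 0, 0, 3, 0, 1, 1, 0, 1],
   [3, 3, 0, 0, 0, 0, 0, 0, 0, 3, 0, 1, 2, 0, 1, 1, 1, 0],
   [3, 3, 0, 0, 0, 0, 0, 0, 1, 2, 0, 1, 2, 0, 0, 2, 0, 1],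
   [3, 3, 0, 0, 0, 1, 0, 0, 1, 0, 0, 1, 0, 2, 3, 0, 0, 0],
   [3, 3, 0, 0, 0, 1, 0, 0, 1, 1, 0, 1, 2, 0, 3, 0, 0, 0],
   [3, 3, 0, 0, 0, 1, 0, 0, 1, 2, 1, 2, 0, 0, 2, 1, 0, 0],
   [3, 3, 0, 0, 0, 2, 0, 1, 1, 1, 1, 0, 2, 0, 1, 2, 0, 0],
   [3, 3, 0, 0, 0, 3, 0, 1, 1, 0, 1, 1, 1, 0, 1, 1, 1, 0],
   [3, 4, 0, 0, 0, 0, 0, 0, 0, 3, 0, 0, 3, 0, 0, 1, 1, 1],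
   [3, 4, 0, 0, 0, 0, 0, 0, 0, 3, 0, 0, 3, 0, 1, 1, 0, 1],
   [3, 4, 0, 0, 0, 1, 0, 0, 0, 3, 0, 0, 3, 0, 1, 1, 1, 0],
   [3, 4, 0, 0, 0, 1, 0, 0, 3, 0, 0, 1, 1, 1, 0, 3, 0, 0],
   [3, 4, 0, 0, 0, 2, 0, 0, 0, 2, 0, 0, 3, 0, 0, 2, 1, 0],
   [3, 4, 0, 0, 0, 2, 0, 0, 1, 2, 0, 0, 3, 0, 0, 2, 0, 0],
   [3, 4, 0, 0, 0, 2, 0, 0, 1, 2, 0, 0, 3, 0, 1, 2, 0, 0],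
   [3, 4, 0, 0, 0, 2, 0, 0, 1, 2, 0, 1, 2, 0, 0, 3, 0, 0],
   [3, 4, 0, 0, 0, 2, 0, 0, 1, 2, 0, 1, 2, 0, 3, 0, 0, 0],
   [3, 4, 0, 0, 0, 2, 0, 0, 2, 1, 0, 0, 2, 1, 0, 3, 0, 0],
   [3, 4, 0, 0, 0, 2, 0, 0, 2, 1, 0, 1, 2, 0, 0, 3, 0, 0],
   [3, 5, 0, 0, 0, 3, 0, 0, 1, 2, 0, 0, 3, 0, 0, 2, 1, 0],
   [3, 5, 0, 0, 0, 3, 0, 0, 1, 2, 0, 1, 2, 0, 3, 0, 0, 0],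
   [3, 5, 0, 0, 0, 3, 0, 0, 1, 2, 0, 3, 0, 0, 1, 2, 0, 0],
   [3, 5, 0, 0, 0, 3, 0, 0, 2, 1, 0, 0, 2, 1, 0, 3, 0, 0],
   [4, 4, 0, 0, 0, 0, 0, 0, 1, 3, 0, 0, 3, 1, 2, 2, 0, 0],
   [4, 4, 0, 0, 0, 1, 0, 0, 2, 2, 0, 1, 2, 1, 4, 0, 0, 0],
   [4, 4, 0, 0, 0, 1, 0, 0, 4, 0, 1, 1, 0, 2, 2, 2, 0, 0],
   [4, 4, 0, 0, 0, 3, 0, 2, 2, 0, 2, 1, 1, 0, 2, 1, 1, 0],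
   [4, 4, 0, 0, 1, 3, 0, 2, 2, 0, 2, 1, 0, 1, 2, 1, 1, 0],
   [4, 5, 0, 0, 0, 0, 0, 0, 0, 4, 0, 0, 3, 1, 0, 2, 2, 0],
   [4, 5, 0, 0, 0, 0, 0, 0, 0, 4, 0, 0, 3, 1, 2, 2, 0, 0],
   [4, 5, 0, 0, 0, 0, 0, 0, 0, 4, 0, 0, 4, 0, 1, 1, 1, 1],
   [4, 5, 0, 0, 0, 2, 0, 0, 1, 3, 0, 0, 4, 0, 2, 2, 0, 0],
   [4, 5, 0, 0, 0, 2, 0, 0, 1, 3, 0, 2, 2, 0, 4, 0, 0, 0],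
   [4, 5, 0, 0, 0, 2, 0, 0, 2, 2, 0, 0, 3, 1, 0, 4, 0, 0],
   [4, 5, 0, 0, 0, 2, 0, 0, 2, 2, 0, 1, 3, 0, 0, 4, 0, 0],
   [4, 5, 0, 0, 0, 2, 0, 0, 2, 2, 0, 1, 3, 0, 4, 0, 0, 0],
   [4, 5, 0, 0, 0, 3, 0, 1, 3, 0, 2, 0, 2, 0, 3, 1, 0, 0],
   [4, 5, 0, 0, 0, 4, 0, 0, 2, 1, 0, 1, 3, 0, 2, 2, 0, 0],
   [4, 5, 0, 0, 0, 4, 0, 0, 2, 1, 0, 2, 2, 0, 0, 3, 1, 0],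
   [4, 5, 0, 0, 0, 4, 0, 0, 2, 1, 0, 2, 2, 0, 1, 3, 0, 0],
   [4, 5, 0, 0, 1, 3, 0, 2, 0, 2, 0, 3, 1, 0, 3, 0, 1, 0],
   [4, 6, 0, 0, 0, 3, 0, 0, 1, 3, 0, 0, 4, 0, 0, 3, 1, 0],
   [4, 6, 0, 0, 0, 3, 0, 0, 4, 0, 0, 3, 1, 0, 0, 3, 1, 0],
   [4, 6, 0, 0, 0, 4, 0, 0, 2, 2, 0, 1, 3, 0, 3, 0, 1, 0],
   [4, 6, 0, 0, 0, 4, 0, 0, 2, 2, 1, 3, 0, 0, 1, 3, 0, 0],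
   [4, 6, 0, 0, 0, 4, 0, 0, 3, 1, 0, 0, 3, 1, 1, 3, 0, 0],
   [4, 6, 0, 0, 0, 4, 0, 0, 3, 1, 0, 1, 3, 0, 0, 3, 0, 1],
   [5, 5, 0, 0, 0, 1, 0, 0, 2, 3, 0, 2, 2, 1, 5, 0, 0, 0],
   [5, 5, 0, 0, 0, 1, 0, 0, 3, 2, 0, 1, 2, 2, 5, 0, 0, 0],
   [5, 5, 0, 0, 0, 1, 0, 0, 5, 0, 1, 2, 0, 2, 2, 3, 0, 0],
   [5, 5, 0, 0, 0, 2, 0, 0, 5, 0, 1, 1, 0, 3, 2, 2, 0, 0],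
   [5, 5, 0, 0, 0, 3, 0, 2, 3, 0, 2, 1, 2, 0, 3, 2, 0, 0],
   [5, 5, 0, 0, 2, 3, 0, 2, 1, 2, 2, 3, 0, 0, 3, 0, 2, 0],
   [5, 6, 0, 0, 0, 3, 0, 0, 2, 3, 0, 5, 0, 0, 1, 1, 3, 0],
   [5, 6, 0, 0, 0, 3, 0, 0, 3, 2, 0, 1, 3, 1, 0, 5, 0, 0],
   [5, 6, 0, 0, 0, 3, 0, 0, 5, 0, 0, 1, 1, 3, 2, 3, 0, 0],
   [5, 6, 0, 0, 0, 4, 0, 0, 3, 2, 0, 2, 3, 0, 0, 4, 0, 0],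
   [5, 6, 0, 0, 0, 4, 0, 0, 3, 2, 0, 2, 3, 0, 1, 4, 0, 0],
   [5, 6, 0, 0, 0, 5, 0, 1, 3, 0, 0, 1, 3, 1, 2, 3, 0, 0],
   [5, 6, 0, 0, 0, 5, 0, 1, 3, 0, 0, 2, 3, 0, 1, 3, 0, 1],
   [5, 6, 0, 0, 0, 5, 0, 1, 3, 0, 3, 0, 1, 1, 3, 0, 2, 0],
   [5, 7, 0, 0, 0, 3, 0, 0, 1, 4, 0, 5, 0, 0, 3, 2, 0, 0],
   [5, 7, 0, 0, 0, 3, 0, 0, 2, 3, 0, 0, 5, 0, 0, 4, 0, 1],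
   [5, 7, 0, 0, 0, 3, 0, 0, 5, 0, 0, 3, 2, 0, 1, 4, 0, 0],
   [5, 7, 0, 0, 0, 5, 0, 0, 3, 2, 0, 1, 4, 0, 3, 2, 0, 0],
   [5, 7, 0, 0, 0, 5, 0, 0, 3, 2, 0, 2, 3, 0, 0, 4, 1, 0],
   [5, 7, 0, 0, 0, 5, 0, 0, 3, 2, 0, 3, 2, 0, 1, 4, 0, 0],
   [6, 6, 0, 0, 0, 2, 0, 0, 2, 4, 0, 3, 3, 0, 5, 0, 1, 0],
   [6, 6, 0, 0, 0, 3, 0, 1, 2, 3, 1, 5, 0, 0, 2, 0, 4, 0],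
   [6, 6, 0, 0, 0, 6, 0, 1, 2, 0, 1, 2, 3, 0, 2, 3, 1, 0],
   [6, 6, 0, 0, 0, 6, 0, 1, 2, 0, 3, 1, 2, 0, 3, 1, 2, 0],
   [5, 8, 0, 0, 0, 5, 0, 0, 4, 1, 0, 0, 4, 1, 0, 4, 0, 1],
   [6, 7, 0, 0, 0, 0, 0, 0, 0, 6, 0, 0, 5, 1, 2, 2, 2, 0],
   [6, 7, 0, 0, 0, 3, 0, 0, 3, 3, 0, 1, 4, 1, 0, 6, 0, 0],
   [6, 7, 0, 0, 0, 3, 0, 0, 3, 3, 0, 1, 4, 1, 6, 0, 0, 0],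
   [6, 7, 0, 0, 0, 3, 0, 0, 3, 3, 0, 6, 0, 0, 1, 1, 4, 0],
   [6, 7, 0, 0, 0, 3, 0, 0, 6, 0, 0, 1, 1, 4, 3, 3, 0, 0],
   [6, 7, 0, 0, 0, 3, 0, 0, 6, 0, 1, 1, 0, 4, 3, 3, 0, 0],
   [6, 7, 0, 0, 0, 6, 0, 0, 3, 1, 0, 3, 3, 0, 1, 4, 1, 0],
   [6, 7, 0, 0, 0, 6, 0, 0, 3, 1, 1, 1, 4, 0, 3, 3, 0, 0],
   [6, 7, 0, 0, 0, 6, 0, 3, 3, 0, 2, 2, 2, 0, 2, 2, 2, 0],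
   [6, 8, 0, 0, 1, 5, 0, 0, 5, 1, 0, 4, 0, 2, 0, 4, 2, 0],
   [7, 7, 0, 0, 1, 6, 2, 2, 3, 0, 2, 2, 3, 0, 3, 3, 0, 1],
   [6, 9, 0, 0, 0, 6, 0, 1, 5, 0, 0, 4, 2, 0, 0, 4, 2, 0],
   [6, 9, 0, 0, 0, 6, 0, 1, 5, 0, 2, 0, 4, 0, 4, 2, 0, 0],
   [7, 8, 0, 0, 0, 3, 0, 0, 2, 5, 0, 7, 0, 0, 3, 1, 3, 0],
   [7, 8, 0, 0, 0, 3, 0, 0, 5, 2, 0, 1, 3, 3, 0, 7, 0, 0],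
   [7, 8, 0, 0, 0, 3, 0, 0, 7, 0, 0, 3, 1, 3, 2, 5, 0, 0],
   [7, 8, 0, 0, 0, 4, 0, 0, 3, 4, 0, 2, 5, 0, 0, 6, 0, 0],
   [7, 8, 0, 0, 0, 4, 0, 0, 3, 4, 0, 2, 5, 0, 1, 6, 0, 0],
   [7, 8, 0, 0, 0, 4, 0, 0, 3, 4, 0, 2, 5, 0, 6, 0, 0, 0],
   [7, 8, 0, 0, 0, 4, 0, 0, 3, 4, 0, 2, 5, 0, 6, 1, 0, 0],
   [7, 8, 0, 0, 0, 6, 0, 0, 4, 2, 0, 3, 4, 0, 2, 5, 0, 0],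
   [7, 8, 0, 0, 0, 7, 0, 2, 4, 0, 0, 2, 4, 0, 2, 4, 0, 1],
   [7, 8, 0, 0, 0, 7, 0, 2, 4, 0, 0, 2, 4, 1, 2, 4, 0, 0],
   [7, 8, 0, 0, 1, 6, 0, 4, 0, 2, 3, 4, 0, 0, 5, 0, 2, 0],
   [7, 9, 0, 0, 0, 6, 0, 0, 4, 3, 0, 3, 4, 0, 0, 6, 1, 0],
   [7, 9, 0, 0, 0, 7, 0, 1, 4, 2, 0, 2, 5, 0, 3, 4, 0, 0],
   [7, 9, 0, 0, 0, 7, 0, 1, 4, 2, 0, 3, 4, 0, 2, 5, 0, 0],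
   [7, 9, 0, 0, 0, 7, 0, 1, 4, 2, 4, 0, 3, 0, 5, 0, 2, 0],
   [7, 9, 0, 0, 1, 6, 0, 0, 4, 3, 0, 3, 4, 0, 1, 6, 0, 0],
   [8, 9, 0, 0, 0, 4, 0, 0, 4, 4, 0, 8, 0, 0, 1, 1, 5, 1],
   [8, 9, 0, 0, 0, 4, 0, 0, 8, 0, 1, 1, 1, 5, 4, 4, 0, 0],
   [8, 9, 0, 0, 3, 5, 0, 4, 0, 4, 0, 5, 3, 0, 5, 0, 3, 0],
   [7, 11, 0, 0, 0, 7, 0, 0, 5, 2, 0, 0, 5, 2, 0, 6, 1, 0],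
   [7, 11, 0, 0, 0, 7, 0, 0, 5, 2, 0, 1, 6, 0, 5, 0, 0, 2],
   [8, 10, 0, 0, 0, 6, 0, 0, 5, 3, 0, 3, 5, 0, 0, 7, 0, 1],
   [8, 10, 0, 0, 0, 8, 0, 2, 4, 2, 0, 3, 5, 0, 3, 5, 0, 0],
   [8, 10, 0, 0, 0, 8, 0, 2, 4, 2, 5, 0, 3, 0, 5, 0, 3, 0],
   [8, 10, 0, 0, 0, 8, 0, 2, 5, 1, 0, 2, 5, 1, 3, 5, 0, 0],
   [8, 10, 0, 0, 0, 8, 0, 2, 5, 1, 0, 3, 5, 0, 2, 5, 0, 1],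
   [8, 10, 0, 0, 1, 7, 0, 0, 5, 3, 0, 4, 4, 0, 2, 6, 0, 0],
   [8, 10, 0, 0, 1, 7, 0, 2, 6, 0, 5, 0, 0, 3, 5, 0, 3, 0],
   [9, 9, 0, 0, 0, 3, 0, 0, 9, 0, 1, 4, 0, 4, 2, 5, 0, 2],
   [9, 9, 0, 0, 0, 3, 0, 0, 9, 0, 2, 2, 0, 5, 4, 4, 0, 1],
   [9, 9, 0, 0, 0, 9, 0, 1, 2, 0, 2, 3, 4, 0, 4, 5, 0, 0],
   [9, 9, 0, 0, 0, 9, 0, 1, 2, 0, 4, 2, 3, 0, 5, 0, 4, 0],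
   [9, 9, 0, 0, 3, 6, 0, 4, 2, 3, 4, 5, 0, 0, 5, 0, 4, 0],
   [9, 10, 0, 0, 0, 9, 0, 4, 4, 1, 3, 3, 3, 0, 3, 3, 3, 0],
   [9, 10, 0, 0, 3, 6, 0, 4, 1, 4, 0, 6, 3, 0, 6, 0, 3, 0],
   [9, 12, 0, 0, 0, 9, 0, 1, 5, 3, 0, 4, 5, 0, 0, 7, 2, 0],
   [9, 12, 0, 0, 0, 9, 0, 1, 5, 3, 2, 0, 7, 0, 4, 5, 0, 0],
   [9, 12, 0, 0, 0, 9, 0, 1, 5, 3, 5, 0, 4, 0, 7, 2, 0, 0],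
   [9, 12, 0, 0, 1, 8, 0, 0, 5, 4, 0, 4, 5, 0, 0, 8, 1, 0],
   [10, 12, 0, 0, 0, 6, 0, 0, 4, 6, 0, 3, 7, 0, 0, 9, 1, 0],
   [10, 12, 0, 0, 0, 6, 0, 0, 4, 6, 0, 3, 7, 0, 9, 0, 1, 0],
   [10, 12, 0, 0, 0, 9, 0, 1, 6, 3, 0, 4, 6, 0, 3, 7, 0, 0],
   [10, 12, 0, 0, 0, 10, 0, 3, 6, 0, 0, 3, 6, 1, 3, 6, 0, 1],
   [10, 12, 0, 0, 0, 10, 0, 3, 6, 0, 6, 0, 3, 1, 6, 0, 3, 1],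
   [10, 12, 0, 0, 1, 9, 0, 3, 7, 0, 6, 0, 0, 3, 6, 0, 4, 0],
   [10, 12, 0, 0, 1, 9, 0, 7, 3, 0, 6, 1, 0, 3, 6, 4, 0, 0],
   [11, 12, 0, 0, 0, 5, 0, 0, 11, 0, 0, 5, 1, 5, 2, 7, 0, 2],
   [11, 12, 0, 0, 0, 5, 0, 0, 11, 0, 2, 2, 0, 7, 5, 5, 1, 0],
   [11, 12, 0, 0, 0, 6, 0, 0, 5, 6, 0, 10, 0, 0, 2, 2, 7, 0],
   [11, 12, 0, 0, 0, 6, 0, 0, 5, 6, 1, 10, 0, 0, 2, 2, 7, 0],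
   [11, 13, 0, 0, 0, 6, 0, 0, 5, 6, 0, 3, 8, 0, 0, 10, 0, 1],
   [11, 13, 0, 0, 0, 6, 0, 0, 5, 6, 0, 3, 8, 0, 10, 0, 0, 1],
   [11, 13, 0, 0, 0, 9, 0, 0, 7, 4, 0, 5, 6, 0, 3, 8, 0, 0],
   [11, 13, 0, 0, 0, 11, 0, 3, 6, 0, 0, 3, 6, 2, 4, 7, 0, 0],
   [11, 13, 0, 0, 0, 11, 0, 3, 6, 0, 0, 4, 7, 0, 3, 6, 0, 2],
   [11, 13, 0, 0, 0, 11, 0, 3, 6, 0, 6, 0, 3, 2, 7, 0, 4, 0],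
   [11, 13, 0, 0, 1, 10, 0, 0, 6, 3, 0, 5, 6, 0, 3, 8, 0, 0],
   [11, 13, 0, 0, 2, 9, 0, 7, 0, 4, 5, 6, 0, 0, 8, 0, 3, 0],
   [12, 12, 0, 0, 3, 9, 0, 4, 5, 3, 5, 3, 4, 0, 7, 5, 0, 0],
   [12, 14, 0, 0, 4, 8, 0, 6, 0, 6, 7, 0, 5, 0, 7, 0, 5, 0],
   [12, 15, 0, 0, 0, 12, 0, 2, 7, 3, 0, 5, 7, 0, 3, 8, 1, 0],
   [12, 15, 0, 0, 0, 12, 0, 2, 7, 3, 1, 3, 8, 0, 5, 7, 0, 0],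
   [12, 15, 0, 0, 0, 12, 0, 2, 7, 3, 7, 0, 5, 0, 8, 1, 3, 0],
   [12, 16, 0, 0, 1, 11, 0, 2, 10, 0, 0, 7, 0, 5, 0, 7, 5, 0],
   [13, 15, 0, 0, 0, 12, 0, 3, 7, 3, 1, 4, 8, 0, 5, 8, 0, 0],
   [13, 15, 0, 0, 1, 12, 0, 8, 5, 0, 7, 3, 0, 3, 8, 4, 1, 0],
   [13, 16, 0, 0, 0, 13, 0, 4, 8, 1, 0, 4, 8, 1, 4, 8, 0, 1],
   [13, 16, 0, 0, 1, 12, 0, 4, 9, 0, 8, 0, 1, 4, 8, 0, 5, 0],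
   [15, 15, 0, 0, 3, 12, 0, 8, 7, 0, 7, 3, 2, 3, 8, 4, 3, 0],
   [15, 16, 0, 0, 3, 12, 0, 8, 7, 0, 8, 4, 3, 0, 8, 4, 3, 0],
   [15, 18, 0, 0, 0, 15, 0, 4, 8, 3, 1, 5, 9, 0, 5, 9, 1, 0],
   [15, 18, 0, 0, 0, 15, 0, 4, 8, 3, 9, 1, 5, 0, 9, 1, 5, 0],
   [15, 18, 0, 0, 1, 14, 0, 6, 9, 0, 8, 0, 3, 4, 10, 0, 5, 0],
   [16, 18, 0, 0, 0, 9, 0, 0, 7, 9, 0, 15, 1, 0, 3, 3, 10, 0],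
   [16, 18, 0, 0, 0, 15, 0, 4, 9, 0, 0, 4, 9, 3, 6, 10, 0, 0],
   [16, 18, 0, 0, 1, 15, 0, 10, 6, 0, 9, 4, 0, 0, 9, 4, 0, 3],
   [17, 18, 0, 0, 0, 9, 0, 2, 15, 0, 0, 5, 3, 9, 6, 11, 0, 0],
   [17, 19, 0, 0, 0, 9, 0, 0, 8, 9, 0, 16, 0, 1, 3, 3, 11, 0],
   [18, 18, 0, 0, 3, 15, 0, 8, 7, 3, 9, 5, 4, 0, 9, 5, 4, 0],
   [18, 19, 0, 0, 3, 15, 5, 5, 8, 0, 5, 5, 8, 0, 9, 9, 0, 0],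
   [17, 21, 0, 0, 0, 17, 0, 5, 10, 2, 0, 5, 10, 2, 6, 11, 0, 0],
   [17, 21, 0, 0, 0, 17, 0, 5, 10, 2, 0, 6, 11, 0, 5, 10, 0, 2],
   [17, 21, 0, 0, 1, 16, 0, 2, 10, 5, 0, 7, 10, 0, 5, 12, 0, 0],
   [17, 21, 0, 0, 2, 15, 0, 5, 12, 0, 10, 0, 7, 0, 11, 0, 0, 6],
   [18, 21, 0, 0, 0, 15, 0, 1, 11, 6, 8, 0, 10, 0, 13, 5, 0, 0],
   [18, 21, 0, 0, 0, 18, 0, 5, 10, 0, 0, 5, 10, 3, 6, 11, 1, 0],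
   [18, 21, 0, 0, 0, 18, 0, 5, 10, 0, 1, 6, 11, 0, 5, 10, 0, 3],
   [18, 21, 0, 0, 0, 18, 0, 5, 10, 0, 10, 0, 5, 3, 11, 1, 6, 0],
   [18, 21, 0, 0, 3, 15, 0, 11, 1, 6, 8, 10, 0, 0, 13, 0, 5, 0],
   [19, 20, 0, 0, 0, 9, 0, 0, 17, 2, 0, 7, 3, 9, 6, 13, 0, 0],
   [18, 24, 0, 0, 3, 15, 0, 5, 13, 0, 10, 0, 8, 0, 14, 4, 0, 0],
   [21, 21, 0, 0, 6, 15, 0, 10, 11, 0, 8, 3, 4, 6, 13, 8, 0, 0],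
   [21, 23, 0, 0, 6, 15, 0, 10, 11, 0, 10, 5, 6, 0, 13, 8, 0, 0],
   [21, 24, 0, 0, 1, 20, 0, 8, 13, 0, 12, 0, 5, 0, 12, 0, 5, 4],
   [23, 27, 0, 0, 0, 21, 0, 5, 12, 6, 0, 8, 15, 0, 9, 14, 0, 0],
   [23, 27, 0, 0, 2, 21, 0, 14, 9, 0, 12, 5, 0, 6, 15, 8, 0, 0],
   [24, 27, 0, 0, 0, 24, 0, 12, 12, 0, 7, 7, 7, 3, 8, 8, 8, 0],
   [25, 30, 0, 0, 0, 24, 0, 7, 15, 3, 0, 7, 15, 3, 9, 16, 0, 0],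
   [25, 30, 0, 0, 1, 24, 0, 16, 9, 0, 15, 7, 0, 3, 15, 7, 0, 3],
   [27, 30, 0, 0, 6, 21, 0, 10, 17, 0, 11, 0, 7, 9, 19, 8, 0, 0],
   [27, 31, 0, 0, 1, 26, 0, 7, 15, 0, 0, 7, 15, 5, 10, 17, 0, 0],
   [27, 33, 0, 0, 0, 27, 0, 7, 14, 6, 0, 10, 17, 0, 9, 16, 2, 0],
   [27, 33, 0, 0, 0, 27, 0, 7, 14, 6, 2, 9, 16, 0, 10, 17, 0, 0],
   [27, 33, 0, 0, 0, 27, 0, 7, 14, 6, 16, 2, 9, 0, 17, 0, 10, 0],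
   [27, 33, 0, 0, 0, 27, 0, 8, 16, 3, 0, 8, 16, 3, 9, 17, 1, 0],
   [27, 33, 0, 0, 0, 27, 0, 8, 16, 3, 1, 9, 17, 0, 8, 16, 0, 3],
   [27, 33, 0, 0, 3, 24, 0, 2, 16, 9, 13, 0, 14, 0, 20, 7, 0, 0],
   [27, 33, 0, 0, 3, 24, 0, 8, 19, 0, 16, 0, 11, 0, 17, 1, 0, 9],
   [33, 40, 0, 0, 1, 32, 0, 12, 21, 0, 20, 0, 9, 4, 20, 0, 9, 4],
   [39, 47, 0, 0, 2, 37, 0, 9, 20, 10, 0, 14, 25, 0, 15, 24, 0, 0],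
   [42, 51, 0, 0, 1, 41, 0, 12, 25, 5, 0, 12, 25, 5, 15, 27, 0, 0],
   [51, 60, 0, 0, 3, 48, 0, 20, 31, 0, 28, 0, 11, 12, 32, 4, 15, 0],
   [66, 78, 0, 0, 3, 63, 0, 16, 35, 15, 5, 21, 40, 0, 25, 41, 0, 0]]

/-- The rays lying on exactly 17 facets, each with the codes of its neighbours. -/
def simpleVertices : List (ℕ × List ℕ) :=
  [(17, [184979, 184988, 185012, 2413284, 186515, 186524, 186548, 2414820, 189587, 189596,
    189620, 2417892, 2478820, 2480356, 2483428, 124132, 58596]),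
   (18, [2528210, 2528216, 2528228, 2810340, 2530514, 2530520, 2530532, 2811108, 189587, 189596,
    189620, 189650, 189656, 189668, 2286820, 2274532, 58596]),
   (19, [447186, 447192, 293044, 2942180, 3987666, 3987672, 3856612, 3990738, 3990744, 3859684,
    2548946, 2548952, 2811108, 189668, 186596, 2390244, 58596]),
   (20, [3073171, 424092, 448692, 451812, 4103288, 3963036, 3987636, 4109528, 3959916, 3990756,
    4121828, 3972216, 3978456, 189560, 186584, 162020, 58596]),
   (21, [2921426, 2921432, 2921444, 3728612, 2530514, 2530520, 2530532, 2536658, 2536664,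
    2536676, 2548946, 2548952, 2548964, 2417892, 2414820, 2390244, 58596]),
   (22, [447186, 447192, 293044, 448722, 448728, 317668, 451794, 451800, 320740, 2942162,
    2942168, 3728612, 2548964, 2548196, 2542052, 2767332, 58596]),
   (23, [423975, 448557, 451641, 422535, 447117, 451785, 413331, 447153, 448737, 413340, 422580,
    424164, 2679865, 2679241, 2673121, 2636260, 58596]),
   (24, [5169618, 4225180, 779489, 4839604, 686221, 8419484, 555164, 4764888, 5813464, 4318436,
    8512740, 5891300, 186584, 4037752, 3990756, 189560, 189656]),
   (25, [5158023, 5158029, 4380852, 845028, 710770, 710776, 8575156, 6545892, 6546660, 6415588,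
    5953716, 4777188, 517348, 162020, 4121828, 189554, 189560]),
   (26, [23651538, 23651544, 976100, 18932946, 18932952, 23678509, 18959917, 23678605, 18960013,
    582089, 10571342, 10571294, 10544356, 10544353, 582713, 5432548, 5432545]),
   (27, [18253622, 18256697, 18244397, 11458785, 18342360, 11461860, 18343140, 11449560,
    18340020, 9516679, 9517459, 9514339, 9492705, 9495780, 9483480, 5026873, 5039149]),
   (28, [2921426, 2921432, 2921444, 2923730, 2923736, 2923748, 2929874, 2929880, 2929892,
    2942162, 2942168, 2942180, 2811108, 2810340, 2804196, 2767332, 58596]),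
   (29, [4646035, 4646044, 293044, 320740, 8416433, 8416436, 3856612, 5813473, 5813476, 8447201,
    8447204, 3847396, 189668, 186596, 162020, 2548964, 2530484]),
   (30, [447174, 4225180, 4511924, 451812, 686221, 8419484, 555164, 5944536, 5813464, 8578276,
    8447204, 3978456, 3204324, 186584, 162020, 2680036, 2548952]),
   (31, [424083, 424092, 4380852, 4383972, 710770, 710776, 8575156, 713938, 713944, 8578276,
    5953716, 5956836, 3335396, 3332276, 162020, 2680033, 2680036]),
   (32, [7528914, 1356248, 7266788, 12772562, 6730968, 10151140, 713953, 582884, 8447204,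
    6087908, 5825764, 6350052, 3185784, 162020, 451812, 3972216, 320740]),
   (33, [7385542, 7385545, 1237476, 8959174, 8959177, 8840420, 713938, 713944, 8578276, 6087908,
    5956836, 845028, 3332276, 162020, 4121828, 451809, 451812]),
   (34, [7390897, 1325468, 7653812, 5938296, 6215908, 9364705, 9233636, 9102564, 6612196,
    10151140, 12903652, 189560, 779480, 6481124, 451812, 447156, 3987636]),
   (35, [1217400, 7246712, 7215980, 13003992, 10254552, 7136484, 5813305, 6218980, 13034724,
    10282212, 7105752, 6460280, 186488, 6429548, 447156, 413340, 3859576]),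
   (36, [774833, 776369, 6084788, 845028, 4905137, 4905140, 14211252, 12968420, 12969188,
    6415588, 8709348, 517348, 162020, 5956836, 3335396, 3192018, 3192024]),
   (37, [11187347, 11050029, 10918969, 6087908, 9779612, 16111844, 14410980, 4908257, 14214372,
    8709348, 9168100, 4774068, 162020, 713944, 5953716, 713956, 582884]),
   (38, [3597411, 22444188, 22453368, 22471908, 22509724, 579764, 22518904, 555164, 22537444,
    582884, 8509620, 8500440, 8481900, 8444084, 8434904, 8416364, 5026996]),
   (39, [13005426, 553607, 5300660, 12754121, 5343021, 686227, 6462674, 778724, 13093276,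
    12808818, 6517428, 3396252, 488116, 448737, 3322994, 3203529, 189650]),
   (40, [9845139, 5318439, 11395508, 16152786, 11172050, 14595297, 10982201, 9692388, 14803380,
    15979128, 778712, 9016121, 9364708, 832722, 5169588, 686179, 189554]),
   (41, [19287630, 19275339, 976100, 21017798, 21030089, 19391716, 21056364, 19390900, 21057180,
    7850468, 12799566, 12798750, 12772580, 12760289, 7773262, 3466468, 582857]),
   (42, [1628370, 28866761, 28891361, 20439512, 24306916, 26925281, 24294616, 26900681,
    10084824, 13624536, 13621368, 20636900, 20624600, 9492705, 18342360, 13677796, 13690072]),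
   (43, [20265363, 28522899, 28519827, 1500388, 20243684, 28501220, 28488932, 15284627,
    13973907, 13973859, 13952228, 13952216, 15262948, 13821156, 13808868, 13821144, 13808856]),
   (44, [4633747, 6206620, 4249780, 4252900, 710833, 579764, 8444084, 713953, 582884, 8447204,
    8709348, 3192024, 3185784, 162020, 3978456, 3972216, 3847396]),
   (45, [4487315, 4487324, 6084788, 4383972, 4905137, 4905140, 14211252, 713938, 713944,
    8578276, 8709348, 4777188, 3332276, 162020, 4121828, 3978450, 3978456]),
   (46, [1356242, 1356248, 1237476, 15918290, 15918296, 8840420, 4908257, 4908260, 14214372,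
    8709348, 845028, 4774068, 162020, 4383972, 5953716, 4252897, 4252900]),
   (47, [1217400, 1322396, 1368500, 16149720, 9230564, 16049380, 8696952, 16180452, 9215192,
    16018648, 779492, 186488, 776300, 4511972, 4496600, 4646116, 5813368]),
   (48, [12771794, 6730200, 10150372, 12772562, 6730968, 10151140, 8902836, 7857380, 14279908,
    845028, 4842724, 8643812, 3400932, 451812, 189560, 4252132, 4252900]),
   (49, [12983148, 7092636, 10231404, 5142729, 776312, 16573665, 16311524, 9102564, 6612196,
    10151140, 12903652, 3400932, 779480, 451812, 4515044, 4602268, 162020]),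
   (50, [13158065, 1754804, 10668468, 14735585, 11983076, 16704737, 16442596, 9102564, 10151140,
    12903652, 845028, 779480, 6481124, 451812, 4515044, 1238244, 8840420]),
   (51, [13376364, 10762652, 1842796, 12760262, 10138840, 11711716, 14345444, 16442596,
    21030116, 22471908, 6337752, 779480, 16311524, 451812, 9233636, 1369316, 4240600]),
   (52, [1718675, 15743367, 1980819, 11958482, 14842066, 11711713, 14476516, 16704740, 21161188,
    22602980, 832722, 778712, 16573668, 9364708, 7398628, 8971492, 451809]),
   (53, [1976172, 1849756, 15612316, 14473441, 11852004, 14476513, 11855076, 10675428, 18408676,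
    14083300, 779492, 779480, 10238364, 7660772, 447156, 9099492, 9102564]),
   (54, [1710956, 10754924, 13245292, 13003992, 10254552, 14595300, 11855076, 12248292,
    17360100, 18670820, 6460280, 779480, 12117220, 447156, 1369316, 4646116, 9233636]),
   (55, [18532017, 10798772, 14076340, 7529682, 1357016, 10413281, 13296868, 18408676, 1238244,
    7259828, 10151140, 4252132, 12895924, 4602268, 451812, 447156, 320740]),
   (56, [1718675, 15743367, 1980819, 1225938, 7398616, 1369313, 7660769, 13165796, 10413284,
    18539748, 6874340, 4370898, 4507313, 12990867, 447153, 451785, 451809]),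
   (57, [13389390, 18532764, 10505806, 1356998, 7267529, 10544356, 13427940, 18521289, 1357028,
    7229084, 12772580, 4252105, 12734030, 4202140, 451785, 413340, 320728]),
   (58, [1976172, 1849756, 15612316, 7395553, 1366244, 7398625, 1369316, 10675428, 18408676,
    14083300, 7005412, 4510388, 4507316, 10238364, 447156, 448740, 451812]),
   (59, [5404747, 5404750, 8837300, 8840420, 21082584, 21083352, 21094884, 21095652, 14214372,
    14211252, 6415588, 6403288, 162020, 8578276, 8575156, 555155, 555164]),
   (60, [14956947, 19934599, 19653044, 21919954, 19560658, 18003169, 15066340, 22012340,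
    18076280, 10982201, 778712, 14521145, 14476516, 10937572, 686179, 11068644, 555155]),
   (61, [19849649, 19849652, 15131060, 17155740, 17156508, 17025436, 18146532, 22078692,
    19719396, 2083228, 841956, 11330788, 14869732, 11199713, 11199716, 713848, 713842]),
   (62, [26254546, 24962264, 24962276, 1500388, 26289995, 24983907, 24983955, 15284627, 2041675,
    2041627, 15262948, 2006226, 2006214, 11461860, 11449572, 11461848, 11449560]),
   (63, [23502022, 27867491, 15512804, 23508196, 24831204, 27833572, 27998563, 29432711,
    24456547, 29964643, 29400265, 29930724, 24437988, 27964644, 11542091, 1631460, 11559725]),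
   (64, [13034643, 9202796, 12900532, 4252900, 16346220, 5027032, 555164, 713953, 582884,
    14214372, 5825764, 8512740, 3185784, 162020, 3990756, 3972216, 3859684]),
   (65, [12744779, 12744782, 8837300, 4383972, 16363992, 16364760, 7791844, 713938, 713944,
    14214372, 5956836, 6415588, 3332276, 162020, 4121828, 3990753, 3990756]),
   (66, [6206611, 6206620, 6084788, 6087908, 4905137, 4905140, 14211252, 4908257, 4908260,
    14214372, 4777188, 4774068, 162020, 5956836, 5953716, 5825761, 5825764]),
   (67, [1754801, 1754804, 1237476, 14735585, 14735588, 16507364, 16508132, 7791844, 6087908,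
    14211252, 845028, 6403288, 162020, 4383972, 8575156, 6612193, 6612196]),
   (68, [9582995, 15742611, 1980819, 14710994, 14842066, 15906017, 10937572, 16901348, 13559012,
    22270584, 832722, 5346105, 16618297, 686179, 451785, 6874340, 4371666]),
   (69, [1976172, 9714076, 15605356, 11065569, 16046308, 14476513, 14345444, 6612196, 10151140,
    12903652, 4973796, 779480, 6481124, 451812, 4515044, 7005412, 555164]),
   (70, [1710956, 1325468, 1842796, 14183532, 6215908, 14595300, 14345444, 16442596, 21030116,
    22471908, 189560, 779480, 16311524, 4515044, 6743268, 7136484, 8416364]),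
   (71, [9845139, 15735591, 1980819, 16152786, 11172050, 14595297, 14476516, 16704740, 21161188,
    22602980, 5301476, 778712, 16573668, 6874340, 447153, 686179, 4515041]),
   (72, [27684038, 9999161, 27714788, 2024673, 26928356, 11461860, 5560545, 2006226, 26897606,
    16552758, 9517459, 16522023, 15787236, 15756486, 13034721, 13003986, 3597540]),
   (73, [17250635, 13743329, 22394081, 20636897, 17491172, 15131876, 14737844, 10916665,
    15913592, 16770276, 840372, 5367012, 713176, 8950585, 13165796, 1762532, 1238244]),
   (74, [17832812, 24148184, 20899044, 17753313, 20505828, 11035449, 16016248, 15000804,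
    14324600, 17360100, 4946067, 751715, 13296868, 1369316, 9081720, 1893604, 582116]),
   (75, [17229010, 21657801, 23258340, 20767969, 17622244, 11198900, 16179636, 15000804,
    14602872, 16835812, 5280569, 751715, 1762532, 9343801, 13427940, 713176, 1369316]),
   (76, [27408739, 1980807, 1628388, 20374756, 27400999, 1976139, 27663131, 27670931, 16704728,
    5626081, 16696988, 9451923, 15743379, 15735579, 13165784, 13158044, 18277604]),
   (77, [18532017, 10798772, 14076340, 12772562, 6730968, 21161185, 21030116, 9102564, 6612196,
    12903652, 6350052, 779480, 6481124, 451812, 4515044, 7267556, 4252900]),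
   (78, [10654584, 18387832, 14062456, 2006232, 15656164, 1893604, 13022436, 7118040, 13034724,
    7105752, 6984568, 6441836, 6429548, 7639928, 413340, 4633828, 4646116]),
   (79, [26745639, 27663143, 1980819, 18789586, 18801880, 13296865, 18408673, 13165796,
    18539748, 21161188, 713188, 12895921, 12990867, 7398628, 447153, 10400993, 7267553]),
   (80, [23651538, 23651544, 976100, 18932946, 18932952, 13427940, 18521289, 13415652, 18509001,
    3466468, 582089, 12734030, 12721742, 10544353, 413340, 7529700, 7517412]),
   (81, [1976172, 1849756, 15612316, 13162721, 1759460, 13165793, 1762532, 18408676, 14083300,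
    7005412, 6607540, 6604468, 10238364, 7660772, 447156, 1235172, 1238244]),
   (82, [19410317, 15366360, 24128924, 13397208, 1865944, 18539745, 14083300, 1762532, 13296868,
    18670820, 6722424, 10143412, 7084908, 1369316, 447156, 1338584, 7259828]),
   (83, [9582995, 19803467, 19653044, 14710994, 19691730, 15906017, 15066340, 22012340,
    18076280, 832722, 5346105, 14521145, 8971492, 686179, 686227, 7922916, 4880531]),
   (84, [9710995, 19934599, 19640756, 14342369, 19557586, 16049377, 9811172, 14377848, 16094072,
    778724, 4973016, 9134968, 9099489, 686227, 4880483, 7922916, 555155]),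
   (85, [19980658, 19849652, 9888180, 23154221, 17156508, 23054748, 16180452, 14604504,
    19588324, 2083228, 5283017, 776300, 8053988, 9346249, 582713, 713848, 4895801]),
   (86, [19908252, 19909020, 15131060, 22922908, 22923676, 17025436, 18146532, 22078692,
    19719396, 2083228, 841956, 14869732, 8053988, 774764, 776300, 5354721, 5353953]),
   (87, [27946182, 20353849, 27976932, 8157385, 27990811, 20440292, 8185060, 27998611, 2046355,
    9517459, 2041627, 2024676, 9495780, 2006214, 582713, 555047, 3597540]),
   (88, [8276766, 11592164, 27806494, 27911396, 8269155, 976100, 11592884, 26829625, 23454072,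
    28435684, 23716216, 28330782, 23600679, 23337767, 26753379, 20112612, 1094884]),
   (89, [20728621, 1755548, 12503452, 22075608, 11983064, 22340836, 25486564, 26010852,
    18015460, 845016, 22209764, 779384, 6862049, 14607588, 1357028, 15918308, 6730980]),
   (90, [12594573, 1849756, 20454252, 21916888, 11852004, 18003172, 12248292, 17360100,
    18670820, 779492, 779480, 12117220, 7005412, 1369316, 7136484, 16049380, 14345444]),
   (91, [20632244, 12378548, 1761716, 13687000, 25879780, 27583716, 18146532, 11720920,
    21947620, 13612257, 841956, 776300, 6855881, 16180452, 1235172, 14738660, 6609124]),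
   (92, [12196716, 18619244, 17308524, 22158956, 11803500, 22197476, 11855076, 12248292,
    17360100, 18670820, 751715, 779480, 7084908, 1369316, 7136484, 16259948, 16311524]),
   (93, [2155730, 19429577, 17884388, 26928353, 21292260, 22328548, 11855076, 17360100,
    18670820, 16835812, 779480, 12117220, 1762532, 1369316, 7136484, 22734052, 16442596]),
   (94, [25721030, 28080329, 29025508, 23910628, 19064036, 18145716, 27059428, 21423332,
    25617636, 840372, 17097956, 22865124, 2024676, 17488100, 11985332, 14737844, 1759460]),
   (95, [22336120, 25481848, 26006136, 24014025, 19195108, 27190500, 21423332, 18010744,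
    22205048, 16966884, 751715, 11719288, 14602872, 2024676, 17722569, 22996196, 1865944]),
   (96, [26647762, 21816536, 24700132, 23764178, 19176658, 17986162, 27321572, 21554404,
    21273810, 750227, 17067218, 17603794, 1744082, 2006226, 11821938, 23127268, 14312306]),
   (97, [13389390, 18532764, 10505806, 6730950, 10151113, 5432548, 22799588, 16337772, 15918308,
    710812, 6350025, 12799566, 5142738, 451785, 8559694, 7529700, 4252873]),
   (98, [10405553, 13289140, 18401716, 710833, 16021720, 22602977, 22471908, 9102564, 6612196,
    10151140, 4842724, 779480, 6481124, 451812, 4515044, 7259828, 8444084]),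
   (99, [13144889, 10392377, 18518841, 9495777, 2024676, 22734052, 582713, 16180452, 10282212,
    7105752, 16552761, 5148045, 6429548, 7377721, 413340, 8447033, 4646116]),
   (100, [23345483, 10020056, 1980819, 20636897, 17491172, 1762529, 10675425, 10413284,
    18539748, 16704740, 9626852, 6604465, 12990867, 7398628, 447153, 1762532, 1238244]),
   (101, [17832812, 24148184, 20899044, 17753313, 20505828, 10413281, 18408676, 1762532,
    10806500, 17360100, 9757924, 12895924, 7084908, 1369316, 447156, 1893604, 7267556]),
   (102, [23389394, 26766537, 19326180, 20767969, 17622244, 10544356, 18521289, 1893604,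
    10775768, 22734052, 9888996, 12734030, 6691692, 1762532, 413340, 7529700, 1369316]),
   (103, [13750904, 5626084, 1980819, 25944500, 25683172, 27648436, 22012340, 16901348,
    22270584, 12050868, 16245172, 16618297, 8971492, 686179, 13546721, 21161188, 713956]),
   (104, [1628358, 17221966, 25710110, 25391673, 25876696, 27580632, 22340836, 21944536,
    9691572, 13606089, 779384, 16692449, 11983064, 16177368, 5563608, 21721657, 13677784]),
   (105, [25115027, 27081107, 27212179, 1500388, 25093348, 27059428, 27190500, 2046355,
    19757266, 19872147, 19718580, 19850468, 2024676, 5694692, 19587508, 19626194, 13808856]),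
   (106, [20265363, 28522899, 28519827, 1500388, 25224420, 27321572, 27309284, 15284627,
    19867467, 19867419, 5694692, 13952216, 2006226, 19587505, 19575217, 19981540, 19969252]),
   (107, [1976172, 1849756, 15612316, 18536673, 10803428, 18539745, 10806500, 10675428,
    18408676, 7005412, 10146484, 10143412, 10238364, 7660772, 447156, 7262900, 7259828]),
   (108, [9202787, 9202796, 8837300, 6087908, 22524376, 22525144, 7791844, 4908257, 4908260,
    8709348, 6415588, 4774068, 162020, 8578276, 5953716, 8447201, 8447204]),
   (109, [12594573, 9714076, 1842796, 11065569, 16046308, 18003172, 16442596, 21030116,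
    22471908, 4973796, 779480, 16311524, 9102564, 6743268, 9233636, 11855076, 555164]),
   (110, [14956947, 1976163, 1980819, 21919954, 19560658, 18003169, 16704740, 21161188,
    22602980, 10982201, 778712, 16573668, 6874340, 9364708, 7005409, 7922916, 9102561]),
   (111, [1723244, 9882012, 12503452, 11196632, 16177368, 22340836, 25486564, 26010852,
    18015460, 5289185, 22209764, 779384, 9352417, 11724004, 7124196, 710764, 9221348]),
   (112, [1757873, 12378548, 9626036, 21712429, 25942232, 25552100, 18146532, 15915224,
    10919113, 21214433, 841956, 5354721, 8953033, 713848, 6609121, 11986148, 8837348]),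
   (113, [2023857, 2023860, 15131060, 25675420, 25676188, 17025436, 18146532, 22078692,
    19719396, 2083228, 841956, 11330788, 8053988, 6855878, 6855881, 8953033, 8953030]),
   (114, [17229010, 21657801, 23258340, 24044769, 23782628, 19587508, 21946804, 18010744,
    16835812, 11003108, 751715, 1762532, 9888996, 14455609, 1893604, 7902009, 9757924]),
   (115, [25762587, 25763355, 16988563, 23913697, 23913700, 18145716, 19718580, 22077876,
    2046355, 840372, 11329972, 8053172, 14868916, 1762529, 1762532, 9626852, 9626849]),
   (116, [26254546, 24962264, 24962276, 1500388, 20243684, 28501220, 28488932, 8185060, 5694692,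
    13973907, 13973859, 2006226, 2006214, 2024676, 2012388, 2024664, 2012376]),
   (117, [19444145, 24162740, 19457249, 24175844, 19313892, 1893604, 19325364, 1892788,
    18652376, 18637688, 20990828, 20979356, 1350872, 10788056, 10773368, 24153500, 24127340]),
   (118, [26114246, 26114249, 26156571, 26156583, 1500388, 26294675, 25239079, 25239067,
    20258343, 25196745, 25196742, 20216009, 26272996, 8303844, 8303841, 8297700, 8297697]),
   (119, [10654584, 18387832, 14062456, 2006232, 1893604, 2012388, 20487384, 2024676, 20475096,
    10282212, 6984568, 9063276, 9050988, 7639928, 413340, 15653080, 15628504]),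
   (120, [27684038, 9999161, 27714788, 2024673, 1762529, 2024676, 20633825, 2006226, 20737222,
    9495780, 6853430, 8947513, 9313063, 15756486, 7377718, 447153, 15784161]),
   (121, [20729374, 9619868, 22989212, 22075608, 14735576, 23323060, 27649252, 26073304,
    10925281, 845016, 22650057, 5348553, 8959201, 710764, 12772580, 11724004, 6087896]),
   (122, [23080333, 9711004, 20455068, 21916888, 14342372, 11068641, 27583716, 22453464,
    16018648, 779492, 4973784, 776300, 9099492, 12885208, 6218980, 11855076, 555164]),
   (123, [20616056, 22864308, 9888180, 13687000, 25879780, 27583716, 11199716, 14604504,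
    21947620, 13612257, 5283017, 776300, 11986148, 9346249, 13034724, 713848, 6218980]),
   (124, [22682476, 18626972, 1842796, 12807198, 776312, 22197476, 14345444, 16442596, 21030116,
    22471908, 8640692, 779480, 6481124, 6743268, 9233636, 12117220, 8481900]),
   (125, [23337758, 19417913, 1842796, 26824249, 25876708, 22328548, 14345444, 21030116,
    22471908, 8905956, 779480, 16311524, 6612196, 6743268, 9233636, 12248292, 16508132]),
   (126, [16791955, 9451911, 1980819, 13603641, 2090212, 22197473, 14476516, 16704740, 21161188,
    22602980, 9016121, 778712, 6874340, 9364708, 12990867, 16618297, 6481121]),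
   (127, [17185099, 10020056, 1980819, 13677793, 28304612, 22328545, 14476516, 21161188,
    22602980, 9692388, 778712, 16573668, 6874340, 9364708, 13165796, 16901348, 6612193]),
   (128, [17229010, 21657801, 23258340, 26928353, 21292260, 2046355, 13624548, 15000804,
    22205048, 9037028, 751715, 1762532, 9888996, 16552761, 22734052, 16770276, 12248292]),
   (129, [15153555, 18184402, 22116562, 27187428, 21420260, 27190500, 21423332, 19757266,
    14907602, 8091858, 840372, 11368658, 2024676, 22993124, 12510436, 22996196, 12507364]),
   (130, [25721030, 28080329, 29025508, 27290825, 21526729, 19872147, 27059428, 21423332,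
    25617636, 8091858, 12379364, 22865124, 2024676, 23096521, 751715, 11237586, 12610761]),
   (131, [21657810, 23258313, 21788897, 27452644, 28387099, 13685326, 15000777, 22336078,
    16835785, 9641619, 740963, 1762505, 9888969, 16683806, 2155748, 17243723, 23389412]),
   (132, [17832812, 24148184, 20899044, 17753313, 20505828, 25474276, 11855076, 12248292,
    18670820, 9757924, 779480, 12117220, 13296868, 1369316, 7136484, 1893604, 21030116]),
   (133, [28342470, 25327817, 30205156, 20636897, 23913700, 19064036, 29156580, 26535140,
    28239076, 9626852, 12376292, 23099593, 18801892, 2024676, 13165796, 1762532, 1238244]),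
   (134, [21788870, 24672457, 26666212, 20767969, 29287652, 26404068, 23782628, 19195108,
    21292260, 9888996, 22862052, 12613833, 1762532, 2024676, 13427940, 18801892, 1369316]),
   (135, [24148178, 17832803, 20899041, 20505825, 29418724, 26516690, 24044772, 19164370,
    17360097, 9757921, 22977746, 12479698, 13296865, 1369313, 2006226, 1893601, 18932964]),
   (136, [2155730, 19429577, 29811937, 26666212, 17701677, 20454252, 20899044, 24128924,
    12248292, 23258340, 9706348, 17308524, 1762532, 1369316, 13245292, 19326180, 1842796]),
   (137, [12619149, 14993820, 12503452, 19585240, 21944536, 22340836, 25486564, 26010852,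
    10984649, 22209764, 779384, 14464225, 11724004, 14607588, 11842788, 7910625, 14333156]),
   (138, [12378545, 12378548, 15131060, 28134189, 28134957, 17025436, 22078692, 19719396,
    2083228, 841956, 11330788, 14869732, 8053988, 11986145, 11986148, 14738660, 14738657]),
   (139, [20068707, 27926055, 1628388, 20374756, 20060967, 27929955, 18276824, 18274484,
    26990817, 5626081, 26975442, 3553683, 27663911, 10020068, 27667811, 26766561, 26758701]),
   (140, [1976172, 1849756, 15612316, 10410209, 13293796, 10413281, 13296868, 10675428,
    14083300, 7005412, 12898996, 12895924, 10238364, 7660772, 447156, 7264484, 7267556]),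
   (141, [19282323, 27670919, 1980819, 13400274, 10516690, 10806497, 14083297, 13165796,
    10413284, 22602980, 12767864, 10143409, 12990867, 7398628, 447153, 7502034, 7259825]),
   (142, [19410317, 15366360, 24128924, 22703320, 1865944, 25998564, 11855076, 12248292,
    17360100, 16290680, 779480, 12117220, 10806500, 1369316, 7136484, 18640088, 22471908]),
   (143, [28342470, 25327817, 30205156, 18789574, 29287652, 26404068, 29156580, 26535140,
    28239076, 713176, 22862052, 23099593, 17491172, 2024676, 10413272, 17622244, 10400969]),
   (144, [23651526, 976088, 23651556, 18932934, 29418724, 26516690, 29406436, 26504402, 3466456,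
    582113, 22977746, 22965458, 10544344, 10544329, 2006226, 17753316, 17741028]),
   (145, [28735686, 30046409, 30336228, 23910628, 23913700, 29549796, 24569060, 28632292,
    12379364, 12376292, 21526729, 26404068, 2024676, 17488100, 1762532, 17491172, 1759460]),
   (146, [21788870, 24672457, 26666212, 24014025, 29680868, 24569060, 23782628, 21292260,
    12510436, 21420260, 12613833, 1762532, 17622244, 2024676, 17722569, 26535140, 1865944]),
   (147, [23389394, 26766537, 29811937, 26666212, 976100, 19325364, 1893604, 15381732, 22734052,
    23258340, 5393998, 20978540, 1762532, 13427940, 18518841, 23612973, 17884388]),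
   (148, [17865938, 2137289, 24175841, 15394017, 29930724, 24700132, 23388536, 1892785,
    12229842, 18637682, 21685476, 16391827, 1350866, 1744082, 10773362, 19408679, 26784996]),
   (149, [13951409, 13820340, 14999988, 29215132, 27117980, 23054748, 21947620, 18012376,
    2083228, 10990817, 776300, 19719396, 14458057, 11199716, 19576036, 7904457, 11037897]),
   (150, [13820337, 13820340, 15131060, 27117212, 27117980, 17025436, 18146532, 22078692,
    2083228, 841956, 11330788, 14869732, 8053988, 19588321, 19588324, 10919113, 10919110]),
   (151, [27336231, 17119635, 27212179, 13966887, 29287652, 22865124, 13821156, 27190500,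
    2046355, 11368658, 19872147, 8053172, 2024676, 19981528, 11198900, 713176, 10904350]),
   (152, [27342375, 29435687, 23144231, 13973031, 29418724, 23127268, 13952228, 27309284,
    2043283, 11232078, 19867419, 19850456, 11198861, 2006226, 11035446, 7889718, 582113]),
   (153, [1628358, 20100312, 27818209, 27862811, 1631460, 23508196, 20081889, 18342264,
    27467339, 28911387, 29825867, 28866785, 29799652, 27452644, 18256685, 11592932, 1094884]),
   (154, [15506642, 26141912, 26141924, 1500388, 28501220, 28488932, 26289995, 5694692,
    13973907, 13973859, 25224420, 25224408, 15262948, 25093348, 25081060, 25093336, 25081048]),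
   (155, [27880646, 24911399, 1628388, 27911396, 24918371, 27925275, 27933075, 28301540,
    5626081, 28286150, 11418003, 1980819, 10020068, 1976091, 25327841, 25316141, 18277604]),
   (156, [17832812, 24148184, 20899044, 17753313, 29144280, 20502756, 23782628, 1865944,
    17360100, 9757924, 16010104, 11803500, 13296868, 1369316, 15628504, 1893604, 20493528]),
   (157, [1628370, 28866761, 28891361, 17491169, 23913700, 1759460, 29275352, 20740297, 5563620,
    9626849, 11979188, 16136604, 20624600, 15784161, 1762529, 13165793, 1238244]),
   (158, [29912262, 27452632, 29811940, 17622241, 29418712, 20618450, 24044772, 1731794,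
    26928356, 9888993, 15879755, 11673187, 1762529, 15756486, 13427937, 1369313, 20755672]),
   (159, [17832812, 24148184, 17753313, 20505828, 17701677, 20454252, 17884388, 24128924,
    17360100, 9757924, 9706348, 17308524, 13296868, 1369316, 13245292, 1893604, 1842796]),
   (160, [19274604, 15343212, 1842796, 5432530, 21017816, 25474276, 14345444, 16442596,
    22471908, 7857380, 779480, 16311524, 10151140, 6743268, 9233636, 17360100, 582884]),
   (161, [21634599, 27663143, 1980819, 25852114, 25683172, 25474273, 14476516, 16704740,
    22602980, 14803380, 778712, 16573668, 6874340, 9364708, 10413284, 13559012, 10151137]),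
   (162, [21788870, 24672457, 26666212, 26928353, 24306916, 28632292, 23782628, 19195108,
    16835812, 25614564, 12613833, 1762532, 17622244, 2024676, 22734052, 28239076, 12248292]),
   (163, [25721030, 28080329, 29025508, 29677796, 24569060, 27190500, 27059428, 25617636,
    16966884, 17097956, 12379364, 22865124, 2024676, 26532068, 12510436, 22996196, 19192036]),
   (164, [30317778, 28763352, 30074084, 29531346, 24550610, 27309284, 27321572, 28613842,
    17079506, 17067218, 26385618, 19045586, 2006226, 12629220, 12641508, 23127268, 23114980]),
   (165, [23239890, 17210569, 14982354, 25448035, 29930724, 24700132, 25770339, 25857427,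
    16817362, 750227, 14771022, 9870546, 1744082, 21121831, 19457252, 13734797, 26784996]),
   (166, [26647750, 24700120, 23764166, 19176646, 27434209, 24437988, 28763364, 21273798,
    12641496, 17210593, 25736420, 17603782, 1744070, 2006214, 28370148, 23370977, 2137313]),
   (167, [27320753, 27058612, 14999988, 13687000, 25879780, 27583716, 19588324, 18012376,
    13612257, 10990817, 776300, 11986148, 14458057, 16180452, 11824344, 7904457, 16018648]),
   (168, [27189681, 27189684, 15131060, 29083292, 29084060, 17025436, 18146532, 19719396,
    2083228, 841956, 11330788, 14869732, 8053988, 11720914, 11720920, 15915224, 15915218]),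
   (169, [26889005, 16828828, 12503452, 2089396, 13606089, 22340836, 25486564, 26010852,
    18015460, 9018569, 779384, 16561377, 11724004, 14607588, 12104932, 22650057, 16299236]),
   (170, [27413278, 17221966, 12503452, 30269876, 13690084, 25486564, 26010852, 18015460,
    9691572, 22209764, 779384, 16692449, 11724004, 14607588, 12236004, 23323060, 16430308]),
   (171, [26753421, 24136568, 1842796, 22509724, 16021720, 25998564, 14345444, 16442596,
    21030116, 14276788, 779480, 16311524, 12903652, 6743268, 9233636, 18670820, 5039332]),
   (172, [23214483, 27670919, 1980819, 27556050, 23061732, 25998561, 14476516, 16704740,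
    21161188, 15979128, 778712, 16573668, 6874340, 9364708, 18539748, 22270584, 12903649]),
   (173, [23389394, 26766537, 19326180, 26928353, 21292260, 23678509, 27583716, 1893604,
    18640088, 16835812, 12838116, 16259948, 1762532, 13427940, 13034724, 22799588, 12248292]),
   (174, [25721030, 28080329, 29025508, 29284580, 26404068, 19850468, 27059428, 21423332,
    25617636, 11368658, 17097956, 12379364, 2024676, 18798820, 16179636, 713176, 17619172]),
   (175, [23280019, 27621586, 26064097, 29391049, 26535140, 27190500, 21423332, 19626194,
    22668516, 16966884, 11237586, 15913592, 713176, 2024676, 18905289, 12510436, 17725641]),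
   (176, [30186706, 28370136, 25355492, 29138130, 26516690, 19981540, 27321572, 21554404,
    28220626, 11232078, 17067218, 18783442, 17472722, 2006226, 16016242, 12641508, 582113]),
   (177, [17229010, 21657801, 29811937, 26666212, 23017875, 27582900, 15000804, 26006136,
    16835812, 15971553, 751715, 1762532, 9888996, 22582073, 19326180, 22394081, 17884388]),
   (178, [26766546, 19326153, 21788897, 27452644, 11541287, 28893596, 1893577, 19456412,
    22734025, 17229028, 23421741, 16390987, 1762505, 13427913, 13144862, 2155748, 1094884]),
   (179, [8288454, 27859739, 26156571, 27845860, 26141924, 8303844, 27990811, 29432615,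
    29825819, 30612251, 30598372, 29811940, 29418712, 27976932, 976100, 23468827, 20100324]),
   (180, [23651526, 976088, 18932934, 18932964, 11541287, 27976092, 11553575, 27963804, 3466456,
    582113, 22766414, 22766366, 10544344, 10544329, 2003742, 19275363, 19287651]),
   (181, [21788870, 24672457, 26666212, 24044769, 25093348, 29549796, 19195108, 21292260,
    15000804, 27056356, 12613833, 1762532, 17622244, 2024676, 1893604, 29156580, 20505828]),
   (182, [24410310, 30439625, 30598372, 23913697, 19064036, 25093348, 29680868, 24306916,
    15131876, 12376292, 27293897, 29287652, 2024676, 1762529, 1762532, 17491172, 20636900]),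
   (183, [29912262, 27452632, 29811940, 23782625, 25224420, 29662418, 19164370, 26928356,
    15000801, 27172050, 12479698, 1762529, 20767972, 2006226, 1893601, 17753316, 29406436]),
   (184, [17851256, 20880600, 19457249, 15394020, 17734857, 20487384, 26764089, 1892788,
    17341656, 18637688, 9739480, 22421148, 1350872, 13278424, 10773368, 1890520, 15364728]),
   (185, [24410310, 30439625, 30598372, 24976923, 28632292, 25093348, 29680868, 2046355,
    25614564, 27293897, 23913700, 29287652, 2024676, 27990811, 21292260, 28239076, 5563620]),
   (186, [30579910, 30467288, 25074886, 29662406, 24831204, 28763364, 24288454, 27321560,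
    24456547, 25736420, 29269190, 23895238, 2006214, 28370148, 8316132, 1631460, 21816548]),
   (187, [28735686, 30046409, 30336228, 29677796, 29680868, 29549796, 28632292, 21423332,
    21420260, 21526729, 19064036, 26404068, 2024676, 26532068, 19195108, 26535140, 19192036]),
   (188, [26647762, 21816536, 23764178, 19176658, 29930724, 30467300, 30074084, 21273810,
    12641508, 21685476, 28095716, 17603794, 1744082, 2006226, 19457252, 25355492, 26784996]),
   (189, [26163555, 24831192, 1500388, 26141924, 24818916, 24983907, 28519827, 24456547,
    30485859, 28501220, 30467300, 24437988, 24962276, 27845860, 8316132, 1631460, 27864419]),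
   (190, [26254546, 24962264, 1500388, 26141924, 24831204, 24818916, 8185060, 28519827,
    24320843, 24320795, 15262948, 2006226, 2006214, 27976932, 27964644, 20353837, 20341549]),
   (191, [24410310, 30439625, 30598372, 1500388, 29549796, 29680868, 24306916, 13821156,
    27056356, 27293897, 23913700, 29287652, 2024676, 20243684, 23782628, 29156580, 25081048]),
   (192, [15506642, 26141912, 26141924, 1500388, 29662418, 29650130, 26289995, 13952228,
    27172050, 27159762, 20243684, 25224408, 2006226, 24044772, 24032484, 29418724, 29406436]),
   (193, [30186706, 28370136, 29138130, 26516690, 1631460, 30467300, 30074084, 28220626,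
    23127268, 13734797, 28095716, 18783442, 17472722, 2006226, 25306919, 24700132, 20356321]),
   (194, [29772589, 21646893, 12503452, 29090228, 25876696, 22340836, 26010852, 18015460,
    14804196, 22209764, 779384, 21148897, 11724004, 14607588, 17347812, 27649252, 21017828]),
   (195, [25721030, 28080329, 29025508, 24303844, 28632292, 2046355, 27059428, 21423332,
    14907602, 17097956, 12379364, 22865124, 2024676, 28236004, 13624548, 21226724, 21289188]),
   (196, [29007046, 28107992, 27040966, 21404870, 24425700, 28763364, 30485907, 25599174,
    17079494, 15145803, 22846662, 12360902, 2006214, 21704083, 28357860, 21804260, 13651531]),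
   (197, [28861241, 28078649, 21656121, 13687000, 27583716, 28134957, 25483480, 21947620,
    13612257, 14801112, 776300, 11986148, 21142729, 16180452, 28236004, 25942232, 16439524]),
   (198, [29936013, 23251356, 12503452, 23060916, 27580632, 22340836, 25486564, 18015460,
    15980760, 22209764, 779384, 22590689, 11724004, 14607588, 18658532, 26073304, 22459620]),
   (199, [15506642, 26141912, 1500388, 24831204, 24818916, 26289995, 28519827, 30612299,
    30612251, 20243684, 25224420, 25224408, 24962276, 23520484, 23508196, 27862811, 27862859]),
   (200, [24934598, 24934601, 26156571, 26156583, 1500388, 15525092, 8157385, 25239079,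
    25239067, 20258343, 2024676, 2024673, 15235273, 27976932, 27976929, 27973860, 27973857]),
   (201, [28735686, 30046409, 30336228, 29284580, 29287652, 29549796, 24569060, 28632292,
    22865124, 22862052, 21526729, 19064036, 2024676, 18798820, 17622244, 18801892, 17619172]),
   (202, [28342470, 25327817, 30205156, 29391049, 29680868, 24569060, 29156580, 28239076,
    22996196, 21420260, 23099593, 17491172, 18801892, 2024676, 18905289, 19195108, 17725641]),
   (203, [21788870, 24672457, 29811937, 30598372, 30336228, 23782628, 19195108, 21292260,
    23258340, 29022436, 12613833, 1762532, 17622244, 2024676, 19326180, 30205156, 17884388]),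
   (204, [19295442, 23358665, 1865938, 24128915, 11572013, 30154387, 29943012, 24687844,
    22703314, 22451058, 16487246, 21673188, 13397202, 1731794, 10361639, 19444964, 18246881]),
   (205, [29912262, 27452632, 29811940, 21292257, 27990811, 5560545, 24044772, 26897606,
    16835809, 27728667, 22158947, 1762529, 20767972, 9495780, 22734049, 12248289, 18342360]),
   (206, [25721030, 28080329, 29025508, 25090276, 29549796, 13821156, 21423332, 25617636,
    19757266, 17097956, 12379364, 22865124, 2024676, 29153508, 21946804, 19626194, 23779556]),
   (207, [30620051, 29047187, 27212179, 25196745, 29680868, 21423332, 13821156, 2046355,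
    16966884, 19872147, 22077876, 19850468, 2024676, 29387977, 12510436, 22996196, 24017097]),
   (208, [30579922, 24437976, 30467300, 25074898, 29662418, 13952228, 21554404, 24288466,
    19867467, 17067218, 29269202, 23895250, 2006226, 21946801, 12641508, 23127268, 19969252]),
   (209, [29912274, 29811928, 21788897, 27862811, 1631460, 24044760, 27421921, 26928344,
    17229028, 28911387, 22289995, 1762505, 20767960, 9999149, 2155748, 20112612, 23389412]),
   (210, [28893617, 29024692, 23257524, 13687000, 25879780, 23054748, 26007768, 21947620,
    13612257, 15983844, 776300, 11986148, 22584521, 16180452, 22734052, 25552100, 16049380]),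
   (211, [27684038, 9999161, 2024673, 29811940, 27976932, 28894436, 2006226, 29943012, 9495780,
    22582070, 26942235, 21109543, 15787236, 15756486, 18518838, 10361639, 18244397]),
   (212, [27815110, 1631448, 26156583, 23520484, 24831204, 8303844, 20440292, 29432615,
    27466535, 30485859, 30202084, 28894436, 28370148, 27976932, 11542091, 27797275, 20094177]),
   (213, [27946182, 20353849, 26272996, 23520484, 27845860, 24962276, 8303844, 11461860,
    29432615, 26942235, 24320795, 2024676, 27714788, 2006214, 23650680, 30153499, 18244397]),
   (214, [29007058, 25748696, 27040978, 21404882, 30455012, 30074084, 28129683, 25599186,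
    17079506, 18178894, 22846674, 12360914, 2006226, 24687844, 25857427, 25912142, 25343204]),
   (215, [28342470, 25327817, 30205156, 20440280, 24306916, 28632292, 29156580, 26535140,
    16770276, 25614564, 23099593, 17491172, 18801892, 2024676, 28304612, 21292260, 25876708]),
   (216, [30186694, 25355480, 29138118, 26516678, 27845860, 24437988, 28763364, 28220614,
    23127256, 17242919, 25736420, 18783430, 17472710, 2006214, 11542091, 28845851, 21816548]),
   (217, [26163555, 24831192, 24831204, 1500388, 20243684, 28488932, 24983907, 5694692,
    13973907, 13973859, 29269202, 29269190, 15262948, 29153508, 29400265, 29153496, 29400289]),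
   (218, [28735686, 30046409, 30336228, 24303844, 24306916, 29549796, 24569060, 25617636,
    25614564, 21526729, 19064036, 26404068, 2024676, 28236004, 21292260, 28239076, 21289188]),
   (219, [30317766, 30074072, 29531334, 24550598, 24425700, 24437988, 28613830, 21554392,
    25748708, 25736420, 26385606, 19045574, 2006214, 28370148, 28357860, 21804260, 21816548]),
   (220, [28863686, 1631448, 30595297, 29811940, 27845860, 30467300, 29943012, 5560545,
    27582897, 27466535, 25832851, 20633825, 20618450, 27714788, 23388536, 28321563, 20094177]),
   (221, [25721030, 28080329, 30595300, 30336228, 27212179, 27059428, 21423332, 25617636,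
    22116562, 17097956, 12379364, 22865124, 2024676, 30202084, 27582900, 25539809, 26663140]),
   (222, [28342470, 25327817, 30205156, 28498148, 25093348, 29549796, 26535140, 28239076,
    19626194, 27056356, 23099593, 17491172, 18801892, 2024676, 29156568, 23782628, 20493528]),
   (223, [24410310, 30439625, 30598372, 28473545, 26404068, 25093348, 29680868, 24306916,
    19850468, 22862052, 27293897, 23913700, 2024676, 29418712, 17622244, 18801892, 20624600]),
   (224, [8288466, 23520472, 27862811, 28473569, 26516690, 25224420, 29650130, 27993883,
    19981540, 22977746, 27159762, 29287640, 20767960, 2006226, 17753316, 24032484, 18932964]),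
   (225, [28735686, 30046409, 30336228, 25090276, 25093348, 24569060, 28632292, 27059428,
    27056356, 21526729, 19064036, 26404068, 2024676, 29153508, 23782628, 29156580, 23779556]),
   (226, [24410310, 30439625, 30598372, 25196745, 24569060, 25093348, 24306916, 27190500,
    21420260, 27293897, 23913700, 29287652, 2024676, 29387977, 19195108, 26535140, 24017097]),
   (227, [29912262, 27452632, 26666209, 23520484, 28894436, 24044772, 29943012, 26928356,
    23258337, 29825819, 25435747, 1762529, 20767972, 27714788, 19326177, 17884385, 20100324]),
   (228, [29781190, 27421897, 24014022, 29811940, 8303844, 28894436, 24687844, 26897606,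
    26006130, 29964691, 21673188, 20737222, 1731794, 27714788, 19444964, 26797284, 1619172]),
   (229, [30317778, 28763352, 29531346, 24550610, 30455012, 30467300, 28613842, 21554404,
    28108004, 28095716, 26385618, 19045586, 2006226, 24687844, 24700132, 25355492, 25343204]),
   (230, [28342470, 25327817, 27842788, 30598372, 30336228, 29156580, 26535140, 28239076,
    22394081, 29022436, 23099593, 17491172, 18801892, 2024676, 27925275, 26666212, 26757945]),
   (231, [28735686, 30046409, 30595300, 30598372, 29549796, 24569060, 28632292, 29025508,
    29022436, 21526729, 19064036, 26404068, 2024676, 30202084, 26666212, 30205156, 26663140]),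
   (232, [30579922, 24437976, 25074898, 29662418, 24831204, 30074084, 24288466, 27321572,
    25770339, 28095716, 29269202, 23895250, 2006226, 28894436, 24700132, 25355492, 27864419]),
   (233, [24410310, 30439625, 26156571, 30336228, 25093348, 29680868, 24306916, 27212179,
    29022436, 27293897, 23913700, 29287652, 2024676, 23520484, 26666212, 30205156, 28891361])]

/-- The other rays, each with its facets grouped into weighted components, the codes of the
neighbours, and facets with codes of rays witnessing that the facets have rank 17. -/
def cusps : List (ℕ × List (List (ℕ × ℕ)) × List ℕ × List (ℕ × ℕ)) :=
  [(0, [[(0, 1), (1, 1), (2, 1), (3, 1), (16, 1)], [(4, 1), (5, 1), (6, 1), (7, 1), (17, 1)],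
    [(8, 1), (9, 1), (10, 1), (11, 1), (18, 1)], [(12, 1), (13, 1), (14, 1), (15, 1), (19, 1)]],
    [3728531, 2942027, 2942051, 2942099, 2767251, 2929739, 320587, 451611, 451659, 2505035,
    2929763, 451623, 320611, 451683, 2505059, 2929811, 451719, 451731, 320659, 2505107, 2804115,
    2541899, 2541923, 2541971, 2379411, 2923595, 317515, 448539, 448587, 2501963, 292939,
    2921294, 447006, 447054, 2500430, 423963, 422430, 413238, 3073051, 2636059, 424011, 422478,
    3073099, 413382, 2636107, 2526539, 2525006, 2672923, 2672971, 151115, 2923619, 448551,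
    317539, 448611, 2501987, 423975, 413214, 422454, 3073063, 2636071, 292963, 447030, 2921330,
    447090, 2500466, 424035, 3073123, 422514, 413394, 2636131, 2526563, 2672935, 2525042,
    2672995, 151139, 2923667, 448647, 448659, 317587, 2502035, 424071, 413262, 3073159, 422598,
    2636167, 424083, 3073171, 413298, 422610, 2636179, 293011, 447174, 447186, 2921426, 2500562,
    2526611, 2673031, 2673043, 2525138, 151187, 2810259, 2548043, 2548067, 2548115, 2388627,
    2535755, 2528078, 2679067, 2679115, 160331, 2535779, 2679079, 2528114, 2679139, 160355,
    2535827, 2679175, 2679187, 2528210, 160403, 2413203, 184907, 184931, 184979, 2266003,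
    2921291, 292942, 447003, 447051, 2500427, 317518, 2923598, 448542, 448590, 2501966, 422427,
    423966, 413241, 3073054, 2636062, 422475, 424014, 3073102, 413385, 2636110, 2525003, 2526542,
    2672926, 2672974, 151118, 320590, 2929742, 451614, 451662, 2505038, 2942030, 3728540,
    2942060, 2942108, 2767260, 451629, 2929772, 320620, 451692, 2505068, 451725, 2929820, 451740,
    320668, 2505116, 2541902, 2804124, 2541932, 2541980, 2379420, 413211, 423981, 422457,
    3073069, 2636077, 448557, 2923628, 317548, 448620, 2501996, 447033, 292972, 2921336, 447096,
    2500472, 3073132, 424044, 422520, 413400, 2636140, 2672941, 2526572, 2525048, 2673004,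
    151148, 413259, 424077, 3073165, 422601, 2636173, 448653, 2923676, 448668, 317596, 2502044,
    3073180, 424092, 413304, 422616, 2636188, 447177, 293020, 447192, 2921432, 2500568, 2673037,
    2526620, 2673052, 2525144, 151196, 2528075, 2535758, 2679070, 2679118, 160334, 2548046,
    2810268, 2548076, 2548124, 2388636, 2679085, 2535788, 2528120, 2679148, 160364, 2679181,
    2535836, 2679196, 2528216, 160412, 184910, 2413212, 184940, 184988, 2266012, 2921315, 447015,
    292978, 447075, 2500451, 422439, 413229, 423990, 3073078, 2636086, 317554, 448566, 2923634,
    448626, 2502002, 422499, 3073138, 424050, 413409, 2636146, 2525027, 2672950, 2526578,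
    2673010, 151154, 413223, 422445, 423993, 3073081, 2636089, 447021, 2921324, 292984, 447084,
    2500460, 448569, 317560, 2923640, 448632, 2502008, 3073144, 422508, 424056, 413412, 2636152,
    2672953, 2525036, 2526584, 2673016, 151160, 320626, 451638, 2929778, 451698, 2505074, 451641,
    320632, 2929784, 451704, 2505080, 2942066, 2942072, 3728564, 2942132, 2767284, 451761,
    451764, 2929844, 320692, 2505140, 2541938, 2541944, 2804148, 2542004, 2379444, 413283,
    3073201, 424113, 422625, 2636209, 3073204, 413292, 424116, 422628, 2636212, 448689, 448692,
    2923700, 317620, 2502068, 447201, 447204, 293044, 2921444, 2500580, 2673073, 2673076,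
    2526644, 2525156, 151220, 2528099, 2679094, 2535794, 2679154, 160370, 2679097, 2528108,
    2535800, 2679160, 160376, 2548082, 2548088, 2810292, 2548148, 2388660, 2679217, 2679220,
    2535860, 2528228, 160436, 184946, 184952, 2413236, 185012, 2266036, 2921363, 447111, 447123,
    293074, 2500499, 422535, 413325, 3073222, 424134, 2636230, 422547, 3073234, 413361, 424146,
    2636242, 317650, 448710, 448722, 2923730, 2502098, 2525075, 2673094, 2673106, 2526674,
    151250, 413319, 422541, 3073225, 424137, 2636233, 447117, 2921372, 447132, 293080, 2500508,
    3073240, 422556, 413364, 424152, 2636248, 448713, 317656, 448728, 2923736, 2502104, 2673097,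
    2525084, 2673112, 2526680, 151256, 413331, 3073249, 422577, 424161, 2636257, 3073252, 413340,
    422580, 424164, 2636260, 447153, 447156, 2921396, 293092, 2500532, 448737, 448740, 317668,
    2923748, 2502116, 2673121, 2673124, 2525108, 2526692, 151268, 320722, 451782, 451794,
    2929874, 2505170, 451785, 320728, 451800, 2929880, 2505176, 451809, 451812, 320740, 2929892,
    2505188, 2942162, 2942168, 2942180, 3728612, 2767332, 2542034, 2542040, 2542052, 2804196,
    2379492, 2528147, 2679238, 2679250, 2535890, 160466, 2679241, 2528156, 2679256, 2535896,
    160472, 2679265, 2679268, 2528180, 2535908, 160484, 2548178, 2548184, 2548196, 2810340,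
    2388708, 185042, 185048, 185060, 2413284, 2266084, 2811027, 2548811, 2548835, 2548883,
    2390163, 2536523, 2530382, 2679835, 2679883, 161867, 2536547, 2679847, 2530418, 2679907,
    161891, 2536595, 2679943, 2679955, 2530514, 161939, 2414739, 186443, 186467, 186515, 2268307,
    2530379, 2536526, 2679838, 2679886, 161870, 2548814, 2811036, 2548844, 2548892, 2390172,
    2679853, 2536556, 2530424, 2679916, 161900, 2679949, 2536604, 2679964, 2530520, 161948,
    186446, 2414748, 186476, 186524, 2268316, 2530403, 2679862, 2536562, 2679922, 161906,
    2679865, 2530412, 2536568, 2679928, 161912, 2548850, 2548856, 2811060, 2548916, 2390196,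
    2679985, 2679988, 2536628, 2530532, 161972, 186482, 186488, 2414772, 186548, 2268340,
    2530451, 2680006, 2680018, 2536658, 162002, 2680009, 2530460, 2680024, 2536664, 162008,
    2680033, 2680036, 2530484, 2536676, 162020, 2548946, 2548952, 2548964, 2811108, 2390244,
    186578, 186584, 186596, 2414820, 2268388, 2417811, 189515, 189539, 189587, 2274451, 189518,
    2417820, 189548, 189596, 2274460, 189554, 189560, 2417844, 189620, 2274484, 189650, 189656,
    189668, 2417892, 2274532, 2286739, 2286748, 2286772, 2286820, 124132], [(0, 3728531), (1,
    2921291), (2, 2921315), (3, 2921363), (16, 2811027), (5, 2923595), (6, 2923619), (7,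
    2923667), (17, 2810259), (9, 2929739), (10, 2929763), (11, 2929811), (18, 2804115), (13,
    2942027), (14, 2942051), (15, 2942099), (19, 2767251)]),
   (1, [[(0, 1), (5, 1), (25, 1)], [(1, 1), (4, 1), (31, 1)], [(2, 1), (6, 1), (8, 1), (9, 1),
    (10, 2), (18, 1), (22, 1)], [(3, 1), (7, 1), (12, 1), (13, 1), (15, 2), (19, 1), (23, 1)]],
    [8688612, 6067172, 4887521, 4887524, 14193636, 4744116, 5923764, 6054836, 1214436, 5366151,
    5366919, 8807348, 811956, 4350900, 4875185, 5353767, 6279827, 1390962, 9285987, 4567395,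
    684598, 4875188, 5354535, 1427922, 6281363, 9286755, 4568163, 684601, 14181300, 8819684,
    9298323, 9299091, 7771108, 6403171, 8545204, 4756452, 824292, 4579731, 4580499, 6415507,
    517267, 3314660, 5936100, 4363236, 709318, 709321, 8557540, 3302324, 4101092, 6214291,
    1325426, 4940721, 5288231, 9220451, 750134, 4501859, 1362386, 6215827, 4940724, 5288999,
    9221219, 750137, 4502627, 4953057, 4953060, 8754148, 6132708, 14259172, 5989300, 4809652,
    5300615, 5301383, 6120372, 1279972, 8872884, 4416436, 832611, 9232787, 9233555, 14246836,
    8885220, 7836644, 8610740, 6337635, 774854, 774857, 6001636, 4428772, 8623076, 4166628,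
    3367860, 4514195, 4514963, 4821988, 844947, 6349971, 3380196, 451731, 5805025, 4232161,
    578273, 709345, 8426465, 3175026, 3961458, 4219825, 4642963, 750257, 5157174, 6448049,
    3387747, 422514, 553649, 774881, 5870561, 4297697, 8492001, 4026994, 3203475, 684721,
    5169606, 4285361, 4708499, 6513585, 488050, 3322211, 8414129, 6460385, 8479665, 6525921,
    582035, 4023217, 3957681, 3199698, 3400083, 4051666, 512722, 4035553, 2744723, 184931,
    3986130, 447186, 3191139, 3334547, 3970017, 160403, 2679187, 6214300, 1325432, 5288237,
    4943025, 9220460, 751670, 4501868, 1362392, 6215836, 5289005, 4943028, 9221228, 751673,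
    4502636, 5300621, 5301389, 1281508, 6122676, 8875188, 4418740, 832620, 4955361, 4955364,
    6135012, 8756452, 14261476, 5991604, 4811956, 9232796, 9233564, 8887524, 14249140, 7838948,
    8613044, 6337644, 776390, 776393, 4431076, 6003940, 8625380, 4168932, 3370164, 4514204,
    4514972, 844956, 4824292, 6349980, 3382500, 451740, 1215972, 6057140, 5366157, 5366925,
    8809652, 814260, 4353204, 6069476, 8690916, 4889825, 4889828, 14195940, 4746420, 5926068,
    5353773, 4877489, 6279836, 1390968, 9285996, 4567404, 686134, 5354541, 4877492, 1427928,
    6281372, 9286764, 4568172, 686137, 8821988, 14183604, 9298332, 9299100, 7773412, 6403180,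
    8547508, 826596, 4758756, 4579740, 4580508, 6415516, 517276, 3316964, 4365540, 5938404,
    710854, 710857, 8559844, 3304628, 4103396, 4641436, 4222132, 5157945, 751796, 6450356,
    3388524, 424056, 4234468, 5807332, 710884, 579812, 8428772, 3176568, 3963000, 5170377,
    686260, 4706972, 4287668, 6515892, 489592, 3322988, 776420, 555188, 4300004, 5872868,
    8494308, 4028536, 3204252, 6462692, 8416436, 6528228, 8481972, 582812, 4025524, 3959988,
    3400860, 3201240, 514264, 4053208, 4037860, 2745500, 186476, 448728, 3987672, 3335324,
    3191916, 3972324, 161948, 2679964, 5805028, 4232164, 709348, 578276, 8426468, 3175032,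
    3961464, 4219828, 4642972, 5157177, 751793, 6448052, 3388515, 422520, 684724, 5169609,
    4706963, 4287665, 6515889, 489586, 3322220, 553652, 776417, 4300001, 5872865, 8494305,
    4028530, 3203484, 8414132, 6460388, 6528225, 8481969, 582044, 4025521, 3957684, 3199704,
    3400851, 514258, 4053202, 4037857, 2745491, 184940, 3986136, 447192, 3334556, 3191148,
    3970020, 160412, 2679196, 4641427, 4222129, 750260, 5157942, 6450353, 3387756, 424050,
    4234465, 5807329, 579809, 710881, 8428769, 3176562, 3962994, 774884, 555185, 5870564,
    4297700, 8492004, 4027000, 3204243, 5170374, 686257, 4285364, 4708508, 6513588, 488056,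
    3322979, 6462689, 8416433, 8479668, 6525924, 582803, 4023220, 3959985, 3400092, 3201234,
    4051672, 512728, 4035556, 2744732, 186467, 448722, 3987666, 3191907, 3335315, 3972321,
    161939, 2679955, 3855076, 293044, 3191154, 3191160, 3846580, 160436, 2535860, 317668,
    3856612, 3191922, 3191928, 3847348, 161972, 2536628, 3203538, 3204306, 3920612, 358580,
    3912116, 2601396, 189539, 3203544, 3204312, 383204, 3922148, 3912884, 2602164, 189548,
    3858916, 3859684, 3924452, 3925220, 189620, 2483380, 2417844, 185060, 186596, 2613732,
    2614500, 2483428, 124132, 2286772, 2548196, 2548964, 189650, 189656, 2417892, 2274532,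
    58596], [(0, 8688612), (5, 6214300), (25, 5805028), (4, 6214291), (31, 5805025), (6,
    6054836), (8, 4875185), (9, 4875188), (10, 14181300), (18, 4756452), (22, 5936100), (7,
    6067172), (12, 4887521), (13, 4887524), (15, 14193636), (19, 4744116), (23, 5923764)]),
   (2, [[(0, 1), (1, 1), (2, 2), (4, 1), (5, 1), (6, 2), (16, 1), (17, 1), (22, 1)], [(8, 1),
    (9, 1), (11, 2), (12, 1), (13, 1), (15, 2), (18, 1), (19, 1), (23, 1)]], [1368530, 7516626,
    7216049, 1356242, 7528914, 7228337, 4213681, 4201393, 413298, 7516632, 1368536, 7216052,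
    7528920, 1356248, 7228340, 4213684, 4201396, 413304, 7254497, 7254500, 293044, 7266785,
    7266788, 317620, 3852004, 3815140, 2923700, 1369298, 7517394, 7216817, 1357010, 7529682,
    7229105, 4214449, 4202161, 413361, 7517400, 1369304, 7216820, 7529688, 1357016, 7229108,
    4214452, 4202164, 413364, 7255265, 7255268, 317668, 7267553, 7267556, 293092, 3852772,
    3815908, 2921396, 4240609, 4240612, 3859684, 4252897, 4252900, 3847396, 186596, 162020,
    2530484, 4239841, 4239844, 3858916, 4252129, 4252132, 3846628, 185060, 160484, 2528180,
    451794, 451800, 2942180, 451809, 451812, 2929892, 2542052, 2505188, 58596], [(0, 1368530),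
    (1, 7516632), (2, 7254497), (4, 1369298), (5, 7517400), (6, 7255265), (16, 4240609), (17,
    4239841), (22, 451794), (9, 7516626), (11, 7216049), (12, 1356242), (13, 7528914), (15,
    7228337), (18, 4213681), (19, 4201393), (23, 413298)]),
   (3, [[(0, 2), (1, 1), (2, 1), (16, 1), (29, 1)], [(4, 2), (5, 1), (6, 1), (17, 1), (43, 1)],
    [(8, 1), (9, 1), (11, 2), (12, 1), (14, 1), (15, 2), (18, 1), (19, 1), (23, 1)]], [1980813,
    10493548, 1980750, 2017713, 10505848, 2017650, 544397, 532145, 451623, 13121165, 18495117,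
    10368653, 15780273, 13388664, 2000760, 12995448, 9320077, 7353997, 15743373, 13376364,
    1976172, 13158065, 18532017, 10405553, 9356977, 12983148, 7390897, 8970706, 12759494, 684685,
    8958406, 12771794, 709297, 5165793, 5141193, 4100984, 7397842, 7516614, 447174, 7385542,
    7528914, 422610, 3983046, 3946194, 3073171, 13121933, 18495885, 10369421, 15779505, 13389432,
    2002296, 12996216, 9320845, 7354765, 10631580, 14039452, 18364828, 2017716, 1855096,
    15617656, 10243704, 6961564, 7616924, 1718684, 10762652, 13253020, 1754804, 10798772,
    13289140, 7128756, 7092636, 1325468, 6599128, 10138072, 12890584, 6861257, 6730200, 9089496,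
    6468056, 776306, 4501976, 1225176, 7254488, 7223708, 7385545, 1356248, 7647704, 4638388,
    4471196, 424092, 15742605, 13377132, 1977708, 13158833, 18532785, 10406321, 9357745,
    12983916, 7391665, 1717916, 10761884, 13252252, 1755572, 10799540, 13289908, 7129524,
    7091868, 1362356, 1980828, 1842796, 15605356, 10668468, 14076340, 18401716, 6998452,
    10231404, 7653812, 6873569, 6742500, 9101796, 6611428, 10150372, 12902884, 779474, 6480356,
    4514276, 7397857, 1368548, 7660004, 1237476, 7266788, 7260596, 4508084, 4601500, 448692,
    8971474, 12760262, 686221, 8959174, 12772562, 710833, 5167329, 5142729, 4103288, 6599896,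
    10138840, 12891352, 6862025, 6730968, 9090264, 6468824, 776312, 4502744, 6874337, 6743268,
    9102564, 6612196, 10151140, 12903652, 779480, 6481124, 4515044, 832728, 6337752, 4839604,
    845028, 6350052, 4842724, 3397812, 3400932, 189560, 4371672, 4240600, 3990756, 4383972,
    4252900, 3978456, 186584, 162020, 2680036, 7398610, 7517382, 448710, 7386310, 7529682,
    424146, 3983814, 3946962, 3073234, 1225944, 7255256, 7222940, 7386313, 1357016, 7648472,
    4639156, 4470428, 422556, 7398625, 1369316, 7660772, 1238244, 7267556, 7259828, 4507316,
    4602268, 447156, 4370904, 4239832, 3989988, 4383204, 4252132, 3977688, 185048, 160484,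
    2679268, 451782, 320728, 2942168, 451809, 320740, 2929892, 2542040, 2505188, 58596], [(0,
    1980813), (1, 13121933), (2, 15742605), (16, 8971474), (29, 7398610), (5, 13121165), (6,
    15743373), (17, 8970706), (43, 7397842), (9, 10493548), (11, 1980750), (12, 2017713), (14,
    10505848), (15, 2017650), (18, 544397), (19, 532145), (23, 451623)]),
   (4, [[(0, 2), (28, 1), (29, 1)], [(1, 1), (2, 1), (4, 2), (5, 3), (6, 3), (17, 2), (21, 1),
    (22, 1)], [(3, 2), (8, 1), (11, 3), (12, 1), (15, 3), (18, 1), (19, 1), (23, 2)]], [18932169,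
    19980745, 23126473, 19968457, 23114185, 11237451, 11237403, 2003940, 18932193, 19980769,
    23126497, 19968481, 23114209, 11234379, 11234331, 2003928, 976082, 18954541, 23673133,
    18954637, 23673229, 10565966, 10565918, 3466387, 23650761, 23148845, 11461767, 23148941,
    11449479, 13072459, 13072411, 2006055, 23650785, 23145773, 11461779, 23145869, 11449491,
    13069387, 13069339, 2006043, 3465682, 2041756, 2090131, 2041708, 2090083, 512710, 512566,
    581927, 10543570, 11199635, 13034643, 11187347, 13022355, 5147958, 5123382, 413298, 10543558,
    11199623, 13034631, 11187335, 13022343, 5147934, 5123358, 413262, 9744856, 7892013, 14314604,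
    11050029, 16030828, 751757, 4942956, 9071724, 9757156, 11037753, 16018552, 7904313, 14326904,
    4946076, 751724, 9084024, 5432530, 9776492, 21064812, 9779612, 21067932, 4290716, 4287596,
    7773304, 21017816, 14407860, 5027032, 16111844, 579764, 8485020, 5872760, 8428664, 21030116,
    16114868, 555164, 14410980, 5039332, 5879000, 8481900, 8416364, 7857380, 9164980, 8512740,
    9168100, 8509620, 4056292, 4053172, 189560, 4252900, 713953, 8447204, 4908260, 5825764,
    3185784, 162020, 3972216, 4240600, 4895960, 5813464, 713944, 8434904, 186584, 3173484,
    3959916, 9757144, 11037741, 16018540, 7904301, 14326892, 4943004, 751661, 9084012, 9744868,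
    7892025, 14314616, 11050041, 16030840, 751772, 4946028, 9071736, 5432518, 9779564, 21067884,
    9776540, 21064860, 4287644, 4290668, 7773292, 21030104, 16111796, 555188, 14407908, 5039320,
    5872856, 8484972, 8416376, 21017828, 14410932, 5027044, 16114916, 579740, 8481948, 5878904,
    8428652, 7857332, 9168052, 8509668, 9165028, 8512692, 4053220, 4056244, 189548, 4240612,
    4895972, 5813476, 713956, 8434916, 186596, 3173496, 3959928, 4252888, 713929, 8447192,
    4908248, 5825752, 3185772, 162008, 3972204], [(0, 18932169), (28, 9744856), (29, 9757144),
    (2, 18932193), (4, 976082), (5, 23650761), (6, 23650785), (17, 3465682), (21, 10543570), (22,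
    10543558), (8, 19980745), (11, 23126473), (12, 19968457), (15, 23114185), (18, 11237451),
    (19, 11237403), (23, 2003940)]),
   (5, [[(0, 1), (1, 1), (28, 1), (35, 1)], [(2, 2), (4, 1), (5, 1), (6, 2), (17, 1), (22, 1),
    (41, 1)], [(3, 2), (8, 1), (11, 3), (13, 1), (15, 3), (18, 1), (19, 1), (23, 2)]], [18788818,
    19620728, 22983122, 19837394, 22852050, 11232120, 11363192, 2011602, 22385588, 18060212,
    26055604, 12527468, 25531316, 14652340, 11768756, 22254516, 17245982, 15017836, 23275372,
    12663181, 21707149, 9906028, 1779564, 16852844, 13734836, 21980024, 27616120, 17114988,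
    25912184, 16212856, 12018552, 13528103, 16765617, 14537393, 22663857, 2041708, 21222065,
    9425585, 6935217, 16634545, 9613778, 10906663, 15890531, 8041619, 14726291, 5362353, 817299,
    8940583, 9875922, 7892007, 14579811, 11187347, 16168083, 750221, 5270567, 9333799, 18801112,
    19849688, 22864344, 19623128, 22995416, 11365592, 11234520, 2023896, 17247566, 12662317,
    21706285, 15019420, 23276956, 1781148, 9907612, 16854428, 22387940, 12529052, 25533668,
    18062564, 26057956, 11771108, 14654692, 22256868, 13737188, 17116572, 25914584, 21982424,
    27618520, 12020952, 16215256, 13540397, 16767201, 2043292, 21223649, 14538977, 22665441,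
    6936801, 9427169, 16636129, 9626072, 8053916, 14738588, 10918957, 15915116, 841884, 5363937,
    8952877, 9888216, 11199644, 16180380, 7904301, 14604396, 5282861, 751661, 9346093, 10412516,
    11037750, 12900529, 10918969, 12769400, 4829656, 5139510, 448689, 16503476, 14406324,
    22532788, 1915292, 21090996, 9294516, 6804148, 16372404, 12310756, 9774956, 17422564,
    11917540, 18733284, 1431780, 7198948, 12179684, 13559012, 16114100, 16081784, 11920612,
    16356216, 6283700, 6525816, 686179, 6673076, 9163444, 12964532, 7070948, 10212020, 4575924,
    512692, 6542004, 4371666, 4895954, 5944530, 713944, 8565970, 186578, 3307667, 4109522,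
    4252897, 582881, 8447201, 4908260, 5825761, 3185778, 162020, 3972210, 10400225, 10906678,
    12744818, 11050041, 12875956, 5151801, 4830328, 424116, 12309172, 11915956, 18731700,
    9776540, 17420980, 7197364, 1387932, 12135836, 16505060, 1914476, 21092580, 14407908,
    22534372, 6805732, 9296100, 16373988, 13546721, 11919796, 16358616, 16114916, 16084184,
    6528216, 6284516, 710764, 6674660, 7070132, 10213604, 9165028, 12966116, 514276, 4577508,
    6543588, 4383960, 713926, 8578264, 4908248, 5956824, 3332252, 162008, 4121816, 4240612,
    4895969, 5813476, 582884, 8434916, 186596, 3173496, 3959928], [(0, 18788818), (1, 18801112),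
    (28, 10412516), (35, 10400225), (4, 22385588), (5, 17245982), (6, 13734836), (17, 16765617),
    (22, 9613778), (41, 9875922), (8, 19620728), (11, 22983122), (13, 19837394), (15, 22852050),
    (18, 11232120), (19, 11363192), (23, 2011602)]),
   (6, [[(0, 1), (5, 1), (29, 1), (45, 1)], [(1, 1), (4, 1), (35, 1), (43, 1)], [(2, 1), (6, 1),
    (8, 1), (9, 1), (11, 2), (14, 2), (15, 2), (18, 1), (19, 1), (22, 1), (23, 1)]], [18141924,
    15124148, 12437169, 12437937, 17025457, 22074084, 19714788, 2083249, 11326180, 14865124,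
    8049380, 12371633, 12372401, 18207460, 15189684, 22139620, 16959921, 19780324, 14930660,
    8114916, 2017713, 11391716, 14734049, 9619121, 12047073, 1820337, 11788754, 15917522,
    10924486, 6926790, 5353926, 8958406, 709234, 11981537, 1754801, 14799585, 9684657, 15983058,
    11723218, 10990022, 9023942, 774770, 6861254, 5288390, 12371636, 12372404, 15190452,
    18208996, 22141156, 16959924, 19781860, 14932196, 8116452, 2017716, 11393252, 15124916,
    18143460, 12437172, 12437940, 17025460, 22075620, 19716324, 2083252, 11327716, 14866660,
    8050916, 1755572, 11983076, 9685428, 14801124, 15983832, 11723992, 10990793, 9024713, 776312,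
    6862025, 5289161, 9619892, 14735588, 1821108, 12048612, 11789528, 15918296, 10925257,
    6927561, 5354697, 8959177, 710776, 14734052, 9619124, 1821105, 12048609, 11789522, 15917528,
    10924489, 6927558, 5354694, 8958409, 709240, 1755569, 11983073, 14799588, 9684660, 15983064,
    11723986, 10990025, 9023945, 774776, 6862022, 5289158, 8839652, 1238244, 6676961, 6677729,
    6415585, 6087140, 4776420, 517345, 160484, 4383204, 3334628, 6611425, 6612193, 8905188,
    1303780, 6152676, 6350049, 4841956, 4448740, 3400164, 451809, 189554, 11981540, 1754804,
    9685425, 14801121, 15983826, 11723224, 10990790, 9024710, 776306, 6861257, 5288393, 9619889,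
    14735585, 12047076, 1820340, 11788760, 15918290, 10925254, 6926793, 5353929, 8959174, 710770,
    6611428, 6612196, 1303012, 8905956, 6153444, 6350052, 4842724, 4449508, 3400932, 451812,
    189560, 1237476, 8840420, 6676964, 6677732, 6415588, 6087908, 4777188, 517348, 162020,
    4383972, 3335396], [(0, 18141924), (5, 12371636), (29, 14734052), (45, 11981540), (4,
    12371633), (35, 14734049), (43, 11981537), (6, 15124148), (8, 12437169), (9, 12437937), (11,
    17025457), (14, 22074084), (15, 19714788), (18, 2083249), (19, 11326180), (22, 14865124),
    (23, 8049380)]),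
   (7, [[(0, 2), (1, 2), (4, 2), (5, 2), (16, 1), (17, 1), (20, 1), (21, 1)], [(10, 2), (11, 2),
    (14, 2), (15, 2), (18, 1), (19, 1), (22, 1), (23, 1)], [(40, 1), (47, 1)], [(41, 1), (46,
    1)]], [11541278, 11579873, 23469598, 23519713, 23519665, 11579825, 23469646, 11541326,
    11553566, 23481886, 11592161, 23507425, 23507377, 23481934, 11592113, 11553614, 19353166,
    23717074, 18997714, 19340878, 19353118, 18997618, 23716978, 19340830, 23651538, 19287630,
    19275342, 18932178, 18932082, 19287582, 19275294, 23651442, 11541275, 23469595, 11579876,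
    23519716, 23519668, 23469643, 11579828, 11541323, 11553563, 11592164, 23481883, 23507428,
    23507380, 11592116, 23481931, 11553611, 19352398, 18998482, 23716306, 19340110, 19352350,
    23716210, 18998386, 19340062, 23651544, 19275339, 19287627, 18932184, 18932088, 19275291,
    19287579, 23651448, 23520481, 11580641, 23468830, 11542046, 11542094, 11580593, 23468878,
    23520433, 23508193, 23481118, 11592929, 11554334, 11554382, 23481166, 11592881, 23508145,
    19340875, 23717080, 18997720, 19353163, 19340827, 18997624, 23716984, 19353115, 18932946,
    19286862, 19274574, 23650770, 23650674, 19286814, 19274526, 18932850, 23520484, 23468827,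
    11580644, 11542043, 11542091, 23468875, 11580596, 23520436, 23508196, 11592932, 23481115,
    11554331, 11554379, 11592884, 23481163, 23508148, 19340107, 18998488, 23716312, 19352395,
    19340059, 23716216, 18998392, 19352347, 18932952, 19274571, 19286859, 23650776, 23650680,
    19274523, 19286811, 18932856, 23678509, 19391716, 19390948, 18947629, 18959917, 19379428,
    19378660, 23666221, 23678605, 19390900, 19391668, 18947725, 18960013, 19378612, 19379380,
    23666317, 10571342, 10609892, 10609124, 10559054, 10571294, 10609076, 10609844, 10559006,
    3466468, 5432548, 5432545, 582857, 582713, 5432500, 5432497, 3466420, 18947623, 19391713,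
    19390945, 23678503, 23666215, 19379425, 19378657, 18959911, 18947719, 19390897, 19391665,
    23678599, 23666311, 19378609, 19379377, 18960007, 10559051, 10609889, 10609121, 10571339,
    10559003, 10609073, 10609841, 10571291, 582089, 5431780, 5431777, 3465700, 3465652, 5431732,
    5431729, 581945, 19326180, 23612973, 18882093, 19325412, 19325364, 23613069, 18882189,
    19326132, 19313892, 18894381, 23600685, 19313124, 19313076, 18894477, 23600781, 19313844,
    5393998, 3427918, 544412, 5393950, 5381710, 532124, 3415630, 5381662, 10544356, 10505806,
    10493518, 10543588, 10543540, 10505758, 10493470, 10544308, 19326177, 18882087, 23612967,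
    19325409, 19325361, 18882183, 23613063, 19326129, 19313889, 23600679, 18894375, 19313121,
    19313073, 23600775, 18894471, 19313841, 5393995, 544403, 3427915, 5393947, 5381707, 3415627,
    532115, 5381659, 10544353, 10493515, 10505803, 10543585, 10543537, 10493467, 10505755,
    10544305], [(0, 11541278), (1, 11541275), (4, 23520481), (5, 23520484), (16, 23678509), (17,
    18947623), (20, 19326180), (21, 19326177), (11, 23519665), (14, 11553566), (15, 23507377),
    (18, 19353166), (19, 19353118), (22, 23651538), (23, 18932082), (47, 23469598), (46,
    11579873)]),
   (8, [[(0, 2), (1, 2), (4, 2), (6, 2), (9, 2), (11, 2), (14, 2), (15, 2), (16, 1), (17, 1),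
    (18, 1), (19, 1), (20, 1), (21, 1), (22, 1), (23, 1)], [(40, 2), (45, 2)]], [20105586,
    11585906, 11592152, 20111832, 11548238, 20067918, 20100324, 11580644, 20061723, 11542043,
    11574449, 20094129, 11553575, 20073255, 20079501, 11559821, 23447922, 23410254, 23404059,
    23454168, 23442660, 23415591, 23421837, 23436465, 23382386, 23344718, 23338523, 23388632,
    23377124, 23350055, 23356301, 23370929], [(0, 20105586), (1, 11592152), (4, 11548238), (6,
    20100324), (9, 20061723), (11, 11574449), (14, 11553575), (15, 20079501), (16, 23447922),
    (17, 23404059), (18, 23442660), (19, 23421837), (20, 23382386), (21, 23338523), (22,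
    23377124), (23, 23356301), (45, 11585906)]),
   (9, [[(0, 1), (1, 1), (2, 2), (8, 1), (9, 1), (11, 2), (14, 2), (15, 2), (16, 1), (18, 1),
    (19, 1), (22, 1), (23, 1)], [(4, 2), (5, 2), (17, 1), (43, 1), (45, 1)]], [17483441,
    20629172, 9619121, 1754801, 13158065, 20629169, 17483444, 9619124, 13158068, 1754804,
    1755569, 1755572, 8839652, 10668465, 10668468, 17491169, 20636900, 9626849, 1762529,
    13165793, 20636897, 17491172, 9626852, 13165796, 1762532, 1759457, 1759460, 8835764,
    10675425, 10675428, 1357010, 1357016, 6087140, 7267553, 7267556, 1341650, 1341656, 6083252,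
    7259825, 7259828, 11983073, 11983076, 845028, 6612193, 6612196, 11979185, 11979188, 840372,
    6604465, 6604468, 6175123, 6175132, 160484, 4602259, 4602268, 7386310, 7386313, 4383204,
    451809, 451812, 7374646, 7374649, 4379316, 447153, 447156], [(0, 17483441), (1, 20629169),
    (2, 1755569), (8, 17491169), (9, 20636897), (11, 1759457), (14, 1357010), (15, 1341650), (16,
    11983073), (18, 11979185), (19, 6175123), (22, 7386310), (23, 7374646), (5, 20629172), (17,
    9619121), (43, 1754801), (45, 13158065)]),
   (10, [[(0, 1), (1, 2), (2, 1), (4, 2), (5, 2), (16, 1), (17, 1), (21, 1), (43, 1)], [(8, 2),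
    (11, 2), (12, 1), (14, 1), (15, 2), (18, 1), (19, 1), (23, 1), (46, 1)]], [20716333,
    17570668, 2155730, 17832812, 19410317, 9837420, 12196716, 1710956, 13376364, 1718684,
    1849756, 19429577, 24148184, 15366360, 9225908, 18619244, 10754924, 10762652, 17701677,
    20454252, 17884388, 20899044, 24128924, 9706348, 17308524, 13245292, 1842796, 1369286,
    1219800, 20767969, 17753313, 1731800, 6049436, 11673196, 7346989, 7517382, 1225944, 1366244,
    17622244, 20505828, 1865944, 6212020, 11803500, 7612268, 7255256, 11711716, 11855076,
    12248292, 17360100, 18670820, 779480, 12117220, 7136484, 6743268, 6074840, 6218164, 9888996,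
    9757924, 9212792, 185048, 751715, 4494200, 4239832, 7398625, 7660772, 1762532, 13296868,
    10806500, 4507316, 7084908, 447156, 451812, 7517412, 7216796, 13427940, 1893604, 10775768,
    4214428, 6691692, 413340, 320728], [(0, 20716333), (1, 1718684), (2, 17701677), (4, 1369286),
    (5, 1225944), (16, 11711716), (17, 6074840), (21, 7398625), (43, 7517412), (11, 17570668),
    (12, 2155730), (14, 17832812), (15, 19410317), (18, 9837420), (19, 12196716), (23, 1710956),
    (46, 13376364)]),
   (11, [[(0, 4), (1, 4), (2, 4), (16, 3), (20, 1), (21, 1), (22, 1)], [(7, 4), (11, 4), (15,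
    4), (17, 1), (18, 1), (19, 1), (23, 3)], [(42, 1), (45, 1), (46, 1)], [(43, 1), (44, 1), (47,
    1)]], [15506642, 24803526, 24828114, 24828102, 26141906, 26163483, 24803538, 26163531,
    26141894, 26163555, 24800454, 26138834, 26138822, 24831186, 26163495, 24800466, 15512786,
    24831174, 26163603, 26114246, 24812754, 24812742, 24818898, 15525074, 26114258, 26163591,
    24818886, 20265363, 25115027, 25111907, 25114979, 28522131, 25245991, 25111955, 25246087,
    28515987, 25246099, 25115015, 28522119, 28515975, 25111883, 25245979, 25111943, 20265351,
    25114955, 25246051, 28515879, 25111847, 25114919, 25111835, 20265255, 28522023, 25246027,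
    25114907, 26254546, 24934598, 24959186, 24959174, 24962258, 26272978, 24934610, 26260690,
    24962246, 26141912, 24803529, 26162763, 24828105, 15506648, 24803544, 26162715, 24828120,
    26141897, 24831192, 24800457, 15512792, 26138825, 26162787, 24800472, 26162727, 26138840,
    24831177, 24818904, 26114249, 26162823, 24812745, 26162835, 26114264, 15525080, 24812760,
    24818889, 28522899, 25114259, 25245319, 25114211, 20264595, 25110419, 25245223, 25110371,
    28515219, 25110347, 25114247, 20264583, 28515207, 25245331, 25110407, 25245211, 28522887,
    25114187, 25110299, 28515111, 25245259, 25114151, 25245283, 28522791, 20264487, 25110311,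
    25114139, 24962264, 24934601, 26260696, 24959177, 26254552, 24934616, 26272984, 24959192,
    24962249, 26141924, 26156571, 24828129, 26156619, 26141921, 24803556, 24803553, 24828132,
    15506660, 24831204, 26156583, 26138849, 15512804, 24831201, 24800484, 24800481, 26138852,
    26156643, 24818916, 15525092, 24812769, 26156679, 24818913, 26114276, 26114273, 24812772,
    26156691, 28519827, 25239079, 25108067, 25239175, 28518291, 25107347, 25108115, 25107299,
    20258451, 25107275, 25239067, 28518279, 20258439, 25108043, 25107335, 25108103, 28519815,
    25239187, 25107227, 20258343, 25108007, 25239115, 25107995, 28519719, 28518183, 25107239,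
    25239139, 24962276, 26272996, 24959201, 26260708, 24962273, 24934628, 24934625, 24959204,
    26254564, 26289995, 24976923, 24983115, 24976971, 26291531, 24983835, 24983067, 24983883,
    26294603, 24983907, 24976935, 26291555, 26294627, 24983139, 24983847, 24983079, 26290019,
    24976995, 24983955, 26294675, 24983175, 24977031, 24983187, 26290067, 26291603, 24983943,
    24977043, 15284627, 2046355, 2043235, 2046307, 15283859, 2041747, 2043283, 2041699, 15277715,
    2041675, 2046343, 15283847, 15277703, 2043211, 2041735, 2043271, 15284615, 2046283, 2041627,
    15277607, 2043175, 2046247, 2043163, 15284519, 15283751, 2041639, 2046235, 8185060, 8157385,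
    8181985, 8181961, 8185057, 8157412, 8157409, 8181988, 8185033, 20243684, 25093348, 25081048,
    25081060, 25224417, 28473572, 25093336, 28498148, 25224393, 28501220, 25090276, 25221345,
    25221321, 25074904, 28470500, 25090264, 20240612, 25074916, 28488932, 25196745, 25065688,
    25065700, 25062616, 20216036, 25196769, 28482788, 25062628, 5694692, 13821156, 13808856,
    13808868, 13952225, 13973799, 13821144, 13973895, 13952201, 13973907, 13818084, 13949153,
    13949129, 13802712, 13973787, 13818072, 5691620, 13802724, 13973859, 13924553, 13793496,
    13793508, 13790424, 5667044, 13924577, 13973835, 13790436, 15262948, 2024676, 2012376,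
    2012388, 2006232, 15235300, 2024664, 15259876, 2006244, 25224420, 25093345, 28498145,
    25081057, 20243681, 25093330, 28473569, 25081042, 25224390, 25074898, 25090273, 20240609,
    25221318, 28501217, 25090258, 28470497, 25221348, 25074913, 25062610, 25196742, 28482785,
    25065697, 28488929, 25196772, 20216033, 25065682, 25062625, 13952228, 13821153, 13973127,
    13808865, 5694689, 13821138, 13973031, 13808850, 13952198, 13802706, 13818081, 5691617,
    13949126, 13973139, 13818066, 13973019, 13949156, 13802721, 13790418, 13924550, 13973067,
    13793505, 13973091, 13924580, 5667041, 13793490, 13790433, 2006226, 2024673, 15259873,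
    2012385, 15262945, 2024658, 15235297, 2012370, 2006241, 25224408, 28473545, 25081033,
    28498121, 25224402, 25093318, 25093321, 25081030, 20243657, 25074886, 28470473, 25221330,
    20240585, 25074889, 25090246, 25090249, 25221336, 28501193, 25062598, 20216009, 25065673,
    28482761, 25062601, 25196760, 25196754, 25065670, 28488905, 13952216, 13966887, 13808841,
    13966983, 13952210, 13821126, 13821129, 13808838, 5694665, 13802694, 13966875, 13949138,
    5691593, 13802697, 13818054, 13818057, 13949144, 13966995, 13790406, 5667017, 13793481,
    13966923, 13790409, 13924568, 13924562, 13793478, 13966947, 2006214, 15235273, 2012361,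
    15259849, 2006217, 2024646, 2024649, 2012358, 15262921], [(0, 15506642), (1, 26141912), (2,
    26141924), (16, 26289995), (20, 20243684), (21, 25224420), (22, 25224408), (11, 26163555),
    (15, 26163603), (17, 20265363), (18, 25246099), (19, 25246051), (23, 26254546), (45,
    24828102), (46, 24803538), (44, 24803526), (47, 24828114)]),
   (12, [[(0, 2), (1, 2), (4, 2), (7, 2), (13, 2), (15, 2), (16, 1), (17, 1), (19, 1), (20, 1),
    (21, 1), (23, 1)], [(10, 4), (18, 1), (22, 1), (45, 2)], [(39, 1), (44, 1), (47, 1)]],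
    [27815122, 27880658, 24797997, 27471203, 28929234, 24470317, 28863698, 27405667, 24404781,
    20109510, 20065635, 8282925, 27845848, 24782631, 27878174, 27469607, 24472801, 28926750,
    28894424, 24389415, 27451756, 20094153, 8267559, 20111724, 24800481, 27911384, 27812638,
    24454951, 28959960, 27517292, 24407265, 27404071, 28861214, 8285409, 20064039, 20107854,
    27862811, 24784227, 27845020, 28911387, 24503524, 27484973, 27452644, 24391011, 28893596,
    20112612, 8269155, 20091789, 24831204, 27797275, 27910556, 24456547, 27518180, 28959132,
    24437988, 28845851, 27419437, 8316132, 20061771, 20079405, 27864467, 27798931, 24830316,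
    28913043, 27487457, 24502636, 27421921, 28847507, 24437100, 20081889, 20061063, 8315244,
    20437220, 25390305, 25387821, 10082532, 20699337, 20697741, 5560521, 13671625, 13686982,
    18340068, 29980897, 29979181, 25372455, 25421028, 20421857, 20651655, 20683974, 10067169,
    13685326, 13669261, 5558925, 29963815, 29996260, 18324705, 25374051, 20419373, 25420140,
    20650827, 10064685, 20681550, 13639243, 5512839, 13638535, 29964643, 18322221, 29995372,
    25324769, 20371684, 25322285, 13737161, 5626057, 13752518, 20633801, 10016996, 20632205,
    29915361, 18274532, 29913645, 25355492, 25306919, 20356321, 13734797, 13750862, 5624461,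
    20618438, 20586119, 10001633, 29930724, 29898279, 18259169, 20353837, 25308515, 25354604,
    5578375, 13704779, 13704071, 9999149, 20585291, 20616014, 18256685, 29899107, 29929836], [(0,
    27815122), (1, 27845848), (4, 24800481), (7, 27862811), (13, 24831204), (15, 27864467), (16,
    20437220), (17, 25372455), (19, 25374051), (20, 25324769), (21, 25355492), (23, 20353837),
    (18, 27471203), (22, 28863698), (45, 20109510), (44, 27880658), (47, 24797997)]),
   (13, [[(0, 1), (1, 1), (2, 2), (8, 2), (11, 2), (14, 2), (15, 2), (16, 1), (18, 1), (19, 1),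
    (22, 1), (23, 1), (46, 1)], [(4, 3), (5, 1), (17, 1), (43, 2), (47, 1)]], [27452626,
    21788870, 17229010, 23389394, 2155730, 29912265, 24672457, 21657801, 26766537, 19429577,
    29811937, 26666212, 23258340, 19326180, 17884388, 23913697, 23913700, 15131876, 1762529,
    13165793, 20633828, 19064036, 11985332, 1235172, 10675428, 24044769, 23782628, 15000804,
    1893604, 13296868, 20737225, 19195108, 11719288, 1338584, 10806500, 26928353, 21292260,
    16835812, 22734052, 12248292, 14731697, 12376292, 840372, 8832692, 6604468, 14556780,
    12613833, 751715, 9182060, 7084908, 20767969, 17622244, 9888996, 13427940, 1369316, 15787233,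
    2024676, 6853433, 7377721, 447156, 20636897, 17491172, 9626852, 13165796, 1238244], [(0,
    27452626), (1, 29912265), (2, 29811937), (8, 23913697), (11, 20633828), (14, 24044769), (15,
    20737225), (16, 26928353), (18, 14731697), (19, 14556780), (22, 20767969), (23, 15787233),
    (46, 20636897), (5, 21788870), (17, 17229010), (43, 23389394), (47, 2155730)]),
   (14, [[(0, 3), (1, 5), (2, 4), (4, 1), (5, 3), (16, 3), (17, 1), (21, 2), (22, 1)], [(8, 2),
    (11, 2), (12, 2), (15, 2), (18, 1), (19, 1), (23, 1), (46, 1), (47, 1)]], [23377106,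
    19444145, 23389394, 19456433, 16403308, 16391020, 10654584, 17845100, 17832812, 26778825,
    24162740, 26766537, 24175028, 22432620, 22420332, 18387832, 24172760, 24148184, 19313892,
    15394020, 19326180, 15381732, 20990828, 20978540, 14062456, 20886756, 20899044, 24032481,
    19176664, 24044769, 19164376, 12491992, 12479704, 2006232, 17741025, 17753313, 23770340,
    20487384, 23782628, 20475096, 14306156, 14293868, 15656164, 20493540, 20505828, 22721764,
    18652376, 22734052, 18640088, 16272236, 16259948, 10282212, 17347812, 17360100, 14988516,
    11821944, 15000804, 11834232, 751763, 751715, 6984568, 9745636, 9757924, 1750244, 1350872,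
    1762532, 1338584, 9194348, 9182060, 7639928, 13284580, 13296868, 13415652, 10788056,
    13427940, 10775768, 6703980, 6691692, 413340, 1357028, 1369316], [(0, 23377106), (1,
    26778825), (2, 19313892), (4, 24032481), (5, 23770340), (16, 22721764), (17, 14988516), (21,
    1750244), (22, 13415652), (11, 19444145), (12, 23389394), (15, 19456433), (18, 16403308),
    (19, 16391020), (23, 10654584), (46, 17845100), (47, 17832812)]),
   (15, [[(0, 3), (1, 4), (2, 5), (14, 3), (15, 1), (16, 3), (19, 1), (21, 1), (22, 2)], [(4,
    3), (7, 1), (17, 1), (43, 2), (47, 1)], [(8, 3), (11, 1), (18, 1), (45, 1), (46, 2)]],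
    [24934598, 24407238, 24328583, 9999158, 27949254, 24410310, 28735686, 25717958, 21788870,
    28342470, 24328595, 25721030, 15153555, 16683833, 16857491, 27946182, 28339398, 16857479,
    13144889, 23607627, 9996086, 21785798, 16680761, 10626924, 13141817, 24934601, 30436553,
    25639303, 27684041, 20350777, 30439625, 30046409, 28077257, 24672457, 25327817, 25639315,
    28080329, 18184402, 21140281, 13538105, 20353849, 25324745, 13535033, 10392377, 1976103,
    27687113, 24669385, 21137209, 14034796, 10389305, 26272996, 30595300, 27212167, 27714785,
    27973860, 30598372, 30336228, 29022436, 26666212, 30205156, 27212179, 29025508, 22116562,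
    22582073, 22263009, 27976932, 30202084, 22262985, 18518841, 1976091, 27711713, 26663140,
    22579001, 18360172, 18515769, 1500388, 25090276, 13818084, 2006232, 15259876, 25093348,
    29549796, 27056356, 23782628, 29156580, 13821156, 27059428, 19757266, 14455609, 19626194,
    15262948, 29153508, 19626182, 15656164, 2024664, 2012376, 23779556, 14452537, 15628504,
    15653092, 25196745, 29677796, 27187428, 24014025, 29391049, 29680868, 24569060, 21420260,
    19195108, 26535140, 27190500, 21423332, 16966884, 12510436, 22996196, 29387977, 26532068,
    22993124, 17722569, 18905289, 24017097, 19192036, 12507364, 1865944, 17725641, 8157385,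
    24303844, 2046343, 9495777, 11458788, 24306916, 28632292, 25614564, 21292260, 28239076,
    2046355, 25617636, 14907602, 16552761, 16639204, 11461860, 28236004, 16639192, 13034724,
    555047, 9492705, 21289188, 16549689, 10254552, 13031652, 13924553, 27290825, 19872135,
    14424877, 19953865, 27293897, 21526729, 17094884, 12613833, 23099593, 19872147, 17097956,
    8091858, 751715, 11237586, 19950793, 23096521, 11237574, 9050988, 539108, 14427949, 12610761,
    751691, 6956908, 9054060, 2024673, 23910628, 14862772, 15787233, 15784164, 23913700,
    19064036, 12376292, 1762532, 17491172, 14868916, 12379364, 840372, 6853433, 8950585,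
    15787236, 17488100, 8947513, 7377721, 447153, 15784161, 1759460, 6850361, 447156, 7374649,
    15235273, 29284580, 19847396, 15756489, 2012358, 29287652, 26404068, 22862052, 17622244,
    18801892, 19850468, 22865124, 11368658, 9343801, 713176, 2006214, 18798820, 707032, 413340,
    447117, 15759561, 17619172, 9340729, 7612268, 422556], [(0, 24934598), (1, 24934601), (2,
    26272996), (14, 1500388), (15, 25196745), (16, 8157385), (19, 13924553), (21, 2024673), (22,
    15235273), (7, 24410310), (17, 24328595), (43, 27946182), (47, 9996086), (11, 24407238), (18,
    24328583), (45, 9999158), (46, 27949254)]),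
   (16, [[(0, 2), (1, 2), (4, 2), (6, 2), (10, 2), (11, 2), (13, 2), (15, 2), (16, 1), (17, 1),
    (18, 1), (19, 1), (20, 1), (21, 1), (23, 1), (45, 1), (47, 1)]], [19429586, 17884361,
    21788897, 27452644, 27400999, 21769571, 17832779, 19410323, 12248265, 17229028, 17177383,
    12196683, 1762505, 1369289, 1710923, 23337767, 23389412], [(0, 19429586), (1, 17884361), (4,
    21788897), (6, 27452644), (10, 27400999), (11, 21769571), (13, 17832779), (15, 19410323),
    (16, 12248265), (17, 17229028), (18, 17177383), (19, 12196683), (20, 1762505), (21, 1369289),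
    (23, 1710923), (45, 23337767), (47, 23389412)])]

/-- The dot product of two lists. -/
noncomputable def dotN (l : List ℕ) : List ℕ → ℕ :=
  List.rec (motive := fun _ => List ℕ → ℕ) (fun _ => 0) (fun a _ ih l' =>
    List.rec (motive := fun _ => ℕ) 0 (fun b bs _ => Nat.add (Nat.mul a b) (ih bs)) l') l

/-- Entrywise sum of lists of possibly different lengths. -/
noncomputable def addL (l : List ℕ) : List ℕ → List ℕ :=
  List.rec (motive := fun _ => List ℕ → List ℕ) (fun l' => l') (fun a as ih l' =>
    List.rec (motive := fun _ => List ℕ) (a :: as) (fun b bs _ => Nat.add a b :: ih bs) l') l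

def facet (k : ℕ) : Facet := facetList.getD k ([], [])

noncomputable def addF (e f : Facet) : Facet := (addL e.1 f.1, addL e.2 f.2)

noncomputable def sumF (l : List Facet) : Facet := l.foldr addF ([], [])

def smulF (k : ℕ) (e : Facet) : Facet := (e.1.map (Nat.mul k), e.2.map (Nat.mul k))

/-- All the entries of `rayList`, as the base 256 digits of a number. -/
def rayTable : ℕ := rayList.foldr (fun l n => l.foldr (fun a m => 256 * m + a) n) 0

/-- The `i`th base 256 digit. -/
def byte (n i : ℕ) : ℕ := Nat.mod (Nat.shiftRight n (Nat.mul 8 i)) 256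

/-- The `i`th base 4 digit. -/
def crumb (n i : ℕ) : ℕ := Nat.mod (Nat.shiftRight n (Nat.mul 2 i)) 4

/-- The array entry at row `s i` and column `t j`, for maps `s` and `t` coded by base 4 digits. -/
def cell (n s t i j : ℕ) : ℕ := byte n (Nat.add 2 (Nat.add (Nat.mul 4 (crumb s i)) (crumb t j)))

/-- The ray with index `k`, coded by base 256 digits. -/
def baseRay (k : ℕ) : ℕ := Nat.shiftRight rayTable (Nat.mul 144 k)

/-- The image of a coded ray under a coordinate permutation. -/
def movedRay (b n s t : ℕ) : List ℕ :=
  match b with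
  | 0 => [byte n 0, byte n 1,
      cell n s t 0 0, cell n s t 0 1, cell n s t 0 2, cell n s t 0 3,
      cell n s t 1 0, cell n s t 1 1, cell n s t 1 2, cell n s t 1 3,
      cell n s t 2 0, cell n s t 2 1, cell n s t 2 2, cell n s t 2 3,
      cell n s t 3 0, cell n s t 3 1, cell n s t 3 2, cell n s t 3 3]
  | _ => [byte n 1, byte n 0,
      cell n s t 0 0, cell n s t 1 0, cell n s t 2 0, cell n s t 3 0,
      cell n s t 0 1, cell n s t 1 1, cell n s t 2 1, cell n s t 3 1,
      cell n s t 0 2, cell n s t 1 2, cell n s t 2 2, cell n s t 3 2,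
      cell n s t 0 3, cell n s t 1 3, cell n s t 2 3, cell n s t 3 3]

/-- The ray with index `k`, as a list. -/
def repL (k : ℕ) : List ℕ := movedRay 0 (baseRay k) 228 228

/-- The image of a ray under a coordinate permutation, both given by a code. -/
def ray (c : ℕ) : List ℕ :=
  movedRay (Nat.mod (Nat.shiftRight c 16) 2) (baseRay (Nat.shiftRight c 17))
    (Nat.mod (Nat.shiftRight c 8) 256) (Nat.mod c 256)

/-- The base 4 digits of `s` form a permutation. -/
def isPerm (s : ℕ) : Bool :=
  Nat.beq (Nat.add (Nat.add (Nat.pow 2 (crumb s 0)) (Nat.pow 2 (crumb s 1)))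
    (Nat.add (Nat.pow 2 (crumb s 2)) (Nat.pow 2 (crumb s 3)))) 15

def isCode (c : ℕ) : Bool :=
  isPerm (Nat.mod (Nat.shiftRight c 8) 256) && isPerm (Nat.mod c 256) &&
    Nat.blt (Nat.shiftRight c 17) 234

noncomputable def zeroAt (e : Facet) (x : List ℕ) : Bool := Nat.beq (dotN e.1 x) (dotN e.2 x)

noncomputable def posAt (e : Facet) (x : List ℕ) : Bool := Nat.blt (dotN e.2 x) (dotN e.1 x)

noncomputable def eqAt (e f : Facet) (x : List ℕ) : Bool :=
  Nat.beq (Nat.add (dotN e.1 x) (dotN f.2 x)) (Nat.add (dotN e.2 x) (dotN f.1 x))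

/-- The relation `f` holds between entries of two lists of the same length. -/
noncomputable def all2 {α β : Type} (f : α → β → Bool) (l : List α) : List β → Bool :=
  List.rec (motive := fun _ => List β → Bool)
    (fun l' => l'.isEmpty)
    (fun a _ ih l' => List.rec (motive := fun _ => Bool) false (fun b bs _ => f a b && ih bs) l') l

/-- All choices of one entry from each list. -/
def sectionsL : List (List ℕ) → List (List ℕ)
  | [] => [[]]
  | c :: cs => c.flatMap fun a => (sectionsL cs).map (a :: ·)

noncomputable def weightedSum (c : List (ℕ × ℕ)) : Facet :=
  sumF (c.map fun p => smulF p.2 (facet p.1))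

/-- All the weighted sums agree. -/
noncomputable def balanced : List (List (ℕ × ℕ)) → Bool
  | [] => true
  | c :: cs => cs.all fun d =>
      addL (weightedSum c).1 (weightedSum d).2 == addL (weightedSum c).2 (weightedSum d).1

/-- Each facet is positive on a ray on which all later facets vanish. -/
noncomputable def triangular : List (ℕ × ℕ) → Bool
  | [] => true
  | p :: l => posAt (facet p.1) (ray p.2) && zeroAt (sumF (l.map fun q => facet q.1)) (ray p.2)
      && isCode p.2 && triangular l

/-- The facets in `J` are positive on the ray with code `c`, and all other summands of `T`
vanish. -/
noncomputable def isNeighbour (T : Facet) (J : List ℕ) (c : ℕ) : Bool :=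
  J.all (fun k => posAt (facet k) (ray c)) && eqAt T (sumF (J.map facet)) (ray c) && isCode c

/-- The facet `k` is positive on the ray with code `c`, and all other summands of `T` vanish. -/
noncomputable def isTightNeighbour (T : Facet) (k c : ℕ) : Bool :=
  posAt (facet k) (ray c) && eqAt T (facet k) (ray c) && isCode c

/-- The facets containing `x`. -/
noncomputable def tightAt (x : List ℕ) : List ℕ :=
  (List.range 48).filter fun i => zeroAt (facet i) x

noncomputable def simpleCheck (p : ℕ × List ℕ) : Bool :=
  all2 (isTightNeighbour (sumF ((tightAt (repL p.1)).map facet))) (tightAt (repL p.1)) p.2 &&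
  Nat.beq (tightAt (repL p.1)).length 17

noncomputable def cuspCheck (p : ℕ × List (List (ℕ × ℕ)) × List ℕ × List (ℕ × ℕ)) : Bool :=
  zeroAt (sumF ((p.2.1.flatten.map Prod.fst).map facet)) (repL p.1) &&
  p.2.1.all (fun c => c.all fun q => Nat.blt 0 q.2) && balanced p.2.1 &&
  all2 (isNeighbour (sumF ((p.2.1.flatten.map Prod.fst).map facet)))
    (sectionsL (p.2.1.map fun c => c.map Prod.fst)) p.2.2.1 &&
  triangular p.2.2.2 &&
  p.2.2.2.all (fun q => (p.2.1.flatten.map Prod.fst).any (Nat.beq q.1)) &&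
  Nat.beq p.2.2.2.length 17

/-- The ray with index `k` lies in the cone and in the positive light cone. -/
noncomputable def repCheck (k : ℕ) : Bool :=
  facetList.all (fun e => Nat.ble (dotN e.2 (repL k)) (dotN e.1 (repL k))) &&
  Nat.blt 0 (dotN [1, 1] (repL k)) &&
  Nat.ble (dotN (repL k) (repL k)) (Nat.mul (dotN [1, 1] (repL k)) (dotN [1, 1] (repL k)))

/-- Coordinates `(u, v; m)` with `u, v` scalars and `m` a `4 × 4` array. -/
abbrev Idx := Fin 2 ⊕ Fin 4 × Fin 4

/-- The position of a coordinate in the list `u, v, m₀₀, m₀₁, …, m₃₃`. -/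
def idxPos : Idx → ℕ
  | .inl a => a
  | .inr p => 2 + (4 * p.1 + p.2)

/-- The vector with the given list of coordinates. -/
def toVec (l : List ℕ) : Idx → ℚ := fun i => (l.getD (idxPos i) 0 : ℕ)

theorem dotN_eq_sum (l x : List ℕ) : ∀ n, x.length ≤ n →
    dotN l x = ∑ i ∈ Finset.range n, l.getD i 0 * x.getD i 0 := by
  induction l generalizing x with
  | nil => intro n _; simp [dotN]
  | cons a l ih =>
    intro n hn
    cases x with
    | nil => simp [dotN]
    | cons b x =>
      obtain ⟨n, rfl⟩ : ∃ m, n = m + 1 := ⟨n - 1, by simp at hn; omega⟩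
      rw [Finset.sum_range_succ']
      have := ih x n (by simpa using hn)
      simp only [List.getD_cons_succ, List.getD_cons_zero, ← this]
      exact add_comm (a * b) _

theorem sum_idx (f : ℕ → ℚ) : ∑ i : Idx, f (idxPos i) = ∑ i ∈ Finset.range 18, f i := by
  simp [Fintype.sum_sum_type, Fintype.sum_prod_type, Fin.sum_univ_succ, Finset.sum_range_succ,
    idxPos]
  ring

theorem toVec_dotProduct (l x : List ℕ) (hx : x.length ≤ 18) :
    toVec l ⬝ᵥ toVec x = dotN l x := by
  have := sum_idx fun i => (l.getD i 0 : ℕ) * (x.getD i 0 : ℕ)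
  rw [dotN_eq_sum l x 18 hx]
  push_cast at this ⊢
  exact this

theorem getD_addL (l l' : List ℕ) (i : ℕ) :
    (addL l l').getD i 0 = l.getD i 0 + l'.getD i 0 := by
  induction l generalizing l' i with
  | nil => simp [addL]
  | cons a l ih =>
    cases l' with
    | nil => simp [addL]
    | cons b l' =>
      cases i with
      | zero => rfl
      | succ i => exact ih l' i

/-- The linear functional encoded by a pair of coefficient lists. -/
def ev (e : Facet) : (Idx → ℚ) →ₗ[ℚ] ℚ where
  toFun y := (toVec e.1 - toVec e.2) ⬝ᵥ y
  map_add' := dotProduct_add _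
  map_smul' c y := dotProduct_smul c _ y

theorem ev_apply (e : Facet) (y : Idx → ℚ) : ev e y = (toVec e.1 - toVec e.2) ⬝ᵥ y := rfl

theorem ev_toVec (e : Facet) (x : List ℕ) (hx : x.length ≤ 18) :
    ev e (toVec x) = dotN e.1 x - dotN e.2 x := by
  rw [ev_apply, sub_dotProduct, toVec_dotProduct _ _ hx, toVec_dotProduct _ _ hx]

theorem ev_addF (e f : Facet) : ev (addF e f) = ev e + ev f := by
  have h : ∀ l l', toVec (addL l l') = toVec l + toVec l' := fun l l' => by
    funext i
    simp only [toVec, getD_addL, Nat.cast_add, Pi.add_apply]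
  refine LinearMap.ext fun y => ?_
  simp only [LinearMap.add_apply, ev_apply, addF, h, ← add_dotProduct]
  congr 1
  abel

theorem ev_sumF (l : List Facet) : ev (sumF l) = (l.map ev).sum := by
  induction l with
  | nil => exact LinearMap.ext fun y => by simp [sumF, ev_apply]
  | cons e l ih =>
    rw [List.map_cons, List.sum_cons, ← ih, ← ev_addF]
    rfl

theorem ev_smulF (k : ℕ) (e : Facet) : ev (smulF k e) = (k : ℚ) • ev e := by
  have h : ∀ l : List ℕ, toVec (l.map (Nat.mul k)) = (k : ℚ) • toVec l := fun l => by
    funext i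
    simp only [toVec, List.getD_eq_getElem?_getD, List.getElem?_map, Pi.smul_apply]
    cases l[idxPos i]? <;> simp
  refine LinearMap.ext fun y => ?_
  simp only [LinearMap.smul_apply, ev_apply, smulF, h, ← smul_sub, smul_dotProduct]

theorem ev_weightedSum (c : List (ℕ × ℕ)) (x : Idx → ℚ) :
    ev (weightedSum c) x = (c.map fun p => (p.2 : ℚ) * ev (facet p.1) x).sum := by
  rw [weightedSum, ev_sumF]
  induction c with
  | nil => simp
  | cons p c ih =>
    simp only [List.map_cons, List.sum_cons, LinearMap.add_apply, ih, ev_smulF,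
      LinearMap.smul_apply, smul_eq_mul]

theorem length_movedRay (b n s t : ℕ) : (movedRay b n s t).length = 18 := by
  cases b <;> rfl

theorem posAt_iff {e : Facet} {x : List ℕ} (hx : x.length ≤ 18) :
    posAt e x = true ↔ 0 < ev e (toVec x) := by
  rw [ev_toVec e x hx, sub_pos, Nat.cast_lt]
  exact iff_of_eq Nat.ble_eq

theorem zeroAt_iff {e : Facet} {x : List ℕ} (hx : x.length ≤ 18) :
    zeroAt e x = true ↔ ev e (toVec x) = 0 := by
  rw [ev_toVec e x hx, sub_eq_zero, Nat.cast_inj]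
  exact iff_of_eq Nat.beq_eq

theorem eqAt_iff {e f : Facet} {x : List ℕ} (hx : x.length ≤ 18) :
    eqAt e f x = true ↔ ev e (toVec x) = ev f (toVec x) := by
  rw [ev_toVec e x hx, ev_toVec f x hx, sub_eq_sub_iff_add_eq_add]
  norm_cast
  rw [add_comm (dotN f.1 x)]
  exact iff_of_eq Nat.beq_eq

/-- The polyhedral cone cut out by the 48 facets. -/
def cone : Set (Idx → ℚ) := {y | (∀ i j, 0 ≤ y (.inr (i, j))) ∧
  (∀ i, ∑ j, y (.inr (i, j)) ≤ y (.inl 0)) ∧ (∀ j, ∑ i, y (.inr (i, j)) ≤ y (.inl 1)) ∧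
  ∀ σ : Equiv.Perm (Fin 4), ∑ i, y (.inr (i, σ i)) ≤ y (.inl 0) + y (.inl 1)}

/-- The coefficient of the `i`th coordinate in a functional. -/
def coefAt (e : Facet) (i : Idx) : ℤ := (e.1.getD (idxPos i) 0 : ℤ) - e.2.getD (idxPos i) 0

theorem ev_eq_coefAt (e : Facet) (y : Idx → ℚ) : ev e y = ∑ i, (coefAt e i : ℚ) * y i := by
  simp only [ev_apply, dotProduct, coefAt, toVec, Pi.sub_apply, Int.cast_sub, Int.cast_natCast]

/-- The four families of facets. -/
abbrev FacetIdx := (Fin 4 × Fin 4) ⊕ Fin 4 ⊕ Fin 4 ⊕ Equiv.Perm (Fin 4)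

/-- The coefficients of the facet functionals, by family. -/
def facetCoef : FacetIdx → Idx → ℤ
  | .inl p, i => if i = .inr p then 1 else 0
  | .inr (.inl _), .inl b => if b = 0 then 1 else 0
  | .inr (.inl a), .inr p => if p.1 = a then -1 else 0
  | .inr (.inr (.inl _)), .inl b => if b = 1 then 1 else 0
  | .inr (.inr (.inl a)), .inr p => if p.2 = a then -1 else 0
  | .inr (.inr (.inr _)), .inl _ => 1
  | .inr (.inr (.inr σ)), .inr p => if p.2 = σ p.1 then -1 else 0

theorem exists_facetCoef_eq : ∀ k : Fin 48, ∃ κ, ∀ i, coefAt (facet k) i = facetCoef κ i := by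
  decide +kernel

theorem exists_facet_eq : ∀ κ, ∃ k : Fin 48, ∀ i, coefAt (facet k) i = facetCoef κ i := by
  decide +kernel

theorem mem_cone_iff_facetCoef (y : Idx → ℚ) :
    y ∈ cone ↔ ∀ κ, 0 ≤ ∑ i, (facetCoef κ i : ℚ) * y i := by
  have h1 : ∀ a : Fin 4, ∑ p : Fin 4 × Fin 4, (((if p.1 = a then -1 else 0 : ℤ) : ℚ)) *
      y (.inr p) = - ∑ j, y (.inr (a, j)) := by
    intro a
    rw [Fintype.sum_prod_type, Finset.sum_eq_single a (by simp +contextual) (by simp)]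
    simp
  have h2 : ∀ σ : Fin 4 → Fin 4, ∑ p : Fin 4 × Fin 4, (((if p.2 = σ p.1 then -1 else 0 : ℤ) : ℚ)) *
      y (.inr p) = - ∑ i, y (.inr (i, σ i)) := by
    intro σ
    rw [Fintype.sum_prod_type, ← Finset.sum_neg_distrib]
    refine Finset.sum_congr rfl fun i _ => ?_
    rw [Finset.sum_eq_single (σ i) (by simp +contextual) (by simp)]
    simp
  have h3 : ∀ a : Fin 4, ∑ p : Fin 4 × Fin 4, (((if p.2 = a then -1 else 0 : ℤ) : ℚ)) *
      y (.inr p) = - ∑ i, y (.inr (i, a)) := fun a => h2 fun _ => a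
  simp only [cone, Set.mem_ofPred_eq, Sum.forall, Prod.forall, facetCoef]
  refine and_congr (forall₂_congr fun i j => ?_) (and_congr (forall_congr' fun a => ?_)
    (and_congr (forall_congr' fun a => ?_) (forall_congr' fun σ => ?_)))
  · simp
  · rw [Fintype.sum_sum_type]
    rw [h1]
    simp
  · rw [Fintype.sum_sum_type]
    rw [h3]
    simp
  · rw [Fintype.sum_sum_type]
    rw [h2]
    rw [Fin.sum_univ_two]
    push_cast
    rw [one_mul, one_mul, ← sub_eq_add_neg, sub_nonneg]

theorem mem_cone_iff (y : Idx → ℚ) : y ∈ cone ↔ ∀ k : Fin 48, 0 ≤ ev (facet k) y := by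
  rw [mem_cone_iff_facetCoef]
  constructor
  · intro h k
    obtain ⟨κ, hκ⟩ := exists_facetCoef_eq k
    simpa only [ev_eq_coefAt, hκ] using h κ
  · intro h κ
    obtain ⟨k, hk⟩ := exists_facet_eq κ
    simpa only [ev_eq_coefAt, hk] using h k

theorem ev_facet_nonneg {y : Idx → ℚ} (hy : y ∈ cone) (k : ℕ) : 0 ≤ ev (facet k) y := by
  rcases lt_or_ge k 48 with hk | hk
  · exact (mem_cone_iff y).1 hy ⟨k, hk⟩
  · have hf : facet k = ([], []) := List.getD_eq_default _ _ (by simpa [facetList] using hk)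
    simp [hf, ev_apply]

/-- The linear functional `u + v`. -/
def height : (Idx → ℚ) →ₗ[ℚ] ℚ := LinearMap.proj (.inl 0) + LinearMap.proj (.inl 1)

theorem height_apply (y : Idx → ℚ) : height y = y (.inl 0) + y (.inl 1) := rfl

/-- The quadratic form `2uv - ∑ mᵢⱼ²`. -/
def quad (y : Idx → ℚ) : ℚ := height y ^ 2 - y ⬝ᵥ y

theorem quad_eq (y : Idx → ℚ) :
    quad y = 2 * y (.inl 0) * y (.inl 1) - ∑ p, y (.inr p) * y (.inr p) := by
  simp only [quad, height_apply, dotProduct, Fintype.sum_sum_type, Fin.sum_univ_two]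
  ring

/-- Permutations of the coordinates preserving the cone and the height. -/
def coneSymm : Subgroup (Equiv.Perm Idx) where
  carrier := {g | (∀ y : Idx → ℚ, y ∘ g ∈ cone ↔ y ∈ cone) ∧
    ∀ y : Idx → ℚ, height (y ∘ g) = height y}
  one_mem' := ⟨fun _ => Iff.rfl, fun _ => rfl⟩
  mul_mem' {g h} hg hh := ⟨fun y => (hh.1 (y ∘ g)).trans (hg.1 y),
    fun y => (hh.2 (y ∘ g)).trans (hg.2 y)⟩
  inv_mem' {g} hg := by
    have h : ∀ y : Idx → ℚ, (y ∘ ⇑g⁻¹) ∘ g = y := fun y => funext fun i => by simp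
    exact ⟨fun y => by rw [← hg.1 (y ∘ ⇑g⁻¹), h], fun y => by rw [← hg.2 (y ∘ ⇑g⁻¹), h]⟩

theorem quad_comp {g : Equiv.Perm Idx} (hg : g ∈ coneSymm) (y : Idx → ℚ) :
    quad (y ∘ g) = quad y := by
  rw [quad, quad, hg.2, comp_equiv_dotProduct_comp_equiv]

/-- Rows and columns are permuted by `σ` and `τ`. -/
def gridPerm (σ τ : Equiv.Perm (Fin 4)) : Equiv.Perm Idx :=
  Equiv.sumCongr 1 (Equiv.prodCongr σ τ)

/-- Transposition of the array together with the exchange of `u` and `v`. -/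
def gridTranspose : Equiv.Perm Idx := Equiv.sumCongr (Equiv.swap 0 1) (Equiv.prodComm _ _)

theorem comp_gridPerm_mem {y : Idx → ℚ} (hy : y ∈ cone) (σ τ : Equiv.Perm (Fin 4)) :
    y ∘ gridPerm σ τ ∈ cone := by
  obtain ⟨h1, h2, h3, h4⟩ := hy
  refine ⟨fun i j => h1 _ _, fun i => ?_, fun j => ?_, fun ρ => ?_⟩
  · exact (Equiv.sum_comp τ fun j => y (.inr (σ i, j))).trans_le (h2 _)
  · exact (Equiv.sum_comp σ fun i => y (.inr (i, τ j))).trans_le (h3 _)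
  · have := Equiv.sum_comp σ fun i => y (.inr (i, τ (ρ (σ.symm i))))
    simp only [Equiv.symm_apply_apply] at this
    exact this.trans_le (h4 ((σ.symm.trans ρ).trans τ))

theorem comp_gridTranspose_mem {y : Idx → ℚ} (hy : y ∈ cone) : y ∘ gridTranspose ∈ cone := by
  obtain ⟨h1, h2, h3, h4⟩ := hy
  refine ⟨fun i j => h1 _ _, fun i => h3 i, fun j => h2 j, fun ρ => ?_⟩
  have := Equiv.sum_comp ρ fun i => y (.inr (i, ρ.symm i))
  simp only [Equiv.symm_apply_apply] at this
  exact (this.trans_le (h4 ρ.symm)).trans_eq (add_comm _ _)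

theorem mem_coneSymm {g h : Equiv.Perm Idx} (hgh : g * h = 1)
    (hg : ∀ y ∈ cone, y ∘ g ∈ cone) (hh : ∀ y ∈ cone, y ∘ h ∈ cone)
    (hs : ∀ y : Idx → ℚ, height (y ∘ g) = height y) : g ∈ coneSymm := by
  refine ⟨fun y => ⟨fun hy => ?_, hg y⟩, hs⟩
  have hid : (y ∘ g) ∘ h = y := by
    rw [Function.comp_assoc, ← Equiv.Perm.coe_mul, hgh]
    rfl
  exact hid ▸ hh _ hy

theorem gridPerm_mem (σ τ : Equiv.Perm (Fin 4)) : gridPerm σ τ ∈ coneSymm := by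
  refine mem_coneSymm (h := gridPerm σ⁻¹ τ⁻¹) ?_ (fun y hy => comp_gridPerm_mem hy _ _)
    (fun y hy => comp_gridPerm_mem hy _ _) fun y => rfl
  ext i
  rcases i with i | ⟨i, j⟩ <;> simp [gridPerm]

theorem gridTranspose_mem : gridTranspose ∈ coneSymm := by
  refine mem_coneSymm (h := gridTranspose) ?_ (fun y hy => comp_gridTranspose_mem hy)
    (fun y hy => comp_gridTranspose_mem hy) fun y => add_comm _ _
  ext i
  rcases i with i | ⟨i, j⟩ <;> simp [gridTranspose]

/-- The base ray with index `k`. -/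
def rep (k : ℕ) : Idx → ℚ := fun i => (byte (baseRay k) (idxPos i) : ℕ)

/-- Representatives of the extreme rays, with all their images under coordinate symmetries. -/
def rays : Set (Idx → ℚ) := {y | ∃ k < 234, ∃ g ∈ coneSymm, y = rep k ∘ g}

theorem rays_finite : rays.Finite := by
  refine ((Set.finite_lt_nat 234).prod (Set.toFinite (coneSymm : Set (Equiv.Perm Idx)))).image
    (fun p => rep p.1 ∘ p.2) |>.subset ?_
  rintro y ⟨k, hk, g, hg, rfl⟩
  exact ⟨(k, g), ⟨hk, hg⟩, rfl⟩

theorem crumb_lt (n i : ℕ) : crumb n i < 4 := Nat.mod_lt _ (by norm_num)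

theorem exists_perm_of_isPerm {s : ℕ} (hs : isPerm s = true) :
    ∃ σ : Equiv.Perm (Fin 4), ∀ i : Fin 4, crumb s i = σ i := by
  have key : ∀ a b c d : Fin 4, 2 ^ (a : ℕ) + 2 ^ (b : ℕ) + (2 ^ (c : ℕ) + 2 ^ (d : ℕ)) = 15 →
      Function.Injective ![a, b, c, d] := by decide
  have h := key ⟨_, crumb_lt s 0⟩ ⟨_, crumb_lt s 1⟩ ⟨_, crumb_lt s 2⟩ ⟨_, crumb_lt s 3⟩
    ((iff_of_eq Nat.beq_eq).1 hs)
  refine ⟨Equiv.ofBijective _ (Finite.injective_iff_bijective.1 h), fun i => ?_⟩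
  fin_cases i <;> rfl

theorem toVec_movedRay {b n s t : ℕ} {σ τ : Equiv.Perm (Fin 4)}
    (hσ : ∀ i : Fin 4, crumb s i = σ i) (hτ : ∀ i : Fin 4, crumb t i = τ i) :
    toVec (movedRay b n s t) = (fun i => ((byte n (idxPos i) : ℕ) : ℚ)) ∘
      (gridPerm σ τ * if b = 0 then 1 else gridTranspose : Equiv.Perm Idx) := by
  have hc : ∀ i j : Fin 4, cell n s t i j = byte n (idxPos (.inr (σ i, τ j))) := fun i j => by
    rw [cell, hσ, hτ]; rfl
  funext i
  rcases b with _ | b <;> rcases i with i | ⟨i, j⟩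
  · fin_cases i <;> rfl
  · refine Eq.trans ?_ (congrArg Nat.cast (hc i j))
    fin_cases i <;> fin_cases j <;> rfl
  · fin_cases i <;> rfl
  · refine Eq.trans ?_ (congrArg Nat.cast (hc j i))
    fin_cases i <;> fin_cases j <;> rfl

theorem length_repL (k : ℕ) : (repL k).length ≤ 18 := (length_movedRay _ _ _ _).le

theorem length_ray (c : ℕ) : (ray c).length ≤ 18 := (length_movedRay _ _ _ _).le

theorem toVec_repL (k : ℕ) : toVec (repL k) = rep k := by
  have h : ∀ i : Fin 4, crumb 228 i = (1 : Equiv.Perm (Fin 4)) i := by decide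
  rw [repL, toVec_movedRay h h]
  funext i
  rcases i with i | ⟨i, j⟩ <;> rfl

theorem toVec_ray_mem {c : ℕ} (hc : isCode c = true) : toVec (ray c) ∈ rays := by
  rw [isCode, Bool.and_eq_true, Bool.and_eq_true] at hc
  obtain ⟨⟨hs, ht⟩, hk⟩ := hc
  obtain ⟨σ, hσ⟩ := exists_perm_of_isPerm hs
  obtain ⟨τ, hτ⟩ := exists_perm_of_isPerm ht
  refine ⟨_, (iff_of_eq Nat.ble_eq).1 hk, _, ?_, toVec_movedRay hσ hτ⟩
  refine mul_mem (gridPerm_mem σ τ) ?_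
  split_ifs
  exacts [one_mem _, gridTranspose_mem]

theorem repCheck_all : (List.range 234).all repCheck = true := by decide +kernel

theorem repCheck_of_lt {k : ℕ} (hk : k < 234) : repCheck k = true :=
  List.all_eq_true.1 repCheck_all k (List.mem_range.2 hk)

theorem rep_mem_cone {k : ℕ} (hk : k < 234) : rep k ∈ cone := by
  have h := repCheck_of_lt hk
  rw [repCheck, Bool.and_eq_true, Bool.and_eq_true] at h
  rw [mem_cone_iff, ← toVec_repL]
  intro i
  have hi : facet i ∈ facetList := by
    rw [facet, List.getD_eq_getElem _ _ i.2]
    exact List.getElem_mem _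
  rw [ev_toVec _ _ (length_repL _), sub_nonneg, Nat.cast_le]
  exact (iff_of_eq Nat.ble_eq).1 (List.all_eq_true.1 h.1.1 _ hi)

theorem height_repL (k : ℕ) : height (rep k) = dotN [1, 1] (repL k) := by
  rw [← toVec_dotProduct _ _ (length_repL _), toVec_repL, dotProduct,
    Fintype.sum_sum_type, Finset.sum_eq_zero (s := (Finset.univ : Finset (Fin 4 × Fin 4)))]
  · simp [toVec, idxPos, height_apply]
  · rintro ⟨i, j⟩ -
    rw [toVec, List.getD_eq_default _ _ (by simp [idxPos])]
    simp

theorem height_rep_pos {k : ℕ} (hk : k < 234) : 0 < height (rep k) := by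
  have h := repCheck_of_lt hk
  rw [repCheck, Bool.and_eq_true, Bool.and_eq_true] at h
  rw [height_repL, Nat.cast_pos]
  exact (iff_of_eq Nat.ble_eq).1 h.1.2

theorem quad_rep_nonneg {k : ℕ} (hk : k < 234) : 0 ≤ quad (rep k) := by
  have h := repCheck_of_lt hk
  rw [repCheck, Bool.and_eq_true, Bool.and_eq_true] at h
  have h2 : dotN (repL k) (repL k) ≤ dotN [1, 1] (repL k) * dotN [1, 1] (repL k) :=
    (iff_of_eq Nat.ble_eq).1 h.2
  rw [quad, height_repL, ← toVec_repL, toVec_dotProduct _ _ (length_repL _),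
    sub_nonneg, sq]
  exact_mod_cast h2

theorem mem_cone_of_mem_rays {y : Idx → ℚ} (hy : y ∈ rays) : y ∈ cone := by
  obtain ⟨k, hk, g, hg, rfl⟩ := hy
  exact (hg.1 _).2 (rep_mem_cone hk)

theorem height_pos_of_mem_rays {y : Idx → ℚ} (hy : y ∈ rays) : 0 < height y := by
  obtain ⟨k, hk, g, hg, rfl⟩ := hy
  exact (hg.2 _).symm ▸ height_rep_pos hk

theorem quad_nonneg_of_mem_rays {y : Idx → ℚ} (hy : y ∈ rays) : 0 ≤ quad y := by
  obtain ⟨k, hk, g, hg, rfl⟩ := hy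
  exact (quad_comp hg _).symm ▸ quad_rep_nonneg hk

theorem comp_mem_rays {y : Idx → ℚ} (hy : y ∈ rays) {g : Equiv.Perm Idx} (hg : g ∈ coneSymm) :
    y ∘ g ∈ rays := by
  obtain ⟨k, hk, h, hh, rfl⟩ := hy
  exact ⟨k, hk, h * g, mul_mem hh hg, rfl⟩

/-- Suppose that near the ray `r` the cone looks like a cone over a product of simplices, whose
facets are grouped in `comps`, and that each choice `J` of one facet per simplex is realised by a
neighbouring ray. Then a functional vanishing at `r` and nonnegative on the rays is nonnegative. -/
theorem nonneg_of_neighbours {r : Idx → ℚ} {comps : List (List ℕ)}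
    (hJ : ∀ J, List.Forall₂ (· ∈ ·) J comps → ∃ n ∈ rays, (∀ k ∈ J, 0 < ev (facet k) n) ∧
      ∀ k ∈ comps.flatten, k ∉ J → ev (facet k) n = 0)
    (hbal : ∀ x, (∀ k ∈ comps.flatten, 0 ≤ ev (facet k) x) → ∀ c ∈ comps, ∀ d ∈ comps,
      (∃ k ∈ c, 0 < ev (facet k) x) → ∃ k ∈ d, 0 < ev (facet k) x)
    (hspan : ∀ x, (∀ k ∈ comps.flatten, ev (facet k) x = 0) → ∃ a : ℚ, x = a • r)
    (ℓ : (Idx → ℚ) →ₗ[ℚ] ℚ) (hℓ : ∀ n ∈ rays, 0 ≤ ℓ n) (hr : ℓ r = 0)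
    (x : Idx → ℚ) (hx : ∀ k ∈ comps.flatten, 0 ≤ ev (facet k) x) : 0 ≤ ℓ x := by
  induction hm : (comps.flatten.toFinset.filter fun k => ev (facet k) x ≠ 0).card
    using Nat.strong_induction_on generalizing x with
  | _ m ih =>
  by_cases h0 : ∀ k ∈ comps.flatten, ev (facet k) x = 0
  · obtain ⟨a, rfl⟩ := hspan x h0
    simp [hr]
  push Not at h0
  obtain ⟨k, hk, hk0⟩ := h0
  have hkpos := lt_of_le_of_ne (hx k hk) (Ne.symm hk0)
  obtain ⟨c, hc, hkc⟩ := List.mem_flatten.1 hk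
  have hex : ∀ d ∈ comps, ∃ j ∈ d, 0 < ev (facet j) x :=
    fun d hd => hbal x hx c hc d hd ⟨k, hkc, hkpos⟩
  obtain ⟨J, hJmem, hJpos⟩ : ∃ J, List.Forall₂ (· ∈ ·) J comps ∧ ∀ j ∈ J, 0 < ev (facet j) x := by
    clear * - hex
    induction comps with
    | nil => exact ⟨[], .nil, by simp⟩
    | cons d comps ih =>
      obtain ⟨J, h1, h2⟩ := ih fun d hd => hex d (List.mem_cons_of_mem _ hd)
      obtain ⟨j, hj, hjx⟩ := hex d List.mem_cons_self
      exact ⟨j :: J, .cons hj h1, by simpa using ⟨hjx, h2⟩⟩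
  have hJne : J.toFinset.Nonempty := by
    rw [List.toFinset_nonempty_iff]
    rintro rfl
    cases hJmem
    simp at hc
  have hJsub : ∀ j ∈ J, j ∈ comps.flatten := by
    clear * - hJmem
    induction hJmem with
    | nil => simp
    | cons h _ ih =>
      intro j hj
      rw [List.flatten_cons, List.mem_append]
      rcases List.mem_cons.1 hj with rfl | hj
      exacts [.inl h, .inr (ih j hj)]
  obtain ⟨n, hn, hnpos, hnzero⟩ := hJ J hJmem
  obtain ⟨e, he, hmin⟩ := J.toFinset.exists_min_image
    (fun j => ev (facet j) x / ev (facet j) n) hJne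
  rw [List.mem_toFinset] at he
  set t := ev (facet e) x / ev (facet e) n with ht
  have ht0 : 0 ≤ t := (div_pos (hJpos e he) (hnpos e he)).le
  have hval : ∀ j, ev (facet j) (x - t • n) = ev (facet j) x - t * ev (facet j) n :=
    fun j => by simp
  have hx' : ∀ j ∈ comps.flatten, 0 ≤ ev (facet j) (x - t • n) := by
    intro j hj
    rw [hval]
    by_cases hjJ : j ∈ J
    · have := hmin j (List.mem_toFinset.2 hjJ)
      rw [le_div_iff₀ (hnpos j hjJ)] at this
      linarith
    · rw [hnzero j hj hjJ]
      simpa using hx j hj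
  have hcard : (comps.flatten.toFinset.filter fun k => ev (facet k) (x - t • n) ≠ 0).card < m := by
    rw [← hm]
    refine Finset.card_lt_card ((Finset.ssubset_iff_of_subset ?_).2 ⟨e, ?_, ?_⟩)
    · intro j hj
      rw [Finset.mem_filter] at hj ⊢
      refine ⟨hj.1, fun hj0 => hj.2 ?_⟩
      have hjJ : j ∉ J := fun h => (hJpos j h).ne' hj0
      rw [hval, hj0, hnzero j (List.mem_toFinset.1 hj.1) hjJ, mul_zero, sub_zero]
    · simpa using ⟨by simpa using hJsub e he, (hJpos e he).ne'⟩
    · rw [Finset.mem_filter]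
      rintro ⟨-, h⟩
      exact h (by rw [hval, ht, div_mul_cancel₀ _ (hnpos e he).ne', sub_self])
  have h1 := ih _ hcard _ hx' rfl
  have h2 := hℓ n hn
  rw [map_sub, map_smul, smul_eq_mul] at h1
  nlinarith

/-- Functionals that are nonnegative on all rays and vanish at `r` are nonnegative on the cone. -/
def IsCertified (r : Idx → ℚ) : Prop :=
  ∀ ℓ : (Idx → ℚ) →ₗ[ℚ] ℚ, (∀ n ∈ rays, 0 ≤ ℓ n) → ℓ r = 0 → ∀ x ∈ cone, 0 ≤ ℓ x

/-- The common kernel of the facets listed in `l`. -/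
def commonKer (l : List ℕ) : Submodule ℚ (Idx → ℚ) where
  carrier := {x | ∀ k ∈ l, ev (facet k) x = 0}
  add_mem' hx hy k hk := by simp [hx k hk, hy k hk]
  zero_mem' k _ := map_zero _
  smul_mem' c x hx k hk := by simp [hx k hk]

theorem finrank_commonKer_cons_lt {k : ℕ} {l : List ℕ} {w : Idx → ℚ}
    (hk : 0 < ev (facet k) w) (hw : w ∈ commonKer l) :
    Module.finrank ℚ (commonKer (k :: l)) < Module.finrank ℚ (commonKer l) := by
  refine Submodule.finrank_lt_finrank_of_lt (lt_of_le_of_ne ?_ fun h => ?_)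
  · exact fun x hx j hj => hx j (List.mem_cons_of_mem _ hj)
  · exact hk.ne' ((h ▸ hw : w ∈ commonKer (k :: l)) k List.mem_cons_self)

theorem exists_eq_smul {l : List ℕ} (hl : Module.finrank ℚ (commonKer l) ≤ 1) {r : Idx → ℚ}
    (hr : r ∈ commonKer l) (hr0 : r ≠ 0) {x : Idx → ℚ} (hx : x ∈ commonKer l) :
    ∃ a : ℚ, x = a • r := by
  obtain ⟨v, hv⟩ := finrank_le_one_iff.1 hl
  obtain ⟨a, ha⟩ := hv ⟨r, hr⟩
  obtain ⟨b, hb⟩ := hv ⟨x, hx⟩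
  have ha' : a • (v : Idx → ℚ) = r := congrArg Subtype.val ha
  have hb' : b • (v : Idx → ℚ) = x := congrArg Subtype.val hb
  have ha0 : a ≠ 0 := by
    rintro rfl
    exact hr0 (by rw [← ha', zero_smul])
  exact ⟨b / a, by rw [← ha', smul_smul, div_mul_cancel₀ _ ha0, hb']⟩

theorem finrank_commonKer_le (l : List ℕ) : Module.finrank ℚ (commonKer l) ≤ 18 :=
  (Submodule.finrank_le _).trans (by simp)

theorem finrank_add_length_le {l : List ℕ} (hl : l.Nodup)
    (h : ∀ i ∈ l, ∃ w, 0 < ev (facet i) w ∧ ∀ j ∈ l, j ≠ i → ev (facet j) w = 0) :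
    Module.finrank ℚ (commonKer l) + l.length ≤ 18 := by
  induction l with
  | nil => exact finrank_commonKer_le _
  | cons k l ih =>
    rw [List.nodup_cons] at hl
    have h1 := ih hl.2 fun i hi => by
      obtain ⟨w, hw, hw'⟩ := h i (List.mem_cons_of_mem _ hi)
      exact ⟨w, hw, fun j hj => hw' j (List.mem_cons_of_mem _ hj)⟩
    obtain ⟨w, hw, hw'⟩ := h k List.mem_cons_self
    have h2 := finrank_commonKer_cons_lt hw fun j hj =>
      hw' j (List.mem_cons_of_mem _ hj) fun h => hl.1 (h ▸ hj)
    rw [List.length_cons]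
    omega

theorem sum_map_ev_apply (l : List ℕ) (x : Idx → ℚ) :
    ev (sumF (l.map facet)) x = (l.map fun k => ev (facet k) x).sum := by
  rw [ev_sumF]
  induction l with
  | nil => simp
  | cons k l ih => simp only [List.map_cons, List.sum_cons, LinearMap.add_apply, ih]

theorem eq_zero_of_sum_map_eq_zero {l : List ℕ} {f : ℕ → ℚ} (hf : ∀ k, 0 ≤ f k)
    (h : (l.map f).sum = 0) : ∀ k ∈ l, f k = 0 := by
  intro k hk
  refine le_antisymm ?_ (hf k)
  rw [← h]
  exact List.single_le_sum (by simpa using fun a _ => hf a) _ (List.mem_map_of_mem hk)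

theorem triangular_finrank {l : List (ℕ × ℕ)} (h : triangular l = true) :
    Module.finrank ℚ (commonKer (l.map Prod.fst)) + l.length ≤ 18 := by
  induction l with
  | nil => exact finrank_commonKer_le _
  | cons p l ih =>
    simp only [triangular, Bool.and_eq_true] at h
    obtain ⟨⟨⟨h1, h2⟩, h3⟩, h4⟩ := h
    have h5 := ih h4
    have hc := mem_cone_of_mem_rays (toVec_ray_mem h3)
    rw [posAt_iff (length_ray _)] at h1
    have h2' : zeroAt (sumF ((l.map Prod.fst).map facet)) (ray p.2) = true := by
      rwa [List.map_map]
    rw [zeroAt_iff (length_ray _), sum_map_ev_apply] at h2'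
    have h6 := finrank_commonKer_cons_lt h1
      (eq_zero_of_sum_map_eq_zero (ev_facet_nonneg hc) h2')
    rw [List.map_cons, List.length_cons]
    omega

theorem all2_exists {α β : Type} {f : α → β → Bool} {l : List α} {l' : List β}
    (h : all2 f l l' = true) : ∀ a ∈ l, ∃ b ∈ l', f a b = true := by
  induction l generalizing l' with
  | nil => simp
  | cons a l ih =>
    cases l' with
    | nil => cases h
    | cons b l' =>
      have h' : (f a b && all2 f l l') = true := h
      rw [Bool.and_eq_true] at h'
      intro c hc
      rcases List.mem_cons.1 hc with rfl | hc
      · exact ⟨b, List.mem_cons_self, h'.1⟩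
      · obtain ⟨d, hd, hcd⟩ := ih h'.2 c hc
        exact ⟨d, List.mem_cons_of_mem _ hd, hcd⟩

theorem mem_sectionsL {J : List ℕ} {comps : List (List ℕ)}
    (h : List.Forall₂ (· ∈ ·) J comps) : J ∈ sectionsL comps := by
  induction h with
  | nil => simp [sectionsL]
  | cons h _ ih =>
    rw [sectionsL, List.mem_flatMap]
    exact ⟨_, h, List.mem_map.2 ⟨_, ih, rfl⟩⟩

theorem sum_section_le {f : ℕ → ℚ} (hf : ∀ k, 0 ≤ f k) {J : List ℕ} {comps : List (List ℕ)}
    (h : List.Forall₂ (· ∈ ·) J comps) : (J.map f).sum ≤ (comps.flatten.map f).sum := by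
  induction h with
  | nil => simp
  | cons h _ ih =>
    rw [List.flatten_cons, List.map_append, List.sum_append, List.map_cons, List.sum_cons]
    exact add_le_add
      (List.single_le_sum (by simpa using fun a _ => hf a) _ (List.mem_map_of_mem h)) ih

theorem eq_zero_of_sum_section_eq {f : ℕ → ℚ} (hf : ∀ k, 0 ≤ f k) {J : List ℕ}
    {comps : List (List ℕ)} (h : List.Forall₂ (· ∈ ·) J comps)
    (hsum : (comps.flatten.map f).sum = (J.map f).sum) :
    ∀ k ∈ comps.flatten, k ∉ J → f k = 0 := by
  induction h with
  | nil => simp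
  | @cons j c J comps hj hJ ih =>
    rw [List.flatten_cons, List.map_append, List.sum_append, List.map_cons, List.sum_cons] at hsum
    have h1 := sum_section_le hf hJ
    have h2 : f j + ((c.erase j).map f).sum = (c.map f).sum := by
      rw [← List.sum_cons, ← List.map_cons]
      exact ((List.perm_cons_erase hj).map f).sum_eq.symm
    have h3 : 0 ≤ ((c.erase j).map f).sum := List.sum_nonneg (by simpa using fun a _ => hf a)
    intro k hk hkJ
    rw [List.mem_cons, not_or] at hkJ
    rw [List.flatten_cons, List.mem_append] at hk
    rcases hk with hk | hk
    · exact eq_zero_of_sum_map_eq_zero hf (by linarith) k ((List.mem_erase_of_ne hkJ.1).2 hk)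
    · exact ih (by linarith) k hk hkJ.2

theorem balanced_spec {cs : List (List (ℕ × ℕ))} (h : balanced cs = true) (x : Idx → ℚ) :
    ∀ c ∈ cs, ∀ d ∈ cs, ev (weightedSum c) x = ev (weightedSum d) x := by
  have key : ∀ c d : List (ℕ × ℕ), (addL (weightedSum c).1 (weightedSum d).2 ==
      addL (weightedSum c).2 (weightedSum d).1) = true →
      ev (weightedSum c) x = ev (weightedSum d) x := by
    intro c d hcd
    have h1 : toVec (weightedSum c).1 + toVec (weightedSum d).2 =
        toVec (weightedSum c).2 + toVec (weightedSum d).1 := by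
      funext i
      have := congrArg (fun l : List ℕ => l.getD (idxPos i) 0) (eq_of_beq hcd)
      simp only [getD_addL] at this
      simp only [toVec, Pi.add_apply]
      exact_mod_cast this
    rw [ev_apply, ev_apply]
    congr 1
    rw [sub_eq_sub_iff_add_eq_add, h1, add_comm]
  cases cs with
  | nil => simp
  | cons b cs =>
    have hb : ∀ c ∈ b :: cs, ev (weightedSum b) x = ev (weightedSum c) x := by
      intro c hc
      rcases List.mem_cons.1 hc with rfl | hc
      · rfl
      · exact key _ _ (List.all_eq_true.1 h c hc)
    intro c hc d hd
    rw [← hb c hc, hb d hd]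

theorem exists_pos_of_weightedSum {c d : List (ℕ × ℕ)} {x : Idx → ℚ}
    (hcd : ev (weightedSum c) x = ev (weightedSum d) x) (hc : ∀ p ∈ c, 0 < p.2)
    (hx : ∀ k ∈ c.map Prod.fst, 0 ≤ ev (facet k) x)
    (hpos : ∃ k ∈ c.map Prod.fst, 0 < ev (facet k) x) :
    ∃ k ∈ d.map Prod.fst, 0 < ev (facet k) x := by
  by_contra! hd
  obtain ⟨k, hk, hkx⟩ := hpos
  obtain ⟨p, hp, rfl⟩ := List.mem_map.1 hk
  have h1 : ev (weightedSum d) x ≤ 0 := by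
    rw [ev_weightedSum]
    clear hcd
    induction d with
    | nil => simp
    | cons q d ih =>
      rw [List.map_cons, List.sum_cons]
      have h2 := hd q.1 (by simp)
      have h3 := ih fun k hk => hd k (by simp at hk ⊢; tauto)
      have h4 : (0 : ℚ) ≤ q.2 := by positivity
      nlinarith
  have h2 : 0 < ev (weightedSum c) x := by
    rw [ev_weightedSum]
    refine lt_of_lt_of_le (mul_pos (Nat.cast_pos.2 (hc p hp)) hkx) ?_
    refine List.single_le_sum ?_ _ (List.mem_map_of_mem (f := fun p : ℕ × ℕ =>
      (p.2 : ℚ) * ev (facet p.1) x) hp)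
    intro a ha
    obtain ⟨q, hq, rfl⟩ := List.mem_map.1 ha
    exact mul_nonneg (by positivity) (hx _ (List.mem_map_of_mem hq))
  exact absurd hcd (by linarith)

theorem rep_ne_zero {k : ℕ} (hk : k < 234) : rep k ≠ 0 := fun h => by
  have := height_rep_pos hk
  rw [h, map_zero] at this
  exact this.false

theorem isCertified_of_cuspCheck {p : ℕ × List (List (ℕ × ℕ)) × List ℕ × List (ℕ × ℕ)}
    (hp : p.1 < 234) (h : cuspCheck p = true) : IsCertified (rep p.1) := by
  obtain ⟨i, comps, codes, basis⟩ := p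
  simp only [cuspCheck, Bool.and_eq_true, List.all_eq_true] at h
  obtain ⟨⟨⟨⟨⟨⟨h1, h2⟩, h3⟩, h4⟩, h5⟩, h6⟩, h7⟩ := h
  have hflat : comps.flatten.map Prod.fst = (comps.map fun c => c.map Prod.fst).flatten :=
    List.map_flatten
  rw [hflat] at h1 h4
  simp only [hflat] at h6
  replace h7 : basis.length = 17 := (iff_of_eq Nat.beq_eq).1 h7
  rw [zeroAt_iff (length_repL _), toVec_repL, sum_map_ev_apply] at h1
  have hr := eq_zero_of_sum_map_eq_zero (ev_facet_nonneg (rep_mem_cone hp)) h1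
  have hbasis : ∀ k ∈ basis.map Prod.fst, k ∈ (comps.map fun c => c.map Prod.fst).flatten := by
    intro k hk
    obtain ⟨q, hq, rfl⟩ := List.mem_map.1 hk
    obtain ⟨j, hj, hqj⟩ := List.any_eq_true.1 (h6 q hq)
    rwa [(iff_of_eq Nat.beq_eq).1 hqj]
  intro ℓ hℓ hℓr x hx
  refine nonneg_of_neighbours (r := rep i) (comps := comps.map fun c => c.map Prod.fst) ?_ ?_ ?_
    ℓ hℓ hℓr x fun k _ => ev_facet_nonneg hx k
  · intro J hJ
    obtain ⟨c, -, hc⟩ := all2_exists h4 J (mem_sectionsL hJ)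
    simp only [isNeighbour, Bool.and_eq_true, List.all_eq_true] at hc
    obtain ⟨⟨hc1, hc2⟩, hc3⟩ := hc
    have hn := toVec_ray_mem hc3
    refine ⟨_, hn, fun k hk => (posAt_iff (length_ray c)).1 (hc1 k hk), ?_⟩
    rw [eqAt_iff (length_ray c), sum_map_ev_apply, sum_map_ev_apply] at hc2
    exact eq_zero_of_sum_section_eq (ev_facet_nonneg (mem_cone_of_mem_rays hn)) hJ hc2
  · intro x hx c hc d hd hpos
    obtain ⟨c', hc', rfl⟩ := List.mem_map.1 hc
    obtain ⟨d', hd', rfl⟩ := List.mem_map.1 hd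
    refine exists_pos_of_weightedSum (balanced_spec h3 x c' hc' d' hd')
      (fun q hq => (iff_of_eq Nat.ble_eq).1 (h2 c' hc' q hq)) (fun k hk => hx k ?_) hpos
    exact List.mem_flatten.2 ⟨_, hc, hk⟩
  · intro x hx
    refine exists_eq_smul (l := basis.map Prod.fst) ?_ (fun k hk => hr k (hbasis k hk))
      (rep_ne_zero hp) fun k hk => hx k (hbasis k hk)
    have := triangular_finrank h5
    omega

theorem isCertified_of_simpleCheck {p : ℕ × List ℕ} (hp : p.1 < 234)
    (h : simpleCheck p = true) : IsCertified (rep p.1) := by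
  obtain ⟨i, codes⟩ := p
  simp only [simpleCheck, Bool.and_eq_true] at h
  set t := tightAt (repL i) with ht
  have hlen : t.length = 17 := (iff_of_eq Nat.beq_eq).1 h.2
  have hr : ∀ k ∈ t, ev (facet k) (rep i) = 0 := by
    intro k hk
    rw [ht, tightAt, List.mem_filter, zeroAt_iff (length_repL _), toVec_repL] at hk
    exact hk.2
  have hnodup : t.Nodup := List.nodup_range.filter _
  clear_value t
  have hneigh : ∀ k ∈ t, ∃ n ∈ rays, 0 < ev (facet k) n ∧
      ∀ j ∈ t, j ≠ k → ev (facet j) n = 0 := by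
    intro k hk
    obtain ⟨c, -, hc⟩ := all2_exists h.1 k hk
    simp only [isTightNeighbour, Bool.and_eq_true] at hc
    obtain ⟨⟨hc1, hc2⟩, hc3⟩ := hc
    have hn := toVec_ray_mem hc3
    refine ⟨_, hn, (posAt_iff (length_ray c)).1 hc1, ?_⟩
    rw [eqAt_iff (length_ray c), sum_map_ev_apply] at hc2
    have := eq_zero_of_sum_section_eq (J := [k]) (comps := [t])
      (ev_facet_nonneg (mem_cone_of_mem_rays hn)) (.cons hk .nil) (by simpa using hc2)
    simpa using this
  intro ℓ hℓ hℓr x hx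
  refine nonneg_of_neighbours (r := rep i) (comps := [t]) ?_ ?_ ?_ ℓ hℓ hℓr x
    fun k _ => ev_facet_nonneg hx k
  · rintro _ (_ | ⟨hk, ⟨⟩⟩)
    obtain ⟨n, hn, hpos, hzero⟩ := hneigh _ hk
    exact ⟨n, hn, by simpa using hpos, by simpa using hzero⟩
  · intro x _ c hc d hd
    rw [List.mem_singleton.1 hc, List.mem_singleton.1 hd]
    exact id
  · intro x hx
    rw [List.flatten_singleton] at hx
    refine exists_eq_smul ?_ hr (rep_ne_zero hp) hx
    have := finrank_add_length_le hnodup fun k hk => by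
      obtain ⟨n, -, hn⟩ := hneigh k hk
      exact ⟨n, hn⟩
    omega

theorem simpleCheck_all : simpleVertices.all simpleCheck = true := by decide +kernel

theorem cuspCheck_all : cusps.all cuspCheck = true := by decide +kernel

theorem indices_eq : cusps.map Prod.fst ++ simpleVertices.map Prod.fst = List.range 234 := by
  decide +kernel

theorem isCertified_rep {k : ℕ} (hk : k < 234) : IsCertified (rep k) := by
  have hmem := List.mem_range.2 hk
  rw [← indices_eq, List.mem_append, List.mem_map, List.mem_map] at hmem
  rcases hmem with ⟨p, hp, rfl⟩ | ⟨p, hp, rfl⟩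
  · exact isCertified_of_cuspCheck hk (List.all_eq_true.1 cuspCheck_all p hp)
  · exact isCertified_of_simpleCheck hk (List.all_eq_true.1 simpleCheck_all p hp)

theorem isCertified_of_mem_rays {r : Idx → ℚ} (hr : r ∈ rays) : IsCertified r := by
  obtain ⟨k, hk, g, hg, rfl⟩ := hr
  intro ℓ hℓ hr x hx
  have hid : ∀ y : Idx → ℚ, (y ∘ ⇑g⁻¹) ∘ g = y := fun y => funext fun i => by simp
  have := isCertified_rep hk (ℓ.comp (LinearMap.funLeft ℚ ℚ g))
    (fun n hn => hℓ _ (comp_mem_rays hn hg)) hr (x ∘ ⇑g⁻¹)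
    (((inv_mem hg : g⁻¹ ∈ coneSymm).1 x).2 hx)
  exact this.trans_eq (congrArg ℓ (hid x))

theorem inl_nonneg {x : Idx → ℚ} (hx : x ∈ cone) (b : Fin 2) : 0 ≤ x (.inl b) := by
  obtain ⟨h1, h2, h3, -⟩ := hx
  have h4 := (Finset.sum_nonneg fun j _ => h1 0 j).trans (h2 0)
  have h5 := (Finset.sum_nonneg fun i _ => h1 i 0).trans (h3 0)
  fin_cases b
  exacts [h4, h5]

theorem rays_nonempty : rays.Nonempty := ⟨rep 0, 0, by norm_num, 1, one_mem _, rfl⟩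

theorem nonneg_on_cone (ℓ : (Idx → ℚ) →ₗ[ℚ] ℚ) (hℓ : ∀ n ∈ rays, 0 ≤ ℓ n) :
    ∀ x ∈ cone, 0 ≤ ℓ x := by
  intro x hx
  obtain ⟨v, hv, hmin⟩ := rays_finite.exists_minimalFor (fun n => ℓ n / height n) rays rays_nonempty
  have hs := height_pos_of_mem_rays hv
  have key := isCertified_of_mem_rays hv (height v • ℓ - ℓ v • height) ?_ ?_ x hx
  · simp only [LinearMap.sub_apply, LinearMap.smul_apply, smul_eq_mul] at key
    have hx0 : 0 ≤ height x := add_nonneg (inl_nonneg hx 0) (inl_nonneg hx 1)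
    have := mul_nonneg (hℓ v hv) hx0
    exact nonneg_of_mul_nonneg_right (by linarith) hs
  · intro n hn
    have hn0 := height_pos_of_mem_rays hn
    have : ℓ v / height v ≤ ℓ n / height n := by
      rcases le_total (ℓ v / height v) (ℓ n / height n) with h | h
      exacts [h, hmin hn h]
    rw [div_le_div_iff₀ hs hn0] at this
    simp only [LinearMap.sub_apply, LinearMap.smul_apply, smul_eq_mul]
    linarith
  · simp [mul_comm]

/-- The cone is contained in the closed positive light cone. -/
theorem quad_nonneg {x : Idx → ℚ} (hx : x ∈ cone) : 0 ≤ quad x := by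
  rcases (inl_nonneg hx 1).eq_or_lt with h0 | hpos
  · have hm : ∀ p, x (.inr p) = 0 := by
      rintro ⟨i, j⟩
      have h1 := hx.2.2.1 j
      rw [← h0] at h1
      exact le_antisymm ((Finset.single_le_sum (f := fun i => x (.inr (i, j)))
        (fun i _ => hx.1 i j) (Finset.mem_univ i)).trans h1) (hx.1 i j)
    simp [quad_eq, hm, ← h0]
  set N := ∑ p, x (.inr p) * x (.inr p) with hN
  let ℓ : (Idx → ℚ) →ₗ[ℚ] ℚ := N • LinearMap.proj (.inl 1) +
    (2 * x (.inl 1) ^ 2) • LinearMap.proj (.inl 0) -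
    (2 * x (.inl 1)) • ∑ p, x (.inr p) • LinearMap.proj (.inr p)
  have hℓ : ∀ y, ℓ y = N * y (.inl 1) + 2 * x (.inl 1) ^ 2 * y (.inl 0) -
      2 * x (.inl 1) * ∑ p, x (.inr p) * y (.inr p) := fun y => by
    simp [ℓ, LinearMap.sum_apply]
  have key := nonneg_on_cone ℓ (fun y hy => ?_) x hx
  · rw [hℓ, ← hN] at key
    rw [quad_eq, ← hN]
    refine nonneg_of_mul_nonneg_right (?_ : 0 ≤ x (.inl 1) * _) hpos
    linarith
  · rw [hℓ]
    have hq := quad_nonneg_of_mem_rays hy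
    rw [quad_eq] at hq
    have hc := mem_cone_of_mem_rays hy
    have h1 := inl_nonneg hc 1
    have h0 := inl_nonneg hc 0
    have hNn : 0 ≤ N := Finset.sum_nonneg fun p _ => mul_self_nonneg _
    have hcs : (∑ p, x (.inr p) * y (.inr p)) ^ 2 ≤ N * ∑ p, y (.inr p) * y (.inr p) := by
      simpa only [sq] using Finset.sum_mul_sq_le_sq_mul_sq Finset.univ
        (fun p => x (.inr p)) fun p => y (.inr p)
    rw [sub_nonneg]
    refine le_of_sq_le_sq ?_ (by positivity)
    have h2 : (∑ p, x (.inr p) * y (.inr p)) ^ 2 ≤ N * (2 * y (.inl 0) * y (.inl 1)) :=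
      hcs.trans (mul_le_mul_of_nonneg_left (by linarith) hNn)
    have h3 := mul_le_mul_of_nonneg_left h2 (by positivity : 0 ≤ 4 * x (.inl 1) ^ 2)
    nlinarith [sq_nonneg (N * y (.inl 1) - 2 * x (.inl 1) ^ 2 * y (.inl 0))]

/-- The simple roots, in the basis of `gramS`. -/
def rootList : List (List ℤ) :=
  [[0, 0, 0, 0, 0, 1, 0, 0, 0, 0, 0, 0, 0, 0, 0, 0, 0, 0],
   [4, 4, 5, 3, 6, 5, 4, 3, 2, 1, 6, 4, 8, 6, 4, 3, 2, 1],
   [1, 0, 1, 0, 0, 0, 0, 0, 0, 0, 0, 0, 0, 0, 0, 0, 0, 0],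
   [0, 0, 0, 1, 0, 0, 0, 0, 0, 0, 0, 0, 0, 0, 0, 0, 0, 0],
   [0, 0, 0, 0, 0, 0, 0, 1, 0, 0, 0, 0, 0, 0, 0, 0, 0, 0],
   [2, 2, 3, 2, 4, 3, 2, 1, 0, 0, 2, 1, 2, 1, 0, 0, 0, 0],
   [3, 2, 3, 2, 4, 3, 2, 1, 0, 0, 4, 3, 6, 5, 4, 3, 2, 1],
   [0, 0, 0, 0, 0, 0, 0, 0, 0, 1, 0, 0, 0, 0, 0, 0, 0, 0],
   [4, 4, 6, 4, 8, 6, 4, 3, 2, 1, 5, 3, 6, 5, 4, 3, 2, 1],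
   [0, 0, 0, 0, 0, 0, 0, 0, 0, 0, 0, 0, 0, 1, 0, 0, 0, 0],
   [1, 0, 0, 0, 0, 0, 0, 0, 0, 0, 1, 0, 0, 0, 0, 0, 0, 0],
   [0, 0, 0, 0, 0, 0, 0, 0, 0, 0, 0, 1, 0, 0, 0, 0, 0, 0],
   [2, 2, 2, 1, 2, 1, 0, 0, 0, 0, 3, 2, 4, 3, 2, 1, 0, 0],
   [0, 0, 0, 0, 0, 0, 0, 0, 0, 0, 0, 0, 0, 0, 0, 1, 0, 0],
   [3, 2, 4, 3, 6, 5, 4, 3, 2, 1, 3, 2, 4, 3, 2, 1, 0, 0],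
   [0, 0, 0, 0, 0, 0, 0, 0, 0, 0, 0, 0, 0, 0, 0, 0, 0, 1],
   [0, 0, 0, 0, 1, 0, 0, 0, 0, 0, 0, 0, 0, 0, 0, 0, 0, 0],
   [0, 0, 0, 0, 0, 0, 0, 0, 1, 0, 0, 0, 0, 0, 0, 0, 0, 0],
   [0, 0, 0, 0, 0, 0, 0, 0, 0, 0, 0, 0, 1, 0, 0, 0, 0, 0],
   [0, 0, 0, 0, 0, 0, 0, 0, 0, 0, 0, 0, 0, 0, 0, 0, 1, 0],
   [0, 0, 0, 0, 0, 0, 1, 0, 0, 0, 0, 0, 0, 0, 0, 0, 0, 0],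
   [0, 0, 0, 0, 0, 0, 0, 0, 0, 0, 0, 0, 0, 0, 1, 0, 0, 0],
   [-1, 1, 0, 0, 0, 0, 0, 0, 0, 0, 0, 0, 0, 0, 0, 0, 0, 0],
   [3, 3, 4, 2, 5, 4, 3, 2, 1, 0, 4, 2, 5, 4, 3, 2, 1, 0],
   [8, 8, 11, 7, 14, 10, 8, 6, 4, 2, 11, 8, 16, 13, 10, 7, 4, 1],
   [6, 6, 7, 4, 8, 5, 4, 3, 2, 1, 9, 5, 12, 10, 8, 6, 4, 2],
   [8, 8, 11, 7, 14, 10, 8, 6, 4, 2, 10, 6, 12, 8, 6, 4, 2, 0],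
   [8, 8, 11, 7, 14, 10, 8, 6, 4, 2, 10, 5, 12, 9, 6, 3, 2, 1],
   [8, 8, 10, 6, 12, 8, 6, 4, 2, 0, 11, 7, 14, 10, 8, 6, 4, 2],
   [10, 10, 14, 9, 18, 13, 10, 7, 4, 1, 13, 9, 18, 14, 10, 6, 4, 2],
   [6, 6, 9, 6, 12, 9, 6, 3, 2, 1, 7, 5, 10, 8, 6, 4, 2, 0],
   [4, 4, 5, 3, 6, 4, 2, 0, 0, 0, 5, 2, 6, 5, 4, 3, 2, 1],
   [0, 0, 0, 0, 0, 0, 0, 0, 0, 0, -1, -1, -2, -2, -2, -2, -2, -2],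
   [2, 2, 4, 3, 6, 5, 4, 3, 2, 1, 1, -1, 0, 0, 0, 0, 0, 0],
   [0, 0, -1, -1, -2, -2, -2, -2, -2, -2, 0, 0, 0, 0, 0, 0, 0, 0],
   [4, 4, 7, 5, 10, 8, 6, 4, 2, 0, 4, 3, 6, 5, 4, 3, 2, 1],
   [10, 10, 13, 9, 18, 14, 10, 6, 4, 2, 14, 9, 18, 13, 10, 7, 4, 1],
   [10, 10, 13, 9, 18, 14, 10, 6, 4, 2, 14, 8, 18, 14, 10, 6, 4, 2],
   [4, 4, 4, 3, 6, 5, 4, 3, 2, 1, 7, 5, 10, 8, 6, 4, 2, 0],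
   [6, 6, 8, 6, 12, 10, 8, 6, 4, 2, 9, 5, 12, 10, 8, 6, 4, 2],
   [6, 6, 7, 5, 10, 8, 6, 4, 2, 0, 9, 6, 12, 9, 6, 3, 2, 1],
   [8, 8, 11, 8, 16, 13, 10, 7, 4, 1, 11, 7, 14, 10, 8, 6, 4, 2],
   [8, 8, 10, 5, 12, 9, 6, 3, 2, 1, 11, 7, 14, 10, 8, 6, 4, 2],
   [10, 10, 14, 8, 18, 14, 10, 6, 4, 2, 13, 9, 18, 14, 10, 6, 4, 2],
   [2, 2, 1, -1, 0, 0, 0, 0, 0, 0, 4, 3, 6, 5, 4, 3, 2, 1],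
   [6, 6, 9, 5, 12, 10, 8, 6, 4, 2, 8, 6, 12, 10, 8, 6, 4, 2],
   [4, 4, 5, 2, 6, 5, 4, 3, 2, 1, 5, 3, 6, 4, 2, 0, 0, 0],
   [6, 6, 9, 5, 12, 10, 8, 6, 4, 2, 7, 4, 8, 5, 4, 3, 2, 1]]

/-- The coordinate functionals `u`, `v`, `mᵢⱼ` on the lattice. -/
def coordList : List (List ℤ) :=
  [[4, 5, -4, 0, 0, 0, 1, 0, 0, 0, -4, 0, 0, 0, 1, 0, 0, 0],
   [6, 6, -6, 0, 1, 0, 0, 0, 1, 0, -6, 0, 1, 0, 0, 0, 1, 0],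
   [0, 0, 0, 0, 1, -2, 1, 0, 0, 0, 0, 0, 0, 0, 0, 0, 0, 0],
   [4, 4, -4, 0, 1, 0, 0, 0, 0, 0, -4, 0, 0, 0, 1, 0, 0, 0],
   [0, 1, -2, 0, 1, 0, 0, 0, 0, 0, 0, 0, 0, 0, 0, 0, 0, 0],
   [0, 0, 0, -2, 1, 0, 0, 0, 0, 0, 0, 0, 0, 0, 0, 0, 0, 0],
   [0, 0, 0, 0, 0, 0, 1, -2, 1, 0, 0, 0, 0, 0, 0, 0, 0, 0],
   [2, 2, -2, 0, 0, 0, 0, 0, 1, 0, -2, 0, 0, 0, 1, 0, 0, 0],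
   [2, 3, -2, 0, 0, 0, 0, 0, 1, 0, -2, 0, 0, 0, 0, 0, 0, 0],
   [0, 0, 0, 0, 0, 0, 0, 0, 1, -2, 0, 0, 0, 0, 0, 0, 0, 0],
   [4, 4, -4, 0, 0, 0, 1, 0, 0, 0, -4, 0, 1, 0, 0, 0, 0, 0],
   [0, 0, 0, 0, 0, 0, 0, 0, 0, 0, 0, 0, 1, -2, 1, 0, 0, 0],
   [0, 1, 0, 0, 0, 0, 0, 0, 0, 0, -2, 0, 1, 0, 0, 0, 0, 0],
   [0, 0, 0, 0, 0, 0, 0, 0, 0, 0, 0, -2, 1, 0, 0, 0, 0, 0],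
   [2, 2, -2, 0, 0, 0, 1, 0, 0, 0, -2, 0, 0, 0, 0, 0, 1, 0],
   [0, 0, 0, 0, 0, 0, 0, 0, 0, 0, 0, 0, 0, 0, 1, -2, 1, 0],
   [2, 3, -2, 0, 0, 0, 0, 0, 0, 0, -2, 0, 0, 0, 0, 0, 1, 0],
   [0, 0, 0, 0, 0, 0, 0, 0, 0, 0, 0, 0, 0, 0, 0, 0, 1, -2]]

/-- 2 times the inverse of the matrix `coordList`. -/
def coordInvList : List (List ℤ) :=
  [[6, 5, 0, -4, -1, 0, 0, -2, -3, 0, -4, 0, -1, 0, -2, 0, -3, 0],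
   [6, 4, 0, -4, 0, 0, 0, -2, -2, 0, -4, 0, 0, 0, -2, 0, -2, 0],
   [8, 6, 0, -5, -1, 0, 0, -3, -3, 0, -6, 0, 0, 0, -2, 0, -4, 0],
   [5, 4, 0, -3, 0, -1, 0, -2, -2, 0, -4, 0, 0, 0, -1, 0, -3, 0],
   [10, 8, 0, -6, 0, 0, 0, -4, -4, 0, -8, 0, 0, 0, -2, 0, -6, 0],
   [8, 6, -1, -5, 0, 0, 0, -3, -3, 0, -6, 0, 0, 0, -1, 0, -5, 0],
   [6, 4, 0, -4, 0, 0, 0, -2, -2, 0, -4, 0, 0, 0, 0, 0, -4, 0],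
   [4, 3, 0, -3, 0, 0, -1, -1, -1, 0, -3, 0, 0, 0, 0, 0, -3, 0],
   [2, 2, 0, -2, 0, 0, 0, 0, 0, 0, -2, 0, 0, 0, 0, 0, -2, 0],
   [1, 1, 0, -1, 0, 0, 0, 0, 0, -1, -1, 0, 0, 0, 0, 0, -1, 0],
   [8, 6, 0, -6, 0, 0, 0, -2, -4, 0, -5, 0, -1, 0, -3, 0, -3, 0],
   [5, 4, 0, -4, 0, 0, 0, -1, -3, 0, -3, 0, 0, -1, -2, 0, -2, 0],
   [10, 8, 0, -8, 0, 0, 0, -2, -6, 0, -6, 0, 0, 0, -4, 0, -4, 0],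
   [8, 6, 0, -6, 0, 0, 0, -1, -5, 0, -5, -1, 0, 0, -3, 0, -3, 0],
   [6, 4, 0, -4, 0, 0, 0, 0, -4, 0, -4, 0, 0, 0, -2, 0, -2, 0],
   [4, 3, 0, -3, 0, 0, 0, 0, -3, 0, -3, 0, 0, 0, -1, -1, -1, 0],
   [2, 2, 0, -2, 0, 0, 0, 0, -2, 0, -2, 0, 0, 0, 0, 0, 0, 0],
   [1, 1, 0, -1, 0, 0, 0, 0, -1, 0, -1, 0, 0, 0, 0, 0, 0, -1]]

def weylList : List ℤ := [23, 22, 30, 19, 39, 30, 22, 15, 9, 4, 30, 19, 39, 30, 22, 15, 9, 4]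

def baseList : List ℤ := [11, 10, 14, 9, 18, 14, 10, 7, 4, 2, 14, 9, 18, 14, 10, 7, 4, 2]

abbrev Lat := Fin (2 + (8 + 8)) → ℤ

/-- The `k`th simple root. -/
def root (k : Fin 48) : Lat := fun a => (rootList.getD k []).getD a 0

/-- A vector pairing positively with all simple roots. -/
def weylVec : Lat := fun a => weylList.getD a 0

/-- The vector of square `4` representing the functional `u + v`. -/
def baseVec : Lat := fun a => baseList.getD a 0

/-- The matrix of the coordinates `u`, `v`, `mᵢⱼ` on the lattice. -/
def coordMatrix : Matrix Idx (Fin (2 + (8 + 8))) ℤ :=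
  fun i a => (coordList.getD (idxPos i) []).getD a 0

/-- Twice the inverse of `coordMatrix`. -/
def coordInv : Matrix (Fin (2 + (8 + 8))) Idx ℤ :=
  fun a i => (coordInvList.getD a []).getD (idxPos i) 0

/-- The coordinates `u`, `v`, `mᵢⱼ` on the lattice. -/
def coord : Lat →ₗ[ℤ] (Idx → ℤ) := coordMatrix.mulVecLin

/-- The pairing of the lattice. -/
def latB : LinearMap.BilinForm ℤ Lat := Matrix.toBilin' gramS

theorem latB_apply (x y : Lat) : latB x y = bform gramS x y := Matrix.toBilin'_apply' _ _ _

/-- The ratio between a facet functional and the pairing with the corresponding root. -/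
def facetMult (k : Fin 48) : ℤ := if k.1 / 8 = 2 then 2 else 1

/-- Twice the form of `gramS` in the coordinates `u`, `v`, `mᵢⱼ`. -/
def coordForm : LinearMap.BilinForm ℤ (Idx → ℤ) :=
  LinearMap.mk₂ ℤ (fun y z => y (.inl 0) * z (.inl 1) + y (.inl 1) * z (.inl 0) -
      ∑ p, y (.inr p) * z (.inr p))
    (fun _ _ _ => by simp only [Pi.add_apply, add_mul, Finset.sum_add_distrib]; ring)
    (fun _ _ _ => by simp only [Pi.smul_apply, smul_eq_mul, mul_assoc, ← Finset.mul_sum]; ring)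
    (fun _ _ _ => by simp only [Pi.add_apply, mul_add, Finset.sum_add_distrib]; ring)
    (fun _ _ _ => by
      simp only [Pi.smul_apply, smul_eq_mul, mul_left_comm _ (_ : ℤ) (_ : ℤ), ← Finset.mul_sum]
      ring)

theorem coordForm_apply (y z : Idx → ℤ) : coordForm y z =
    y (.inl 0) * z (.inl 1) + y (.inl 1) * z (.inl 0) - ∑ p, y (.inr p) * z (.inr p) := rfl

theorem two_mul_gramS : ∀ a b, 2 * gramS a b =
    coordMatrix (.inl 0) a * coordMatrix (.inl 1) b +
      coordMatrix (.inl 1) a * coordMatrix (.inl 0) b -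
      ∑ p, coordMatrix (.inr p) a * coordMatrix (.inr p) b := by
  decide +kernel

theorem gramS_isSymm : gramS.IsSymm := Matrix.IsSymm.ext fun a b => by
  refine mul_left_cancel₀ (two_ne_zero' ℤ) ?_
  rw [two_mul_gramS, two_mul_gramS]
  simp only [mul_comm (coordMatrix _ b)]
  ring

theorem vecMul_coordMatrix (k : Fin 48) :
    coefAt (facet k) ᵥ* coordMatrix = facetMult k • (gramS *ᵥ root k) := by
  revert k
  decide +kernel

theorem coordInv_mul_coordMatrix : coordInv * coordMatrix = (2 : ℤ) • 1 := by
  decide +kernel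

theorem latB_root_self (k : Fin 48) : latB (root k) (root k) = if k.1 < 24 then -2 else -4 := by
  rw [latB_apply]
  revert k
  decide +kernel

theorem two_dvd_gramS_mulVec_root (k : Fin 48) (hk : 24 ≤ k.1) (a : Fin (2 + (8 + 8))) :
    2 ∣ (gramS *ᵥ root k) a := by
  revert k a
  decide +kernel

theorem latB_weylVec_root_pos (k : Fin 48) : 0 < latB weylVec (root k) := by
  rw [latB_apply]
  revert k
  decide +kernel

theorem latB_weylVec_self_pos : 0 < latB weylVec weylVec := by
  rw [latB_apply]
  decide +kernel

theorem latB_baseVec_self : latB baseVec baseVec = 4 := by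
  rw [latB_apply]
  decide +kernel

theorem gramS_mulVec_baseVec :
    coordMatrix (.inl 0) + coordMatrix (.inl 1) = gramS *ᵥ baseVec := by
  decide +kernel

theorem latB_comm (x y : Lat) : latB x y = latB y x := by
  rw [latB_apply, latB_apply, bform, bform, Matrix.dotProduct_mulVec, ← Matrix.mulVec_transpose,
    gramS_isSymm.eq, dotProduct_comm]

theorem two_mul_latB (x y : Lat) : 2 * latB x y = coordForm (coord x) (coord y) := by
  suffices (2 : ℤ) • latB = coordForm.compl₁₂ coord coord from
    congrArg (fun f => f x y) this
  refine LinearMap.BilinForm.ext_basis (Pi.basisFun ℤ _) fun a b => ?_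
  have h : ∀ a i, coord (Pi.single a 1) i = coordMatrix i a := fun a i => by
    simp [coord]
  have hB : latB (Pi.single a 1) (Pi.single b 1) = gramS a b := Matrix.toBilin'_single _ _ _
  simp only [Pi.basisFun_apply, LinearMap.smul_apply, LinearMap.compl₁₂_apply, hB, smul_eq_mul,
    coordForm_apply, h, two_mul_gramS]

theorem eq_zero_of_coord_eq_zero {x : Lat} (hx : coord x = 0) : x = 0 := by
  have h : coordInv *ᵥ coord x = (2 : ℤ) • x := by
    rw [coord, Matrix.mulVecLin_apply, Matrix.mulVec_mulVec, coordInv_mul_coordMatrix,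
      Matrix.smul_mulVec, Matrix.one_mulVec]
  rw [hx, Matrix.mulVec_zero] at h
  exact (smul_eq_zero.1 h.symm).resolve_left two_ne_zero

theorem coord_injective : Function.Injective coord :=
  (injective_iff_map_eq_zero coord).2 fun _ => eq_zero_of_coord_eq_zero

theorem sum_coefAt_mul_coord (k : Fin 48) (x : Lat) :
    ∑ i, coefAt (facet k) i * coord x i = facetMult k * latB x (root k) := by
  have : coefAt (facet k) ⬝ᵥ (coordMatrix *ᵥ x) = facetMult k * latB x (root k) := by
    rw [Matrix.dotProduct_mulVec, vecMul_coordMatrix, smul_dotProduct, latB_apply, bform,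
      smul_eq_mul, dotProduct_comm]
  exact this

theorem latB_baseVec (x : Lat) : latB x baseVec = coord x (.inl 0) + coord x (.inl 1) := by
  rw [latB_apply, bform, ← gramS_mulVec_baseVec, dotProduct_add, dotProduct_comm, dotProduct_comm x]
  rfl

/-- The coordinates as a rational vector. -/
def ratCoord (x : Lat) : Idx → ℚ := fun i => coord x i

theorem ev_ratCoord (k : Fin 48) (x : Lat) :
    ev (facet k) (ratCoord x) = facetMult k * latB x (root k) := by
  rw [ev_eq_coefAt]
  simp only [ratCoord]
  exact_mod_cast sum_coefAt_mul_coord k x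

theorem facetMult_pos (k : Fin 48) : 0 < facetMult k := by
  unfold facetMult
  split_ifs <;> norm_num

/-- The Vinberg chamber. -/
def chamber : Set Lat := {x | ∀ k, 0 ≤ latB x (root k)}

theorem ratCoord_mem_cone_iff {x : Lat} : ratCoord x ∈ cone ↔ x ∈ chamber := by
  refine (mem_cone_iff _).trans (forall_congr' fun k => ?_)
  rw [ev_ratCoord, ← Int.cast_mul, Int.cast_nonneg_iff,
    mul_nonneg_iff_of_pos_left (facetMult_pos k)]

theorem quad_ratCoord (x : Lat) : quad (ratCoord x) = 2 * latB x x := by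
  have := two_mul_latB x x
  rw [coordForm_apply] at this
  rw [quad_eq, ← Int.cast_two, ← Int.cast_mul, this]
  simp only [ratCoord]
  push_cast
  ring

theorem latB_self_nonneg {x : Lat} (hx : x ∈ chamber) : 0 ≤ latB x x := by
  have := quad_nonneg (ratCoord_mem_cone_iff.2 hx)
  rw [quad_ratCoord] at this
  exact_mod_cast nonneg_of_mul_nonneg_right this two_pos

theorem coord_inl_nonneg {x : Lat} (hx : x ∈ chamber) (b : Fin 2) : 0 ≤ coord x (.inl b) :=
  Int.cast_nonneg_iff.1 (inl_nonneg (ratCoord_mem_cone_iff.2 hx) b)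

theorem sq_sum_mul_le (y z : Idx → ℤ) : (∑ p, y (.inr p) * z (.inr p)) ^ 2 ≤
    (∑ p, y (.inr p) * y (.inr p)) * ∑ p, z (.inr p) * z (.inr p) := by
  simpa only [sq] using Finset.sum_mul_sq_le_sq_mul_sq Finset.univ (fun p => y (.inr p)) _

theorem sum_mul_self_nonneg (y : Idx → ℤ) : 0 ≤ ∑ p, y (.inr p) * y (.inr p) :=
  Finset.sum_nonneg fun _ _ => mul_self_nonneg _

theorem latB_nonneg {x y : Lat} (hx : x ∈ chamber) (hy : y ∈ chamber) : 0 ≤ latB x y := by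
  have hx0 := coord_inl_nonneg hx 0
  have hx1 := coord_inl_nonneg hx 1
  have hy0 := coord_inl_nonneg hy 0
  have hy1 := coord_inl_nonneg hy 1
  have hxx := latB_self_nonneg hx
  have hyy := latB_self_nonneg hy
  have h := sq_sum_mul_le (coord x) (coord y)
  have hx2 := sum_mul_self_nonneg (coord x)
  have hy2 := sum_mul_self_nonneg (coord y)
  have e1 := two_mul_latB x x
  have e2 := two_mul_latB y y
  have e3 := two_mul_latB x y
  rw [coordForm_apply] at e1 e2 e3
  generalize ∑ p, coord x (.inr p) * coord x (.inr p) = a at *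
  generalize ∑ p, coord y (.inr p) * coord y (.inr p) = b at *
  generalize ∑ p, coord x (.inr p) * coord y (.inr p) = c at *
  generalize coord x (.inl 0) = x0 at *
  generalize coord x (.inl 1) = x1 at *
  generalize coord y (.inl 0) = y0 at *
  generalize coord y (.inl 1) = y1 at *
  have h1 : a * b ≤ (2 * x0 * x1) * (2 * y0 * y1) :=
    mul_le_mul (by linarith) (by linarith) hy2 (by positivity)
  have h2 : c ≤ x0 * y1 + x1 * y0 := by
    refine (abs_le_of_sq_le_sq' ?_ (by positivity)).2
    nlinarith [sq_nonneg (x0 * y1 - x1 * y0)]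
  linarith

/-- The pairing is negative definite on the orthogonal complement of a positive vector. -/
theorem eq_zero_of_latB_eq_zero {w z : Lat} (hz : 0 < latB z z) (hwz : latB w z = 0)
    (hw : 0 ≤ latB w w) : w = 0 := by
  have h := sq_sum_mul_le (coord w) (coord z)
  have e1 := two_mul_latB w w
  have e2 := two_mul_latB z z
  have e3 := two_mul_latB w z
  rw [coordForm_apply] at e1 e2 e3
  have hw2 := sum_mul_self_nonneg (coord w)
  have hz2 := sum_mul_self_nonneg (coord z)
  obtain ⟨h0, h1, h2⟩ : coord w (.inl 0) = 0 ∧ coord w (.inl 1) = 0 ∧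
      ∑ p, coord w (.inr p) * coord w (.inr p) = 0 := by
    generalize ∑ p, coord w (.inr p) * coord w (.inr p) = a at *
    generalize ∑ p, coord z (.inr p) * coord z (.inr p) = b at *
    generalize ∑ p, coord w (.inr p) * coord z (.inr p) = c at *
    generalize coord w (.inl 0) = w0 at *
    generalize coord w (.inl 1) = w1 at *
    generalize coord z (.inl 0) = z0 at *
    generalize coord z (.inl 1) = z1 at *
    have hc : c = w0 * z1 + w1 * z0 := by linarith
    have hzz : b < 2 * z0 * z1 := by linarith
    have hww : a ≤ 2 * w0 * w1 := by linarith
    have ha : a = 0 := by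
      by_contra hne
      have ha : 0 < a := lt_of_le_of_ne hw2 (Ne.symm hne)
      rw [hc] at h
      linarith [sq_nonneg (w0 * z1 - w1 * z0), mul_lt_mul_of_pos_left hzz ha,
        mul_le_mul_of_nonneg_right hww (hz2.trans hzz.le)]
    have hzpos : 0 < z0 * z1 := by nlinarith
    subst ha
    have hc0 : c = 0 := by nlinarith
    have hww0 : 0 ≤ w0 * w1 := by linarith
    have h3 : (w0 * z1) ^ 2 + (w1 * z0) ^ 2 + 2 * (w0 * w1) * (z0 * z1) = 0 := by
      have : (w0 * z1 + w1 * z0) ^ 2 = 0 := by rw [← hc, hc0]; rfl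
      linarith
    have h4 : 0 ≤ 2 * (w0 * w1) * (z0 * z1) := by positivity
    have hz0 : z0 ≠ 0 := left_ne_zero_of_mul hzpos.ne'
    have hz1 : z1 ≠ 0 := right_ne_zero_of_mul hzpos.ne'
    refine ⟨?_, ?_, rfl⟩
    · have : (w0 * z1) ^ 2 = 0 := by nlinarith [sq_nonneg (w0 * z1), sq_nonneg (w1 * z0)]
      exact (mul_eq_zero.1 (pow_eq_zero_iff two_ne_zero |>.1 this)).resolve_right hz1
    · have : (w1 * z0) ^ 2 = 0 := by nlinarith [sq_nonneg (w0 * z1), sq_nonneg (w1 * z0)]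
      exact (mul_eq_zero.1 (pow_eq_zero_iff two_ne_zero |>.1 this)).resolve_right hz0
  refine eq_zero_of_coord_eq_zero (funext fun i => ?_)
  rcases i with b | p
  · fin_cases b
    exacts [h0, h1]
  · exact mul_self_eq_zero.1 <|
      (Finset.sum_eq_zero_iff_of_nonneg fun _ _ => mul_self_nonneg _).1 h2 p (Finset.mem_univ _)

theorem latB_map (g : OrthGroup _ gramS) (x y : Lat) : latB (g.1 x) (g.1 y) = latB x y := by
  simpa only [latB_apply] using g.2 x y

theorem latB_root_self_neg (k : Fin 48) : latB (root k) (root k) < 0 := by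
  rw [latB_root_self]
  split_ifs <;> norm_num

theorem isRoot_root (k : Fin 48) : IsRoot gramS (root k) := by
  have h := latB_root_self k
  rw [latB_apply] at h
  split_ifs at h with hk
  · exact .inl h
  · refine .inr ⟨h, fun x => ?_⟩
    rw [← latB_apply, latB_comm, latB_apply]
    have h2 : 2 ∣ ∑ a, x a * (gramS *ᵥ root k) a := Finset.dvd_sum fun a _ =>
      dvd_mul_of_dvd_right (two_dvd_gramS_mulVec_root k (not_lt.1 hk) a) _
    exact h2

theorem latB_self_dvd {α : Lat} (hα : IsRoot gramS α) (x : Lat) :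
    latB α α ∣ 2 * latB x α := by
  rcases hα with h | ⟨h, h2⟩
  · rw [latB_apply α α, h]
    exact (neg_dvd.2 dvd_rfl).mul_right _
  · obtain ⟨c, hc⟩ := h2 x
    rw [latB_comm x, latB_apply, latB_apply, h, hc]
    exact ⟨-c, by ring⟩

theorem exists_reflection {α : Lat} (hα : IsRoot gramS α) :
    ∃ s ∈ Wr _ gramS, ∃ c : Lat → ℤ, ∀ x, c x * latB α α = 2 * latB x α ∧
      s.1 x = x - c x • α := by
  have hne : latB α α ≠ 0 := by
    rw [latB_apply]
    rcases hα with h | ⟨h, -⟩ <;> simp [h]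
  have hc (x : Lat) : 2 * latB x α / latB α α * latB α α = 2 * latB x α :=
    Int.ediv_mul_cancel (latB_self_dvd hα x)
  let f : Module.Dual ℤ Lat :=
    { toFun := fun x => 2 * latB x α / latB α α
      map_add' := fun x y => mul_right_cancel₀ hne <| by
        rw [add_mul, hc, hc, hc, map_add, LinearMap.add_apply, mul_add]
      map_smul' := fun m x => mul_right_cancel₀ hne <| by
        rw [RingHom.id_apply, smul_eq_mul, mul_assoc, hc, hc, map_smul, LinearMap.smul_apply,
          smul_eq_mul, mul_left_comm] }
  have hf : f α = 2 := Int.mul_ediv_cancel 2 hne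
  have hs (x : Lat) : Module.reflection hf x = x - f x • α := Module.reflection_apply _ _
  have hmem : Module.reflection hf ∈ OrthGroup _ gramS := fun x y => by
    simp only [← latB_apply, hs, map_sub, map_smul, LinearMap.sub_apply, LinearMap.smul_apply,
      smul_eq_mul, latB_comm α y]
    have hx : f x * latB α α = 2 * latB x α := hc x
    have hy : f y * latB α α = 2 * latB y α := hc y
    refine mul_left_cancel₀ (two_ne_zero' ℤ) ?_
    linear_combination f y * hx + f x * hy
  refine ⟨⟨_, hmem⟩, Subgroup.subset_closure ⟨α, hα, fun x => ?_⟩, f, fun x => ⟨hc x, hs x⟩⟩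
  rw [hs, ← latB_apply, ← latB_apply]
  rfl

/-- A positive vector whose pairing with the Weyl vector is minimal lies in the chamber. -/
theorem mem_chamber_of_minimal {y : Lat} (hy : 0 < latB y y) (hρ : 0 < latB y weylVec)
    (hmin : ∀ s ∈ Wr _ gramS, |latB y weylVec| ≤ |latB (s.1 y) weylVec|) : y ∈ chamber := by
  intro k
  by_contra! hk
  obtain ⟨s, hs, c, hc⟩ := exists_reflection (isRoot_root k)
  obtain ⟨h1, h2⟩ := hc y
  have hle := hmin s hs
  have hss := latB_map s y y
  have hw := latB_weylVec_root_pos k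
  rw [latB_comm] at hw
  have hkk := latB_root_self_neg k
  have hcpos : 0 < c y := by nlinarith
  have h3 : latB (s.1 y) weylVec = latB y weylVec - c y * latB (root k) weylVec := by
    rw [h2, map_sub, map_smul]; rfl
  have h4 : latB y (s.1 y) = latB y y - c y * latB y (root k) := by
    rw [h2, map_sub, map_smul, smul_eq_mul]
  generalize s.1 y = y' at *
  have h5 : latB y' weylVec ≤ -latB y weylVec := by
    rw [abs_of_pos hρ, le_abs] at hle
    rcases hle with h | h
    · nlinarith [mul_pos hcpos hw]
    · linarith
  have h6 : 0 < latB y y' := by nlinarith [mul_neg_of_pos_of_neg hcpos hk]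
  set p := latB y weylVec
  set q := -latB y' weylVec with hq
  have hqpos : 0 < q := by linarith
  have hzz : latB (q • y + p • y') (q • y + p • y') =
      q * q * latB y y + 2 * (p * q) * latB y y' + p * p * latB y y := by
    simp only [map_add, map_smul, LinearMap.add_apply, LinearMap.smul_apply, smul_eq_mul, hss,
      latB_comm y' y]
    ring
  have hpos : 0 < latB (q • y + p • y') (q • y + p • y') := by
    rw [hzz]
    positivity
  have hz : q • y + p • y' = 0 := by
    refine eq_zero_of_latB_eq_zero latB_weylVec_self_pos ?_ hpos.le
    simp only [map_add, map_smul, LinearMap.add_apply, LinearMap.smul_apply, smul_eq_mul]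
    linear_combination p * hq
  rw [hz, map_zero] at hpos
  exact hpos.false

/-- Every positive vector can be moved into the chamber or its opposite. -/
theorem exists_mem_chamber {x : Lat} (hx : 0 < latB x x) :
    ∃ w ∈ Wr _ gramS, w.1 x ∈ chamber ∨ -w.1 x ∈ chamber := by
  let f (w : Wr _ gramS) : ℕ := (latB (w.1.1 x) weylVec).natAbs
  let w := Function.argmin f
  have hw : 0 < latB (w.1.1 x) (w.1.1 x) := by rwa [latB_map]
  have hmin : ∀ s ∈ Wr _ gramS,
      |latB (w.1.1 x) weylVec| ≤ |latB (s.1 (w.1.1 x)) weylVec| := fun s hs => by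
    rw [Int.abs_eq_natAbs, Int.abs_eq_natAbs]
    exact_mod_cast Function.argmin_le f (⟨s, hs⟩ * w)
  refine ⟨w.1, w.2, ?_⟩
  rcases lt_trichotomy (latB (w.1.1 x) weylVec) 0 with h | h | h
  · refine .inr (mem_chamber_of_minimal (by simpa using hw) (by simpa using h) fun s hs => ?_)
    simpa only [map_neg, LinearMap.neg_apply, abs_neg] using hmin s hs
  · have := eq_zero_of_latB_eq_zero latB_weylVec_self_pos h hw.le
    rw [this, map_zero] at hw
    exact hw.false.elim
  · exact .inl (mem_chamber_of_minimal hw h hmin)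

theorem eq_of_forall_latB_root_le {x y : Lat} (hx : x ∈ chamber) (hpos : 0 < latB x x)
    (hxy : latB x x = latB y y) (h : ∀ k, latB x (root k) ≤ latB y (root k)) : x = y := by
  have hd : y - x ∈ chamber := fun k => by
    rw [map_sub, LinearMap.sub_apply]
    exact sub_nonneg.2 (h k)
  have h1 := latB_self_nonneg hd
  have h2 := latB_nonneg hd hx
  have h3 : latB (y - x) (y - x) + 2 * latB (y - x) x = 0 := by
    simp only [map_sub, LinearMap.sub_apply, hxy, latB_comm x y]
    ring
  exact (sub_eq_zero.1 (eq_zero_of_latB_eq_zero hpos (by linarith) h1)).symm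

theorem finite_chamber_inter (n : ℤ) (hn : 0 < n) : {x ∈ chamber | latB x x = n}.Finite := by
  by_contra hinf
  let e := Set.Infinite.natEmbedding _ hinf
  obtain ⟨i, j, hij, hle⟩ := wellQuasiOrdered_le fun i k => (latB (e i).1 (root k)).toNat
  refine hij.ne (e.injective (Subtype.ext ?_))
  refine eq_of_forall_latB_root_le (e i).2.1 (hn.trans_eq (e i).2.2.symm)
    ((e i).2.2.trans (e j).2.2.symm) fun k => ?_
  have h : (latB (e i).1 (root k)).toNat ≤ (latB (e j).1 (root k)).toNat := hle k
  rwa [Int.toNat_le, Int.toNat_of_nonneg ((e j).2.1 k)] at h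

theorem finite_latB_eq (a b : ℤ) : {x | latB x x = a ∧ latB x baseVec = b}.Finite := by
  let N := b ^ 2 - 2 * a
  refine ((Set.finite_Icc (fun _ : Idx => -N) fun _ => N).preimage
    coord_injective.injOn).subset ?_
  rintro x ⟨h1, h2⟩
  have h3 := two_mul_latB x x
  rw [coordForm_apply, h1] at h3
  rw [latB_baseVec] at h2
  have h4 : ∑ i, coord x i * coord x i = N := by
    simp only [Fintype.sum_sum_type, Fin.sum_univ_two, N, ← h2]
    linarith
  have h5 (i) : |coord x i| ≤ N := by
    rw [← h4, Int.abs_eq_natAbs]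
    refine le_trans ?_ (Finset.single_le_sum (fun j _ => mul_self_nonneg (coord x j))
      (Finset.mem_univ i))
    rw [← Int.natAbs_mul_self]
    exact_mod_cast Nat.le_mul_self _
  exact ⟨fun i => (abs_le.1 (h5 i)).1, fun i => (abs_le.1 (h5 i)).2⟩

theorem finite_stabilizer : {g : OrthGroup _ gramS | g.1 baseVec = baseVec}.Finite := by
  let F (g : OrthGroup _ gramS) (a : Fin (2 + (8 + 8))) : Lat := g.1 (Pi.single a 1)
  have hF : Function.Injective F := fun g h hgh =>
    Subtype.ext <| LinearEquiv.toLinearMap_injective <|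
      (Pi.basisFun ℤ _).ext fun a => by simpa using congrFun hgh a
  refine ((Set.Finite.pi' fun a => finite_latB_eq (latB (Pi.single a 1) (Pi.single a 1))
    (latB (Pi.single a 1) baseVec)).preimage hF.injOn).subset fun g hg a => ⟨latB_map _ _ _,
    (congrArg (latB (F g a)) (Eq.symm hg)).trans (latB_map g _ _)⟩

theorem finite_setOf_map_mem {X : Set Lat} (hX : X.Finite) :
    {g : OrthGroup _ gramS | g.1 baseVec ∈ X}.Finite := by
  refine (hX.biUnion (t := fun x => {g : OrthGroup _ gramS | g.1 baseVec = x}) fun x _ => ?_).subset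
    fun _ hg => Set.mem_iUnion₂.2 ⟨_, hg, rfl⟩
  rcases Set.eq_empty_or_nonempty {g : OrthGroup _ gramS | g.1 baseVec = x} with h | ⟨g₀, hg₀⟩
  · exact h ▸ Set.finite_empty
  · refine (finite_stabilizer.preimage (mul_right_injective g₀⁻¹).injOn).subset fun g hg => ?_
    exact (LinearEquiv.symm_apply_eq _).2 (hg.trans hg₀.symm)

theorem finiteIndex_Wr : (Wr _ gramS).FiniteIndex := by
  let X : Set Lat := {x ∈ chamber | latB x x = 4}
  have hX : X.Finite := finite_chamber_inter 4 four_pos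
  let K : Set (OrthGroup _ gramS) := {g | g.1 baseVec ∈ X ∪ Neg.neg ⁻¹' X}
  have : Finite K := finite_setOf_map_mem (hX.union (hX.preimage neg_injective.injOn))
  refine @Subgroup.finiteIndex_of_finite_quotient _ _ _ (Finite.of_surjective
    (fun k : K => (QuotientGroup.mk k.1⁻¹ : _ ⧸ Wr _ gramS)) fun q => ?_)
  obtain ⟨g, rfl⟩ := QuotientGroup.mk_surjective q
  have hg : latB (g⁻¹.1 baseVec) (g⁻¹.1 baseVec) = 4 := (latB_map _ _ _).trans latB_baseVec_self
  obtain ⟨w, hw, h⟩ := exists_mem_chamber (hg ▸ four_pos)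
  have hn : latB ((w * g⁻¹).1 baseVec) ((w * g⁻¹).1 baseVec) = 4 :=
    (latB_map _ _ _).trans latB_baseVec_self
  refine ⟨⟨w * g⁻¹, h.imp (fun h => ⟨h, hn⟩) fun h => ⟨h, ?_⟩⟩, ?_⟩
  · rw [map_neg, map_neg, LinearMap.neg_apply, neg_neg]
    exact hn
  · rw [QuotientGroup.eq]
    simpa using hw

end ReflectiveLattice

/-- The lattice `U ⊕ D₈ ⊕ D₈` is reflective: the subgroup `W_r` of `O(S)`
generated by the reflections in all roots has finite index in `O(S)`. -/
theorem reflective_18_4_0 : (Wr _ gramS).FiniteIndex :=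
  ReflectiveLattice.finiteIndex_Wr
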